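/- arXiv:2009.14140 — 5 statements merged into one kernel-verified Lean document; each statement's English description precedes it below -/
import Mathlib

section
/- For all real numbers α, β with 0 ≤ α ≤ β, there exists a constant c > 0 (depending only on α and β) such that for every integer p ≥ 1 and every real polynomial q in one variable of degree at most p, ∫_{-1}^{1} (1 - x²)^α q(x)² dx ≤ c · p^{2(β−α)} · ∫_{-1}^{1} (1 - x²)^β q(x)² dx. -/
open MeasureTheory

/-- Endpoint Markov inequality, homogeneous version. -/
lemma endpoint_markov {p : ℕ} {q : Polynomial ℝ} (hq : q.natDegree ≤ p) {M : ℝ} (hM : 0 < M)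
    (hb : ∀ x ∈ Set.Icc (-1 : ℝ) 1, |q.eval x| ≤ M) :
    |q.derivative.eval 1| ≤ (p : ℝ) ^ 2 * M := by
  have key : ∀ r : Polynomial ℝ, r.natDegree ≤ p →
      (∀ x ∈ Set.Icc (-1 : ℝ) 1, |r.eval x| ≤ M) → r.derivative.eval 1 ≤ (p : ℝ) ^ 2 * M := by
    intro r hr hrb
    have h := Polynomial.Chebyshev.eval_iterate_derivative_le_of_forall_abs_le_one
      (n := p) (P := Polynomial.C M⁻¹ * r) (k := 1) (x := 1) le_rfl
      ((Polynomial.degree_le_of_natDegree_le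
        ((Polynomial.natDegree_C_mul_le _ _).trans hr)))
      (by
        intro x hx
        rw [Polynomial.eval_mul, Polynomial.eval_C, abs_mul, abs_of_pos (inv_pos.2 hM),
          inv_mul_le_iff₀ hM, mul_one]
        exact hrb x hx)
    have hT : (Polynomial.derivative (Polynomial.Chebyshev.T ℝ p)).eval 1 = (p : ℝ) ^ 2 := by
      have := Polynomial.Chebyshev.derivative_T_eval_one (R := ℝ) (p : ℤ)
      simpa using this
    simp only [Function.iterate_one, Polynomial.derivative_C_mul, Polynomial.eval_mul,
      Polynomial.eval_C, hT] at h
    rw [inv_mul_le_iff₀ hM] at h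
    linarith
  rw [abs_le]
  constructor
  · have := key (-q) (by simpa using hq) (by simpa using hb)
    simp at this
    linarith
  · exact key q hq hb

/-- Markov inequality at points of `[0,1]`, up to a factor 2 in the constant. -/
lemma markov_aux {p : ℕ} {q : Polynomial ℝ} (hq : q.natDegree ≤ p) {M : ℝ} (hM : 0 < M)
    (hb : ∀ x ∈ Set.Icc (-1 : ℝ) 1, |q.eval x| ≤ M) {s y : ℝ} (hs : |s| = 1) (hy : 0 ≤ y)
    (hy1 : y ≤ 1) :
    |q.derivative.eval (s * y)| ≤ 2 * (p : ℝ) ^ 2 * M := by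
  -- affine map sending `1` to `s * y` and `-1` to `-s`
  set l : Polynomial ℝ := Polynomial.C (s * ((y + 1) / 2)) * Polynomial.X +
    Polynomial.C (s * ((y - 1) / 2)) with hl
  have hld : l.natDegree ≤ 1 := Polynomial.natDegree_linear_le
  have hev : ∀ t, l.eval t = s * ((y + 1) / 2 * t + (y - 1) / 2) := by
    intro t; simp [hl]; ring
  have h := endpoint_markov (p := p) (q := q.comp l) (by
      rw [Polynomial.natDegree_comp]
      calc q.natDegree * l.natDegree ≤ q.natDegree * 1 := Nat.mul_le_mul_left _ hld
        _ ≤ p := by simpa using hq) hM (by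
      intro t ht
      rw [Polynomial.eval_comp]
      apply hb
      rw [Set.mem_Icc, ← abs_le, hev, abs_mul, hs, one_mul, abs_le]
      constructor <;> nlinarith [ht.1, ht.2])
  have hd : l.derivative.eval 1 = s * ((y + 1) / 2) := by simp [hl]
  rw [Polynomial.derivative_comp, Polynomial.eval_mul, Polynomial.eval_comp, hd, abs_mul, abs_mul,
    hs, hev, show (y + 1) / 2 * 1 + (y - 1) / 2 = y by ring, abs_of_pos (by linarith), one_mul] at h
  nlinarith [abs_nonneg (q.derivative.eval (s * y))]

lemma markov_weak {p : ℕ} {q : Polynomial ℝ} (hq : q.natDegree ≤ p) {M : ℝ} (hM : 0 < M)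
    (hb : ∀ x ∈ Set.Icc (-1 : ℝ) 1, |q.eval x| ≤ M) {x : ℝ} (hx : x ∈ Set.Icc (-1 : ℝ) 1) :
    |q.derivative.eval x| ≤ 2 * (p : ℝ) ^ 2 * M := by
  rcases le_total 0 x with h | h
  · simpa using markov_aux hq hM hb (s := 1) (by simp) h hx.2
  · simpa using markov_aux hq hM hb (s := -1) (y := -x) (by simp) (by linarith) (by linarith [hx.1])

lemma bubble_cont {α : ℝ} (hα : 0 ≤ α) (q : Polynomial ℝ) :
    Continuous (fun x : ℝ => (1 - x ^ 2) ^ α * (q.eval x) ^ 2) := by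
  have h1 : Continuous (fun x : ℝ => (1 - x ^ 2) ^ α) :=
    Continuous.rpow_const (by fun_prop) (fun x => Or.inr hα)
  have := q.continuous
  fun_prop

lemma one_sub_sq_ge {x : ℝ} (hx : |x| ≤ 1) : 1 - |x| ≤ 1 - x ^ 2 := by
  rw [← sq_abs]; nlinarith [abs_nonneg x]

/-- Lower bound for the weighted integral near a maximum point. -/
lemma nikolskii_aux {α : ℝ} (hα : 0 ≤ α) {p : ℕ} (hp : 1 ≤ p) {q : Polynomial ℝ}
    (hq : q.natDegree ≤ p) {x₀ : ℝ} (hx₀ : x₀ ∈ Set.Icc (-1 : ℝ) 1) (hM : 0 < |q.eval x₀|)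
    (hb : ∀ x ∈ Set.Icc (-1 : ℝ) 1, |q.eval x| ≤ |q.eval x₀|) {h a : ℝ}
    (hh : h = 1 / (8 * (p : ℝ) ^ 2))
    (ha : ∀ x ∈ Set.Icc a (a + h), |x| ≤ 1 - h ∧ |x - x₀| ≤ 2 * h) :
    h ^ (α + 1) * (q.eval x₀ ^ 2 / 4) ≤
      ∫ x in Set.Icc (-1 : ℝ) 1, (1 - x ^ 2) ^ α * (q.eval x) ^ 2 := by
  have hp0 : (0 : ℝ) < p := by exact_mod_cast hp
  have hpos : 0 < h := by rw [hh]; positivity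
  have hph : (p : ℝ) ^ 2 * h = 1 / 8 := by rw [hh]; field_simp
  have hsub : Set.Icc a (a + h) ⊆ Set.Icc (-1 : ℝ) 1 := by
    intro x hx
    rw [Set.mem_Icc, ← abs_le]; linarith [(ha x hx).1]
  have hpt : ∀ x ∈ Set.Icc a (a + h),
      h ^ α * (q.eval x₀ ^ 2 / 4) ≤ (1 - x ^ 2) ^ α * (q.eval x) ^ 2 := by
    intro x hx
    obtain ⟨h1, h2⟩ := ha x hx
    have hlip : ‖q.eval x - q.eval x₀‖ ≤ 2 * (p : ℝ) ^ 2 * |q.eval x₀| * ‖x - x₀‖ := by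
      apply Convex.norm_image_sub_le_of_norm_deriv_le (f := fun x => q.eval x)
        (s := Set.Icc (-1 : ℝ) 1) (fun y _ => q.differentiable y) _ (convex_Icc _ _) hx₀ (hsub hx)
      intro y hy
      rw [Polynomial.deriv]
      exact markov_weak hq hM hb hy
    rw [Real.norm_eq_abs, Real.norm_eq_abs] at hlip
    have h3 : 2 * (p : ℝ) ^ 2 * |q.eval x₀| * |x - x₀| ≤ |q.eval x₀| / 2 := by
      calc 2 * (p : ℝ) ^ 2 * |q.eval x₀| * |x - x₀|
          ≤ 2 * (p : ℝ) ^ 2 * |q.eval x₀| * (2 * h) := by gcongr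
        _ = 4 * ((p : ℝ) ^ 2 * h) * |q.eval x₀| := by ring
        _ = _ := by rw [hph]; ring
    have h4 : |q.eval x₀| / 2 ≤ |q.eval x| := by
      have := abs_sub_abs_le_abs_sub (q.eval x₀) (q.eval x)
      rw [abs_sub_comm] at this
      linarith
    have h5 : q.eval x₀ ^ 2 / 4 ≤ q.eval x ^ 2 := by
      rw [← sq_abs (q.eval x₀), ← sq_abs (q.eval x)]
      nlinarith
    have h6 : h ≤ 1 - x ^ 2 := by
      have := one_sub_sq_ge (x := x) (by linarith)
      linarith
    have h7 : 0 ≤ (1 - x ^ 2) ^ α := Real.rpow_nonneg (by linarith) _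
    gcongr
  have hint : ∀ u v : ℝ, IntegrableOn (fun x : ℝ => (1 - x ^ 2) ^ α * (q.eval x) ^ 2)
    (Set.Icc u v) := fun u v => (bubble_cont hα q).integrableOn_Icc
  calc h ^ (α + 1) * (q.eval x₀ ^ 2 / 4)
      = ∫ x in Set.Icc a (a + h), h ^ α * (q.eval x₀ ^ 2 / 4) := by
        rw [setIntegral_const, Real.rpow_add_one hpos.ne']
        simp [Measure.real, hpos.le]
        ring
    _ ≤ ∫ x in Set.Icc a (a + h), (1 - x ^ 2) ^ α * (q.eval x) ^ 2 :=
        setIntegral_mono_on (continuous_const.integrableOn_Icc) (hint _ _) measurableSet_Icc hpt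
    _ ≤ _ := by
        apply setIntegral_mono_set (hint _ _)
        · filter_upwards [ae_restrict_mem measurableSet_Icc] with x hx
          have : 0 ≤ 1 - x ^ 2 := by nlinarith [hx.1, hx.2]
          exact mul_nonneg (Real.rpow_nonneg this _) (sq_nonneg _)
        · exact hsub.eventuallyLE

lemma nikolskii {α : ℝ} (hα : 0 ≤ α) {p : ℕ} (hp : 1 ≤ p) {q : Polynomial ℝ}
    (hq : q.natDegree ≤ p) {x₀ : ℝ} (hx₀ : x₀ ∈ Set.Icc (-1 : ℝ) 1)
    (hb : ∀ x ∈ Set.Icc (-1 : ℝ) 1, |q.eval x| ≤ |q.eval x₀|) {h : ℝ}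
    (hh : h = 1 / (8 * (p : ℝ) ^ 2)) :
    h ^ (α + 1) * (q.eval x₀ ^ 2 / 4) ≤
      ∫ x in Set.Icc (-1 : ℝ) 1, (1 - x ^ 2) ^ α * (q.eval x) ^ 2 := by
  rcases (abs_nonneg (q.eval x₀)).eq_or_lt' with h0 | hM
  · rw [abs_eq_zero] at h0
    rw [h0]
    simp only [ne_eq, OfNat.ofNat_ne_zero, not_false_eq_true, zero_pow, zero_div, mul_zero]
    apply setIntegral_nonneg measurableSet_Icc
    intro x hx
    have : 0 ≤ 1 - x ^ 2 := by nlinarith [hx.1, hx.2]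
    exact mul_nonneg (Real.rpow_nonneg this _) (sq_nonneg _)
  have hp1 : (1 : ℝ) ≤ p := by exact_mod_cast hp
  have hpos : 0 < h := by rw [hh]; positivity
  have hle : h ≤ 1 / 8 := by
    rw [hh]; apply one_div_le_one_div_of_le (by norm_num); nlinarith
  rcases le_total 0 x₀ with hs | hs
  · refine nikolskii_aux hα hp hq hx₀ hM hb hh (a := x₀ - 2 * h) ?_
    intro x hx
    rw [abs_le, abs_le]
    refine ⟨⟨?_, ?_⟩, ?_, ?_⟩ <;> linarith [hx.1, hx.2, hx₀.1, hx₀.2]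
  · refine nikolskii_aux hα hp hq hx₀ hM hb hh (a := x₀ + h) ?_
    intro x hx
    rw [abs_le, abs_le]
    refine ⟨⟨?_, ?_⟩, ?_, ?_⟩ <;> linarith [hx.1, hx.2, hx₀.1, hx₀.2]

/-- Splitting into the bulk and the boundary layer of width `δ`. -/
lemma split_bound {α β : ℝ} (hα : 0 ≤ α) (hαβ : α ≤ β) {q : Polynomial ℝ} {A δ : ℝ}
    (hδ : 0 < δ) (hb : ∀ x ∈ Set.Icc (-1 : ℝ) 1, q.eval x ^ 2 ≤ A) :
    ∫ x in Set.Icc (-1 : ℝ) 1, (1 - x ^ 2) ^ α * (q.eval x) ^ 2 ≤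
      δ ^ (-(β - α)) * (∫ x in Set.Icc (-1 : ℝ) 1, (1 - x ^ 2) ^ β * (q.eval x) ^ 2) +
        2 * δ ^ (α + 1) * A := by
  have hA : 0 ≤ A := (sq_nonneg _).trans (hb 0 (by simp))
  set K : ℝ := δ ^ α * A with hK
  have hK0 : 0 ≤ K := by positivity
  set f₁ : ℝ → ℝ := (Set.Icc (-1 : ℝ) (-1 + δ)).indicator (fun _ => K) with hf₁
  set f₂ : ℝ → ℝ := (Set.Icc (1 - δ) (1 : ℝ)).indicator (fun _ => K) with hf₂
  have hfi : ∀ u v : ℝ, Integrable ((Set.Icc u v).indicator (fun _ => K)) := by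
    intro u v
    rw [integrable_indicator_iff measurableSet_Icc]
    simp
  have hf0 : ∀ (u v x : ℝ), 0 ≤ (Set.Icc u v).indicator (fun _ => K) x :=
    fun u v x => Set.indicator_nonneg (fun _ _ => hK0) x
  have hfK : ∀ u : ℝ, ∫ x in Set.Icc (-1 : ℝ) 1, (Set.Icc u (u + δ)).indicator (fun _ => K) x
      ≤ δ * K := by
    intro u
    calc _ ≤ ∫ x, (Set.Icc u (u + δ)).indicator (fun _ => K) x :=
          setIntegral_le_integral (hfi _ _) (Filter.Eventually.of_forall (hf0 _ _))
      _ = δ * K := by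
          rw [integral_indicator measurableSet_Icc, setIntegral_const]
          simp [Measure.real, hδ.le]
  have hint : ∀ γ : ℝ, 0 ≤ γ → IntegrableOn (fun x : ℝ => (1 - x ^ 2) ^ γ * (q.eval x) ^ 2)
    (Set.Icc (-1) 1) := fun γ hγ => (bubble_cont hγ q).integrableOn_Icc
  have hpt : ∀ x ∈ Set.Icc (-1 : ℝ) 1, (1 - x ^ 2) ^ α * (q.eval x) ^ 2 ≤
      δ ^ (-(β - α)) * ((1 - x ^ 2) ^ β * (q.eval x) ^ 2) + (f₁ x + f₂ x) := by
    intro x hx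
    have hw : 0 ≤ 1 - x ^ 2 := by nlinarith [hx.1, hx.2]
    rcases le_or_gt δ (1 - x ^ 2) with h | h
    · have hwp : 0 < 1 - x ^ 2 := hδ.trans_le h
      have h1 : (1 - x ^ 2) ^ α ≤ δ ^ (-(β - α)) * (1 - x ^ 2) ^ β := by
        calc (1 - x ^ 2) ^ α = (1 - x ^ 2) ^ (-(β - α)) * (1 - x ^ 2) ^ β := by
              rw [← Real.rpow_add hwp]; congr 1; ring
          _ ≤ _ := by
              gcongr ?_ * _
              exact Real.rpow_le_rpow_of_nonpos hδ h (by linarith)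
      have h2 := mul_le_mul_of_nonneg_right h1 (sq_nonneg (q.eval x))
      have h3 := hf0 (-1) (-1 + δ) x
      have h4 := hf0 (1 - δ) 1 x
      simp only [hf₁, hf₂]
      linarith
    · have h1 : (1 - x ^ 2) ^ α * (q.eval x) ^ 2 ≤ K := by
        have := hb x hx
        rw [hK]
        gcongr
      have h0 : 0 ≤ δ ^ (-(β - α)) * ((1 - x ^ 2) ^ β * (q.eval x) ^ 2) := by positivity
      have hx1 := one_sub_sq_ge (abs_le.2 hx)
      have h2 : K ≤ f₁ x + f₂ x := by
        rcases le_total 0 x with hs | hs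
        · rw [abs_of_nonneg hs] at hx1
          have hm : x ∈ Set.Icc (1 - δ) (1 : ℝ) := ⟨by linarith, hx.2⟩
          have : f₂ x = K := Set.indicator_of_mem hm _
          linarith [hf0 (-1) (-1 + δ) x]
        · rw [abs_of_nonpos hs] at hx1
          have hm : x ∈ Set.Icc (-1 : ℝ) (-1 + δ) := ⟨hx.1, by linarith⟩
          have : f₁ x = K := Set.indicator_of_mem hm _
          linarith [hf0 (1 - δ) 1 x]
      linarith
  have hI₁ : IntegrableOn f₁ (Set.Icc (-1) 1) := (hfi _ _).integrableOn
  have hI₂ : IntegrableOn f₂ (Set.Icc (-1) 1) := (hfi _ _).integrableOn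
  have hIβ := (hint β (hα.trans hαβ)).const_mul (δ ^ (-(β - α)))
  have hI₁₂ : IntegrableOn (fun x => f₁ x + f₂ x) (Set.Icc (-1) 1) := hI₁.add hI₂
  have hm := setIntegral_mono_on (hint α hα) (hIβ.add hI₁₂) measurableSet_Icc hpt
  have e : ∫ x in Set.Icc (-1 : ℝ) 1, (δ ^ (-(β - α)) * ((1 - x ^ 2) ^ β * (q.eval x) ^ 2) +
      (f₁ x + f₂ x)) = δ ^ (-(β - α)) * (∫ x in Set.Icc (-1 : ℝ) 1,
        (1 - x ^ 2) ^ β * (q.eval x) ^ 2) + ((∫ x in Set.Icc (-1 : ℝ) 1, f₁ x) +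
        ∫ x in Set.Icc (-1 : ℝ) 1, f₂ x) := by
    rw [integral_add hIβ hI₁₂, integral_add hI₁ hI₂, integral_const_mul]
  have k1 := hfK (-1)
  have k2 := hfK (1 - δ)
  rw [sub_add_cancel] at k2
  have hKe : δ * K + δ * K = 2 * δ ^ (α + 1) * A := by
    rw [hK, Real.rpow_add_one hδ.ne']; ring
  refine hm.trans (e.le.trans ?_)
  linarith

/-- $hp$-explicit 1D polynomial inverse estimate with the bubble
weight $(1-x^2)$ (first inequality of Lemma 3.3 of the paper). -/
theorem jacobi_bubble_inverse_estimate_1D :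
    ∀ α β : ℝ, 0 ≤ α → α ≤ β →
      ∃ c : ℝ, 0 < c ∧
        ∀ p : ℕ, 1 ≤ p → ∀ q : Polynomial ℝ, q.natDegree ≤ p →
          ∫ x in Set.Icc (-1 : ℝ) 1, (1 - x ^ 2) ^ α * (q.eval x) ^ 2 ≤
            c * (p : ℝ) ^ (2 * (β - α)) *
              ∫ x in Set.Icc (-1 : ℝ) 1, (1 - x ^ 2) ^ β * (q.eval x) ^ 2 := by
  intro α β hα hαβ
  refine ⟨2 * 128 ^ (β - α), by positivity, ?_⟩
  intro p hp q hq
  have hp0 : (0 : ℝ) < p := by exact_mod_cast hp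
  obtain ⟨x₀, hx₀, hmax⟩ := isCompact_Icc.exists_isMaxOn (Set.nonempty_Icc.2 (by norm_num))
    (q.continuous.abs.continuousOn (s := Set.Icc (-1 : ℝ) 1))
  have hb : ∀ x ∈ Set.Icc (-1 : ℝ) 1, |q.eval x| ≤ |q.eval x₀| := fun x hx => hmax hx
  set h : ℝ := 1 / (8 * (p : ℝ) ^ 2) with hh
  have hpos : 0 < h := by positivity
  have hN := nikolskii hα hp hq hx₀ hb hh
  have hS := split_bound hα hαβ (q := q) (A := q.eval x₀ ^ 2) (δ := h / 16) (by positivity)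
    (fun x hx => sq_le_sq.2 (hb x hx))
  have h16 : (h / 16) ^ (α + 1) ≤ h ^ (α + 1) / 16 := by
    rw [Real.div_rpow hpos.le (by norm_num)]
    gcongr
    calc (16 : ℝ) = 16 ^ (1 : ℝ) := by simp
      _ ≤ 16 ^ (α + 1) := Real.rpow_le_rpow_of_exponent_le (by norm_num) (by linarith)
  have hd : (h / 16) ^ (-(β - α)) = 128 ^ (β - α) * (p : ℝ) ^ (2 * (β - α)) := by
    rw [Real.rpow_neg (by positivity), ← Real.inv_rpow (by positivity), Real.rpow_mul hp0.le,
      ← Real.mul_rpow (by norm_num) (by positivity)]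
    congr 1
    rw [hh, Real.rpow_two]
    field_simp
    norm_num
  rw [hd] at hS
  have h5 : 2 * (h / 16) ^ (α + 1) * q.eval x₀ ^ 2 ≤
      2 * (h ^ (α + 1) / 16) * q.eval x₀ ^ 2 := by gcongr
  linarith
end

section
/- Let d ∈ (0,1) and a, b ∈ ℝ satisfy −1 + a·d < 1 + b·d, and let D = {(x,y) ∈ ℝ² : 0 ≤ y ≤ d and a·y − 1 ≤ x ≤ 1 + b·y}. For y ∈ [0,d] set L(y) = 2 + (b−a)y, m(y) = (a+b)y/2, and ψ(x,y) = 1 − (2(x − m(y))/L(y))². Let s ≥ 1 be an integer and let Φ : D → ℝ be continuous such that: (i) for each y* ∈ [0,d], the function x ↦ Φ(x,y*) coincides on the slice [a·y* − 1, 1 + b·y*] with a real polynomial of degree at most 2s, and (ii) there exist constants c₁, c₂ > 0 with c₁·ψ(x,y)^s ≤ Φ(x,y) ≤ c₂·ψ(x,y)^s for all (x,y) ∈ D. Then for all real numbers β > α ≥ 0 there exists a constant c > 0 (depending only on α, β, s, c₁, c₂, a, b, d) such that for every integer p ≥ 1 and every real polynomial q in two variables of total degree at most p, ∫_D Φ(x,y)^α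 q(x,y)² dx dy ≤ c · p^{2s(β−α)} · ∫_D Φ(x,y)^β q(x,y)² dx dy. -/
open MeasureTheory

/-- The quasi-1D trapezoid `D = D(a,b,d)` of height `d`, whose horizontal
slice at height `y` is the interval `[a*y - 1, 1 + b*y]`. -/
def trapezoid (a b d : ℝ) : Set (ℝ × ℝ) :=
  {z | 0 ≤ z.2 ∧ z.2 ≤ d ∧ a * z.2 - 1 ≤ z.1 ∧ z.1 ≤ 1 + b * z.2}

/-- The parabolic bubble `ψ(x,y) = 1 - (2(x - m(y))/L(y))²` on the slice at
height `y`, with `L(y) = 2 + (b-a)y` and `m(y) = (a+b)y/2`. -/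
noncomputable def slicedBubble (a b : ℝ) (x y : ℝ) : ℝ :=
  1 - (2 * (x - (a + b) * y / 2) / (2 + (b - a) * y)) ^ 2


lemma biet_markov (P : Polynomial ℝ) (n : ℕ) (hP : P.natDegree ≤ n) (M : ℝ) (hM : 0 < M)
    (hb : ∀ x ∈ Set.Icc (-1:ℝ) 1, |P.eval x| ≤ M) (x : ℝ) (hx : x ∈ Set.Icc (-1:ℝ) 1) :
    |P.derivative.eval x| ≤ 2 * (n:ℝ)^2 * M := by
  obtain ⟨h, hh, hmem⟩ : ∃ h : ℝ, 1/2 ≤ |h| ∧ ∀ t ∈ Set.Icc (-1:ℝ) 1,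
      h * t + (x - h) ∈ Set.Icc (-1:ℝ) 1 := by
    obtain ⟨h1, h2⟩ := hx
    rcases le_total 0 x with h0 | h0
    · refine ⟨(x+1)/2, ?_, ?_⟩
      · rw [abs_of_nonneg (by linarith)]; linarith
      · rintro t ⟨t1, t2⟩
        constructor <;> nlinarith
    · refine ⟨(x-1)/2, ?_, ?_⟩
      · rw [abs_of_nonpos (by linarith)]; linarith
      · rintro t ⟨t1, t2⟩
        constructor <;> nlinarith
  have key : ∀ e : ℝ, |e| = 1 → e * h * P.derivative.eval x ≤ (n:ℝ)^2 * M := by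
    intro e he
    set R : Polynomial ℝ := Polynomial.C (e * M⁻¹) *
      P.comp (Polynomial.C h * Polynomial.X + Polynomial.C (x - h)) with hR
    have hdeg : R.degree ≤ n := by
      apply Polynomial.degree_le_of_natDegree_le
      refine (Polynomial.natDegree_C_mul_le _ _).trans ?_
      refine Polynomial.natDegree_comp_le.trans ?_
      calc _ ≤ P.natDegree * 1 := Nat.mul_le_mul_left _ Polynomial.natDegree_linear_le
        _ ≤ n := by simpa using hP
    have hbd : ∀ t ∈ Set.Icc (-1:ℝ) 1, |R.eval t| ≤ 1 := by
      intro t ht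
      have := hb _ (hmem t ht)
      simp only [hR, Polynomial.eval_mul, Polynomial.eval_C, Polynomial.eval_comp,
        Polynomial.eval_add, Polynomial.eval_X, abs_mul, he, one_mul, abs_inv, abs_of_pos hM]
      rw [inv_mul_le_iff₀ hM]; linarith
    have := Polynomial.Chebyshev.eval_iterate_derivative_le_of_forall_abs_le_one (k := 1)
      (le_refl (1:ℝ)) hdeg hbd
    rw [Function.iterate_one, Polynomial.Chebyshev.derivative_T_eval_one] at this
    simp only [hR, Polynomial.derivative_C_mul, Polynomial.derivative_comp, Polynomial.eval_mul, 
      Polynomial.eval_C, Polynomial.eval_comp, Polynomial.derivative_add, Polynomial.derivative_X,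
      Polynomial.derivative_C, Polynomial.eval_add, Polynomial.eval_X, mul_one, add_zero, add_sub_cancel] at this
    have h2 := mul_le_mul_of_nonneg_right this hM.le
    push_cast at h2
    refine le_trans (le_of_eq ?_) h2
    field_simp
  have k1 := key 1 (by simp)
  have k2 := key (-1) (by simp)
  have : |h| * |P.derivative.eval x| ≤ (n:ℝ)^2 * M := by
    rw [← abs_mul]; exact abs_le.2 ⟨by linarith, by linarith⟩
  nlinarith [abs_nonneg (P.derivative.eval x)]

lemma biet_lip (P : Polynomial ℝ) (n : ℕ) (hP : P.natDegree ≤ n) (M : ℝ) (hM : 0 < M)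
    (hb : ∀ x ∈ Set.Icc (-1:ℝ) 1, |P.eval x| ≤ M) (x y : ℝ) (hx : x ∈ Set.Icc (-1:ℝ) 1)
    (hy : y ∈ Set.Icc (-1:ℝ) 1) :
    |P.eval y - P.eval x| ≤ 2 * (n:ℝ)^2 * M * |y - x| := by
  have := Convex.norm_image_sub_le_of_norm_hasDerivWithin_le (𝕜 := ℝ) (f := fun x => P.eval x)
    (f' := fun x => P.derivative.eval x) (C := 2 * (n:ℝ)^2 * M) (s := Set.Icc (-1:ℝ) 1)
    (fun x _ => (P.hasDerivAt x).hasDerivWithinAt)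
    (fun x hx => biet_markov P n hP M hM hb x hx) (convex_Icc _ _) hx hy
  simpa using this

/-- sup bound -/
lemma biet_sup (P : Polynomial ℝ) (p : ℕ) (hp : 1 ≤ p) (hP : P.natDegree ≤ p) (δ : ℝ) (hδ : 0 ≤ δ) :
    ∃ M : ℝ, 0 ≤ M ∧ (∀ x ∈ Set.Icc (-1:ℝ) 1, |P.eval x| ≤ M) ∧
     M^2 ≤ 32 * (p:ℝ)^2 * (16 * (p:ℝ)^2)^δ *
        ∫ x in Set.Icc (-1:ℝ) 1, (1 - x^2)^δ * (P.eval x)^2 := by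
  obtain ⟨x0, hx0, hmax⟩ := isCompact_Icc.exists_isMaxOn (s := Set.Icc (-1:ℝ) 1) ⟨0, by norm_num⟩
    (f := fun x => |P.eval x|) (by fun_prop)
  have hmax : ∀ x ∈ Set.Icc (-1:ℝ) 1, |P.eval x| ≤ |P.eval x0| := fun x hx => hmax hx
  refine ⟨|P.eval x0|, abs_nonneg _, hmax, ?_⟩
  set M := |P.eval x0| with hMdef
  have hw : ∀ x ∈ Set.Icc (-1:ℝ) 1, 0 ≤ 1 - x^2 := fun x hx => by nlinarith [hx.1, hx.2]
  have hJ0 : 0 ≤ ∫ x in Set.Icc (-1:ℝ) 1, (1 - x^2)^δ * (P.eval x)^2 :=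
    setIntegral_nonneg measurableSet_Icc fun x hx =>
      mul_nonneg (Real.rpow_nonneg (hw x hx) _) (sq_nonneg _)
  rcases (abs_nonneg (P.eval x0)).eq_or_lt with h0 | hM
  · rw [hMdef, ← h0]; simp; positivity
  rw [← hMdef] at hM
  have hp1 : (1:ℝ) ≤ p := by exact_mod_cast hp
  have hpp : (1:ℝ) ≤ (p:ℝ)^2 := by nlinarith
  obtain ⟨ℓ, hℓ⟩ : ∃ ℓ : ℝ, ℓ = 1 / (4 * (p:ℝ)^2) := ⟨_, rfl⟩
  have hℓ0 : 0 < ℓ := by rw [hℓ]; positivity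
  have hℓ1 : ℓ ≤ 1/4 := by
    rw [hℓ]; apply div_le_div_of_nonneg_left <;> linarith
  have hℓp : ℓ * (4 * (p:ℝ)^2) = 1 := by rw [hℓ]; field_simp
  obtain ⟨u, hu⟩ : ∃ u : ℝ, ∀ x ∈ Set.Icc u (u + ℓ/2), x ∈ Set.Icc (-1:ℝ) 1 ∧ |x - x0| ≤ ℓ ∧
      ℓ/4 ≤ 1 - x^2 := by
    obtain ⟨a1, a2⟩ := hx0
    rcases le_total 0 x0 with h | h
    · refine ⟨x0 - ℓ, fun x ⟨h1, h2⟩ => ⟨⟨by linarith, by linarith⟩, abs_le.2 ⟨by linarith, by linarith⟩, by nlinarith⟩⟩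
    · refine ⟨x0 + ℓ/2, fun x ⟨h1, h2⟩ => ⟨⟨by linarith, by linarith⟩, abs_le.2 ⟨by linarith, by linarith⟩, by nlinarith⟩⟩
  have hlow : ∀ x ∈ Set.Icc u (u + ℓ/2), (ℓ/4)^δ * (M/2)^2 ≤ (1 - x^2)^δ * (P.eval x)^2 := by
    intro x hx
    obtain ⟨b1, b2, b3⟩ := hu x hx
    have hl := biet_lip P p hP M hM hmax x0 x hx0 b1
    have h1 : |P.eval x - P.eval x0| ≤ M/2 := by
      refine hl.trans ?_
      have : 2 * (p:ℝ)^2 * M * |x - x0| ≤ 2 * (p:ℝ)^2 * M * ℓ := by gcongr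
      nlinarith
    have h2 : M/2 ≤ |P.eval x| := by
      have := abs_sub_abs_le_abs_sub (P.eval x0) (P.eval x)
      rw [abs_sub_comm] at this
      linarith
    rw [← sq_abs (P.eval x)]
    have b4 := Real.rpow_nonneg (hw x b1) δ
    gcongr
  have hcont : Continuous fun x : ℝ => (1 - x^2)^δ * (P.eval x)^2 := by
    refine Continuous.mul (Continuous.rpow_const (by fun_prop) fun _ => Or.inr hδ) (by fun_prop)
  have hI : IntegrableOn (fun x : ℝ => (1 - x^2)^δ * (P.eval x)^2) (Set.Icc (-1:ℝ) 1) :=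
    hcont.continuousOn.integrableOn_Icc
  have hsub : Set.Icc u (u + ℓ/2) ⊆ Set.Icc (-1:ℝ) 1 := fun x hx => (hu x hx).1
  have hJ : ℓ/2 * ((ℓ/4)^δ * (M/2)^2) ≤ ∫ x in Set.Icc (-1:ℝ) 1, (1 - x^2)^δ * (P.eval x)^2 := by
    calc ℓ/2 * ((ℓ/4)^δ * (M/2)^2) = ∫ x in Set.Icc u (u + ℓ/2), (ℓ/4)^δ * (M/2)^2 := by
          rw [setIntegral_const, measureReal_def, Real.volume_Icc, ENNReal.toReal_ofReal (by linarith)]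
          simp
      _ ≤ ∫ x in Set.Icc u (u + ℓ/2), (1 - x^2)^δ * (P.eval x)^2 := by
          refine setIntegral_mono_on ?_ (hI.mono_set hsub) measurableSet_Icc hlow
          exact continuousOn_const.integrableOn_Icc
      _ ≤ _ := by
          refine setIntegral_mono_set hI ?_ hsub.eventuallyLE
          filter_upwards [ae_restrict_mem measurableSet_Icc] with x hx
          exact mul_nonneg (Real.rpow_nonneg (hw x hx) _) (sq_nonneg _)
  have hprod : (16 * (p:ℝ)^2)^δ * (ℓ/4)^δ = 1 := by
    rw [← Real.mul_rpow (by positivity) (by positivity)]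
    rw [show 16 * (p:ℝ)^2 * (ℓ/4) = 1 by linarith, Real.one_rpow]
  calc M^2 = 32 * (p:ℝ)^2 * (16 * (p:ℝ)^2)^δ * (ℓ/2 * ((ℓ/4)^δ * (M/2)^2)) := by
        linear_combination (-M^2 ) * hprod - (16 * (p:ℝ)^2)^δ * (ℓ/4)^δ * M^2 * hℓp
    _ ≤ _ := by gcongr

lemma biet_one (P : Polynomial ℝ) (p : ℕ) (hp : 1 ≤ p) (hP : P.natDegree ≤ p) (γ δ : ℝ)
    (hγ : 0 ≤ γ) (hγδ : γ ≤ δ) :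
    ∫ x in Set.Icc (-1:ℝ) 1, (1 - x^2)^γ * (P.eval x)^2 ≤
      (1 + 64 * 16^δ) * ((p:ℝ)^2)^(δ - γ) *
        ∫ x in Set.Icc (-1:ℝ) 1, (1 - x^2)^δ * (P.eval x)^2 := by
  have hδ := hγ.trans hγδ
  obtain ⟨M, hM0, hM, hMJ⟩ := biet_sup P p hp hP δ hδ
  have hp1 : (1:ℝ) ≤ p := by exact_mod_cast hp
  set N := (p:ℝ)^2 with hN
  have hN1 : 1 ≤ N := by nlinarith
  have hN0 : 0 < N := by linarith
  have hw : ∀ x ∈ Set.Icc (-1:ℝ) 1, 0 ≤ 1 - x^2 := fun x hx => by nlinarith [hx.1, hx.2]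
  have hcont : ∀ e : ℝ, 0 ≤ e → IntegrableOn (fun x : ℝ => (1 - x^2)^e * (P.eval x)^2)
      (Set.Icc (-1:ℝ) 1) := fun e he => by
    refine Continuous.integrableOn_Icc ?_
    exact Continuous.mul (Continuous.rpow_const (by fun_prop) fun _ => Or.inr he) (by fun_prop)
  set A := Set.Icc (-1:ℝ) (-1 + 1/N)
  set B := Set.Icc (1 - 1/N) (1:ℝ)
  set K := M^2 * (1/N)^γ
  have hK : 0 ≤ K := by positivity
  have hnn : ∀ (S : Set ℝ) x, 0 ≤ S.indicator (fun _ => K) x := fun S x =>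
    Set.indicator_nonneg (fun _ _ => hK) x
  set J := ∫ x in Set.Icc (-1:ℝ) 1, (1 - x^2)^δ * (P.eval x)^2
  have hint : ∀ u v : ℝ, IntegrableOn ((Set.Icc u v).indicator (fun _ => K)) (Set.Icc (-1:ℝ) 1) := by
    intro u v
    refine Integrable.integrableOn ?_
    rw [integrable_indicator_iff measurableSet_Icc]
    exact continuousOn_const.integrableOn_Icc
  have hval : ∀ u v : ℝ, v - u = 1/N → 
      ∫ x in Set.Icc (-1:ℝ) 1, (Set.Icc u v).indicator (fun _ => K) x ≤ 1/N * K := by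
    intro u v huv
    rw [integral_indicator_const _ measurableSet_Icc, smul_eq_mul]
    refine mul_le_mul_of_nonneg_right ?_ hK
    refine (measureReal_mono (μ := volume.restrict (Set.Icc (-1:ℝ) 1)) (le_refl (Set.Icc u v))).trans ?_
    rw [measureReal_restrict_apply measurableSet_Icc]
    refine (measureReal_mono Set.inter_subset_left (by simp [Real.volume_Icc])).trans ?_
    rw [measureReal_def, Real.volume_Icc, huv, ENNReal.toReal_ofReal (by positivity)]
  have hpt : ∀ x ∈ Set.Icc (-1:ℝ) 1, (1 - x^2)^γ * (P.eval x)^2 ≤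
      N^(δ-γ) * ((1 - x^2)^δ * (P.eval x)^2) + (A.indicator (fun _ => K) x + B.indicator (fun _ => K) x) := by
    intro x hx
    have hwx := hw x hx
    have hpos : 0 ≤ N^(δ-γ) * ((1 - x^2)^δ * (P.eval x)^2) := by positivity
    rcases le_or_gt (1/N) (1 - x^2) with h | h
    · have h1 : 0 < 1 - x^2 := lt_of_lt_of_le (by positivity) h
      have h2 : 1 ≤ (N * (1 - x^2))^(δ-γ) := by
        apply Real.one_le_rpow _ (by linarith)
        rw [div_le_iff₀ hN0] at h; linarith
      have h3 : (1-x^2)^γ ≤ N^(δ-γ) * (1 - x^2)^δ := by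
        have : (1-x^2)^δ = (1-x^2)^(δ-γ) * (1-x^2)^γ := by
          rw [← Real.rpow_add h1]; ring_nf
        rw [this, ← mul_assoc, ← Real.mul_rpow hN0.le h1.le]
        exact le_mul_of_one_le_left (by positivity) h2
      have h4 := mul_le_mul_of_nonneg_right h3 (sq_nonneg (P.eval x))
      have := hnn A x
      have := hnn B x
      linarith
    · have h1 : (1 - x^2)^γ * (P.eval x)^2 ≤ K := by
        rw [mul_comm, ← sq_abs (P.eval x)]
        have := hM x hx
        simp only [K]
        gcongr
      have : K ≤ A.indicator (fun _ => K) x + B.indicator (fun _ => K) x := by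
        obtain ⟨x1, x2⟩ := hx
        rcases le_total 0 x with h0 | h0
        · have : x ∈ B := ⟨by nlinarith, x2⟩
          rw [Set.indicator_of_mem this]; linarith [hnn A x]
        · have : x ∈ A := ⟨x1, by nlinarith⟩
          rw [Set.indicator_of_mem this]; linarith [hnn B x]
      linarith
  have h1 : ∫ x in Set.Icc (-1:ℝ) 1, (1 - x^2)^γ * (P.eval x)^2 ≤ N^(δ-γ) * J + (1/N*K + 1/N*K) := by
    refine (setIntegral_mono_on (hcont γ hγ) (((hcont δ hδ).const_mul _).add ((hint _ _).add (hint _ _)))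
      measurableSet_Icc hpt).trans ?_
    have hAB : IntegrableOn (fun x => A.indicator (fun _ => K) x + B.indicator (fun _ => K) x)
      (Set.Icc (-1:ℝ) 1) := (hint _ _).add (hint _ _)
    refine (integral_add ((hcont δ hδ).const_mul (N^(δ-γ))) hAB).trans_le ?_
    rw [integral_add (hint _ _) (hint _ _), integral_const_mul]
    gcongr
    · exact hval _ _ (by ring)
    · exact hval _ _ (by ring)
  refine h1.trans ?_
  have h2 : 1/N*K ≤ 32 * 16^δ * N^(δ-γ) * J := by
    calc 1/N*K = M^2 * (1/N * (1/N)^γ) := by simp only [K]; ring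
      _ ≤ (32 * N * (16 * N)^δ * J) * (1/N * (1/N)^γ) := by gcongr
      _ = 32 * 16^δ * N^(δ-γ) * J := by
        rw [Real.mul_rpow (by norm_num) hN0.le, Real.rpow_sub hN0, Real.div_rpow (by norm_num) hN0.le,
          Real.one_rpow]
        field_simp
  linarith

lemma biet_interval (P : Polynomial ℝ) (p : ℕ) (hp : 1 ≤ p) (hP : P.natDegree ≤ p) (γ δ : ℝ)
    (hγ : 0 ≤ γ) (hγδ : γ ≤ δ) (m L : ℝ) (hL : 0 < L) :
    ∫ x in Set.Icc (m - L/2) (m + L/2), (1 - (2 * (x - m) / L)^2)^γ * (P.eval x)^2 ≤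
      (1 + 64 * 16^δ) * ((p:ℝ)^2)^(δ - γ) *
        ∫ x in Set.Icc (m - L/2) (m + L/2), (1 - (2 * (x - m) / L)^2)^δ * (P.eval x)^2 := by
  set R := P.comp (Polynomial.C (L/2) * Polynomial.X + Polynomial.C m) with hR
  have hdeg : R.natDegree ≤ p := by
    refine Polynomial.natDegree_comp_le.trans ?_
    calc _ ≤ P.natDegree * 1 := Nat.mul_le_mul_left _ Polynomial.natDegree_linear_le
      _ ≤ p := by simpa using hP
  have key : ∀ e : ℝ, ∫ x in Set.Icc (m - L/2) (m + L/2), (1 - (2 * (x - m) / L)^2)^e * (P.eval x)^2 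
      = L/2 * ∫ x in Set.Icc (-1:ℝ) 1, (1 - x^2)^e * (R.eval x)^2 := by
    intro e
    rw [integral_Icc_eq_integral_Ioc, integral_Icc_eq_integral_Ioc,
      ← intervalIntegral.integral_of_le (by linarith), ← intervalIntegral.integral_of_le (by norm_num)]
    have := intervalIntegral.integral_comp_mul_add (a := -1) (b := 1)
      (fun x => (1 - (2 * (x - m) / L)^2)^e * (P.eval x)^2) (c := L/2) (by positivity) m
    rw [show L/2 * (-1) + m = m - L/2 by ring, show L/2*1 + m = m + L/2 by ring, smul_eq_mul] at this
    rw [eq_inv_mul_iff_mul_eq₀ (by positivity)] at this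
    rw [← this]
    congr 1
    apply intervalIntegral.integral_congr
    intro x _
    have h1 : 2 * (L/2 * x + m - m) / L = x := by field_simp; ring
    simp only [h1, hR, Polynomial.eval_comp, Polynomial.eval_add, Polynomial.eval_mul,
      Polynomial.eval_C, Polynomial.eval_X]
  rw [key, key]
  have := mul_le_mul_of_nonneg_left (biet_one R p hp hdeg γ δ hγ hγδ) (by positivity : 0 ≤ L/2)
  linarith

lemma biet_slice (q : MvPolynomial (Fin 2) ℝ) (p : ℕ) (hq : q.totalDegree ≤ p) (y : ℝ) :
    ∃ P : Polynomial ℝ, P.natDegree ≤ p ∧ ∀ x, MvPolynomial.eval ![x, y] q = P.eval x := by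
  refine ⟨MvPolynomial.aeval ![Polynomial.X, Polynomial.C y] q, ?_, fun x => ?_⟩
  · have := MvPolynomial.aeval_natDegree_le (n := 1) q hq ![Polynomial.X, Polynomial.C y] (by
      intro i; fin_cases i <;> simp)
    simpa using this
  · have h : (Polynomial.evalRingHom x).comp
        (MvPolynomial.aeval ![Polynomial.X, Polynomial.C y] :
          MvPolynomial (Fin 2) ℝ →ₐ[ℝ] Polynomial ℝ).toRingHom
        = MvPolynomial.eval ![x, y] := by
      apply MvPolynomial.ringHom_ext
      · intro r; simp
      · intro i; fin_cases i <;> simp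
    rw [← h]; simp

lemma biet_compact (a b d : ℝ) : IsCompact (trapezoid a b d) := by
  have hc : IsClosed (trapezoid a b d) := by
    have h1 : IsClosed {z : ℝ × ℝ | 0 ≤ z.2} := isClosed_le (by fun_prop) (by fun_prop)
    have h2 : IsClosed {z : ℝ × ℝ | z.2 ≤ d} := isClosed_le (by fun_prop) (by fun_prop)
    have h3 : IsClosed {z : ℝ × ℝ | a * z.2 - 1 ≤ z.1} := isClosed_le (by fun_prop) (by fun_prop)
    have h4 : IsClosed {z : ℝ × ℝ | z.1 ≤ 1 + b * z.2} := isClosed_le (by fun_prop) (by fun_prop)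
    exact h1.inter (h2.inter (h3.inter h4))
  refine IsCompact.of_isClosed_subset (s := Set.Icc (-(|a| * |d|) - 1) (1 + |b| * |d|) ×ˢ Set.Icc 0 d)
    (isCompact_Icc.prod isCompact_Icc) hc ?_
  rintro ⟨x, y⟩ ⟨h1, h2, h3, h4⟩
  simp only at h1 h2 h3 h4
  have hy : |y| ≤ |d| := by rw [abs_of_nonneg h1, abs_of_nonneg (h1.trans h2)]; exact h2
  have e1 : |a * y| ≤ |a| * |d| := by rw [abs_mul]; gcongr
  have e2 : |b * y| ≤ |b| * |d| := by rw [abs_mul]; gcongr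
  have := abs_le.1 e1
  have := abs_le.1 e2
  exact ⟨⟨by simp only; linarith, by simp only; linarith⟩, h1, h2⟩

lemma biet_L (a b d y : ℝ) (hab : -1 + a * d < 1 + b * d) (h1 : 0 ≤ y) (h2 : y ≤ d) :
    0 < 2 + (b - a) * y := by
  rcases le_total 0 (b - a) with h | h
  · positivity
  · nlinarith

lemma biet_fubini (a b d : ℝ) (f : ℝ × ℝ → ℝ) (hf : IntegrableOn f (trapezoid a b d)) :
    Integrable (fun y => (Set.Icc 0 d).indicator
      (fun y => ∫ x in Set.Icc (a * y - 1) (1 + b * y), f (x, y)) y) ∧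
    ∫ z in trapezoid a b d, f z = ∫ y, (Set.Icc 0 d).indicator
      (fun y => ∫ x in Set.Icc (a * y - 1) (1 + b * y), f (x, y)) y := by
  have hm := (biet_compact a b d).isClosed.measurableSet
  have hi : Integrable ((trapezoid a b d).indicator f) (volume.prod volume) := by
    rw [← Measure.volume_eq_prod, integrable_indicator_iff hm]; exact hf
  have hs : (fun y => ∫ x, (trapezoid a b d).indicator f (x, y)) = fun y => (Set.Icc 0 d).indicator
      (fun y => ∫ x in Set.Icc (a * y - 1) (1 + b * y), f (x, y)) y := by
    funext y
    by_cases hy : y ∈ Set.Icc 0 d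
    · rw [Set.indicator_of_mem hy, ← integral_indicator measurableSet_Icc]
      congr 1
      funext x
      by_cases hx : x ∈ Set.Icc (a * y - 1) (1 + b * y)
      · rw [Set.indicator_of_mem hx, Set.indicator_of_mem]
        exact ⟨hy.1, hy.2, hx.1, hx.2⟩
      · rw [Set.indicator_of_notMem hx, Set.indicator_of_notMem]
        exact fun h => hx ⟨h.2.2.1, h.2.2.2⟩
    · rw [Set.indicator_of_notMem hy]
      have : ∀ x, (trapezoid a b d).indicator f (x, y) = 0 := fun x => 
        Set.indicator_of_notMem (fun h => hy ⟨h.1, h.2.1⟩) _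
      simp [this]
  rw [← hs]
  refine ⟨hi.integral_prod_right, ?_⟩
  rw [← integral_indicator hm, Measure.volume_eq_prod, integral_prod_symm _ hi]

/-- The estimate with the bubble itself as weight. -/
lemma biet_bubble (d a b : ℝ) (hab : -1 + a * d < 1 + b * d) (γ δ : ℝ) (hγ : 0 ≤ γ) (hγδ : γ ≤ δ)
    (hint : ∀ e : ℝ, 0 ≤ e → ∀ q : MvPolynomial (Fin 2) ℝ, IntegrableOn (fun z : ℝ × ℝ =>
      slicedBubble a b z.1 z.2 ^ e * (MvPolynomial.eval ![z.1, z.2] q) ^ 2) (trapezoid a b d))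
    (p : ℕ) (hp : 1 ≤ p) (q : MvPolynomial (Fin 2) ℝ) (hq : q.totalDegree ≤ p) :
    ∫ z in trapezoid a b d, slicedBubble a b z.1 z.2 ^ γ * (MvPolynomial.eval ![z.1, z.2] q) ^ 2 ≤
      (1 + 64 * 16^δ) * ((p:ℝ)^2)^(δ - γ) *
    ∫ z in trapezoid a b d, slicedBubble a b z.1 z.2 ^ δ * (MvPolynomial.eval ![z.1, z.2] q) ^ 2 := by
  obtain ⟨i1, e1⟩ := biet_fubini a b d _ (hint γ hγ q)
  obtain ⟨i2, e2⟩ := biet_fubini a b d _ (hint δ (hγ.trans hγδ) q)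
  rw [e1, e2, ← integral_const_mul]
  refine integral_mono i1 (i2.const_mul _) fun y => ?_
  simp only
  by_cases hy : y ∈ Set.Icc 0 d
  · rw [Set.indicator_of_mem hy, Set.indicator_of_mem hy]
    obtain ⟨P, hP, hPq⟩ := biet_slice q p hq y
    have := biet_interval P p hp hP γ δ hγ hγδ ((a + b) * y / 2) (2 + (b - a) * y)
      (biet_L a b d y hab hy.1 hy.2)
    rw [show (a + b) * y / 2 - (2 + (b - a) * y) / 2 = a * y - 1 by ring,
      show (a + b) * y / 2 + (2 + (b - a) * y) / 2 = 1 + b * y by ring] at this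
    simpa only [slicedBubble, hPq] using this
  · rw [Set.indicator_of_notMem hy, Set.indicator_of_notMem hy, mul_zero]

lemma biet_nonneg (d a b : ℝ) (hab : -1 + a * d < 1 + b * d) (z : ℝ × ℝ)
    (hz : z ∈ trapezoid a b d) : 0 ≤ slicedBubble a b z.1 z.2 := by
  obtain ⟨h1, h2, h3, h4⟩ := hz
  have hL := biet_L a b d z.2 hab h1 h2
  unfold slicedBubble
  have : |2 * (z.1 - (a + b) * z.2 / 2) / (2 + (b - a) * z.2)| ≤ 1 := by
    rw [abs_div, abs_of_pos hL, div_le_one hL]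
    exact abs_le.2 ⟨by linarith, by linarith⟩
  have := (sq_le_one_iff_abs_le_one _).2 this
  linarith

/-- $hp$-polynomial inverse estimate with bubbles in quasi-1D
trapezoids (Lemma 3.4 of the paper). -/
theorem bubble_inverse_estimate_trapezoid
    (d a b : ℝ) (hd0 : 0 < d) (hd1 : d < 1) (hab : -1 + a * d < 1 + b * d)
    (s : ℕ) (hs : 1 ≤ s) (c₁ c₂ : ℝ) (hc₁ : 0 < c₁) (hc₂ : 0 < c₂)
    (α β : ℝ) (hα : 0 ≤ α) (hαβ : α < β) :
    ∃ c : ℝ, 0 < c ∧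
      ∀ Φ : ℝ × ℝ → ℝ, ContinuousOn Φ (trapezoid a b d) →
        (∀ y ∈ Set.Icc (0 : ℝ) d, ∃ P : Polynomial ℝ, P.natDegree ≤ 2 * s ∧
          ∀ x ∈ Set.Icc (a * y - 1) (1 + b * y), Φ (x, y) = P.eval x) →
        (∀ z ∈ trapezoid a b d,
          c₁ * slicedBubble a b z.1 z.2 ^ s ≤ Φ z ∧
            Φ z ≤ c₂ * slicedBubble a b z.1 z.2 ^ s) →
        ∀ p : ℕ, 1 ≤ p → ∀ q : MvPolynomial (Fin 2) ℝ, q.totalDegree ≤ p →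
          ∫ z in trapezoid a b d,
              Φ z ^ α * (MvPolynomial.eval ![z.1, z.2] q) ^ 2 ≤
            c * (p : ℝ) ^ (2 * (s : ℝ) * (β - α)) *
              ∫ z in trapezoid a b d,
                Φ z ^ β * (MvPolynomial.eval ![z.1, z.2] q) ^ 2 := by
  have hβ : 0 ≤ β := hα.trans hαβ.le
  have hK := biet_compact a b d
  have hm := hK.isClosed.measurableSet
  have hqc : ∀ q : MvPolynomial (Fin 2) ℝ,
      Continuous fun z : ℝ × ℝ => MvPolynomial.eval ![z.1, z.2] q := fun q =>
    (MvPolynomial.continuous_eval q).comp (by fun_prop)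
  have hgen : ∀ f : ℝ × ℝ → ℝ, ContinuousOn f (trapezoid a b d) → ∀ e : ℝ, 0 ≤ e →
      ∀ q : MvPolynomial (Fin 2) ℝ, IntegrableOn (fun z : ℝ × ℝ =>
      f z ^ e * (MvPolynomial.eval ![z.1, z.2] q) ^ 2) (trapezoid a b d) := by
    intro f hf e he q
    refine ContinuousOn.integrableOn_compact hK ?_
    exact (hf.rpow_const fun _ _ => Or.inr he).mul ((hqc q).pow 2).continuousOn
  have hψc : ContinuousOn (fun z : ℝ × ℝ => slicedBubble a b z.1 z.2) (trapezoid a b d) := by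
    unfold slicedBubble
    refine continuousOn_const.sub (ContinuousOn.pow (ContinuousOn.div (by fun_prop) (by fun_prop) ?_) 2)
    exact fun z hz => (biet_L a b d z.2 hab hz.1 hz.2.1).ne'
  have hψi := hgen _ hψc
  have hpw : ∀ z ∈ trapezoid a b d, ∀ e : ℝ,
      (slicedBubble a b z.1 z.2 ^ s) ^ e = slicedBubble a b z.1 z.2 ^ ((s:ℝ) * e) := by
    intro z hz e
    rw [Real.rpow_natCast_mul (biet_nonneg d a b hab z hz)]
  have hs0 : (0:ℝ) ≤ s := Nat.cast_nonneg s
  refine ⟨c₂^α * (1 + 64 * 16^((s:ℝ)*β)) * (c₁^β)⁻¹, by positivity, ?_⟩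
  intro Φ hΦ _ hΦb p hp q hq
  have hp0 : (0:ℝ) < p := by exact_mod_cast hp
  have A := biet_bubble d a b hab (s*α) (s*β) (by positivity) (by gcongr) hψi p hp q hq
  have B : ∫ z in trapezoid a b d, Φ z ^ α * (MvPolynomial.eval ![z.1, z.2] q) ^ 2 ≤
      c₂^α * ∫ z in trapezoid a b d,
        slicedBubble a b z.1 z.2 ^ ((s:ℝ)*α) * (MvPolynomial.eval ![z.1, z.2] q) ^ 2 := by
    rw [← integral_const_mul]
    refine setIntegral_mono_on (hgen Φ hΦ α hα q) ((hψi _ (by positivity) q).const_mul _) hm ?_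
    intro z hz
    have h0 := biet_nonneg d a b hab z hz
    have hΦ0 : 0 ≤ Φ z := le_trans (by positivity) (hΦb z hz).1
    rw [← mul_assoc, ← hpw z hz, ← Real.mul_rpow hc₂.le (by positivity)]
    have := (hΦb z hz).2
    gcongr
  have C : c₁^β * ∫ z in trapezoid a b d,
        slicedBubble a b z.1 z.2 ^ ((s:ℝ)*β) * (MvPolynomial.eval ![z.1, z.2] q) ^ 2 ≤
      ∫ z in trapezoid a b d, Φ z ^ β * (MvPolynomial.eval ![z.1, z.2] q) ^ 2 := by
    rw [← integral_const_mul]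
    refine setIntegral_mono_on ((hψi _ (by positivity) q).const_mul _) (hgen Φ hΦ β hβ q) hm ?_
    intro z hz
    have h0 := biet_nonneg d a b hab z hz
    rw [← mul_assoc, ← hpw z hz, ← Real.mul_rpow hc₁.le (by positivity)]
    have := (hΦb z hz).1
    gcongr
  have hexp : ((p:ℝ)^2)^((s:ℝ)*β - s*α) = (p:ℝ) ^ (2 * (s : ℝ) * (β - α)) := by
    rw [← Real.rpow_natCast_mul hp0.le]; congr 1; push_cast; ring
  rw [hexp] at A
  have hc1β : 0 < c₁^β := by positivity
  have C' := (le_inv_mul_iff₀ hc1β).2 C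
  refine B.trans ?_
  calc _ ≤ c₂^α * _ := mul_le_mul_of_nonneg_left A (by positivity)
    _ ≤ c₂^α * ((1 + 64 * 16^((s:ℝ)*β)) * (p:ℝ) ^ (2 * (s : ℝ) * (β - α)) * _) :=
      mul_le_mul_of_nonneg_left (mul_le_mul_of_nonneg_left C' (by positivity)) (by positivity)
    _ = _ := by ring
end

section
/- Let S = [0,1]² and let b(x,y) = x(1 − x)·y(1 − y) be its bubble function. For all real numbers α, β with −1/2 < α ≤ β, there exists a constant c > 0 (depending only on α and β) such that for every integer p ≥ 1 and every real polynomial q in two variables of degree at most p in each variable, ∫_S b(x,y)^α q(x,y)² dx dy ≤ c · p^{4(β−α)} · ∫_S b(x,y)^β q(x,y)² dx dy. -/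
open MeasureTheory

/-- The unit square `S = [0,1]²`. -/
def unitSquare : Set (ℝ × ℝ) := Set.Icc (0 : ℝ) 1 ×ˢ Set.Icc (0 : ℝ) 1

open Polynomial

lemma bub_int_w (α : ℝ) (hα : -1 < α) :
    IntervalIntegrable (fun x : ℝ => (x * (1 - x)) ^ α) volume 0 1 := by
  have h := Complex.betaIntegral_convergent (u := ((α + 1 : ℝ) : ℂ)) (v := ((α + 1 : ℝ) : ℂ))
    (by rw [Complex.ofReal_re]; linarith) (by rw [Complex.ofReal_re]; linarith)
  have h2 := h.norm
  refine h2.congr_uIoo ?_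
  intro x hx
  rw [Set.uIoo_of_le zero_le_one] at hx
  have e : ((α + 1 : ℝ) : ℂ) - 1 = (α : ℂ) := by push_cast; ring
  have e2 : (1 - (x:ℂ)) = ((1 - x : ℝ) : ℂ) := by push_cast; ring
  have h0 : 0 < x := hx.1
  have h1 : 0 < 1 - x := by linarith [hx.2]
  simp only [e, e2, norm_mul]
  rw [Complex.norm_cpow_eq_rpow_re_of_pos h0, Complex.norm_cpow_eq_rpow_re_of_pos h1,
    Complex.ofReal_re, Real.mul_rpow h0.le h1.le]

lemma bub_int (α : ℝ) (hα : -1 < α) (g : ℝ → ℝ) (hg : ContinuousOn g (Set.Icc 0 1)) :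
    IntervalIntegrable (fun x : ℝ => (x * (1 - x)) ^ α * g x) volume 0 1 := by
  apply (bub_int_w α hα).mul_continuousOn
  rwa [Set.uIcc_of_le zero_le_one]

lemma bub_ibp (α : ℝ) (hα : -1 < α) (h h' : ℝ → ℝ)
    (hd : ∀ x ∈ Set.Icc (0:ℝ) 1, HasDerivAt h (h' x) x) (hc : ContinuousOn h' (Set.Icc 0 1)) :
    ∫ x in (0:ℝ)..1, (x * (1 - x)) ^ α * ((α + 1) * (1 - 2 * x) * h x + x * (1 - x) * h' x) = 0 := by
  have hh : ContinuousOn h (Set.Icc 0 1) := fun x hx => (hd x hx).continuousAt.continuousWithinAt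
  have key := intervalIntegral.integral_eq_sub_of_hasDerivAt_of_le (a := 0) (b := 1) zero_le_one
    (f := fun x : ℝ => (x * (1 - x)) ^ (α + 1) * h x)
    (f' := fun x : ℝ => (x * (1 - x)) ^ α * ((α + 1) * (1 - 2 * x) * h x + x * (1 - x) * h' x))
    ?_ ?_ ?_
  · rw [key]
    simp [Real.zero_rpow (by linarith : α + 1 ≠ 0)]
  · refine ContinuousOn.mul ?_ hh
    refine ContinuousOn.rpow_const (by fun_prop) ?_
    intro x _
    right; linarith
  · intro x hx
    have hw : 0 < x * (1 - x) := mul_pos hx.1 (by linarith [hx.2])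
    have d1 : HasDerivAt (fun x : ℝ => x * (1 - x)) (1 - 2 * x) x := by
      have := (hasDerivAt_id x).mul ((hasDerivAt_id x).const_sub 1)
      exact this.congr_deriv (by simp only [id]; ring)
    have d2 := (d1.rpow_const (p := α + 1) (Or.inl hw.ne')).mul (hd x ⟨hx.1.le, hx.2.le⟩)
    refine d2.congr_deriv ?_
    have : (x * (1 - x)) ^ (α + 1) = (x * (1 - x)) ^ α * (x * (1 - x)) := by
      rw [Real.rpow_add hw, Real.rpow_one]
    rw [this, show α + 1 - 1 = α by ring]
    ring
  · apply bub_int α hα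
    fun_prop

/-- The Jacobi operator. -/
noncomputable def bubL (α : ℝ) (f : ℝ[X]) : ℝ[X] :=
  -(X * (1 - X) * derivative (derivative f) + C (α + 1) * (1 - C 2 * X) * derivative f)

noncomputable def bubB (α : ℝ) (f g : ℝ[X]) : ℝ :=
  ∫ x in (0:ℝ)..1, (x * (1 - x)) ^ α * (f.eval x * g.eval x)

lemma bub_intP (α : ℝ) (hα : -1 < α) (f : ℝ[X]) :
    IntervalIntegrable (fun x : ℝ => (x * (1 - x)) ^ α * f.eval x) volume 0 1 :=
  bub_int α hα _ f.continuous.continuousOn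

lemma bub_intPP (α : ℝ) (hα : -1 < α) (f g : ℝ[X]) :
    IntervalIntegrable (fun x : ℝ => (x * (1 - x)) ^ α * (f.eval x * g.eval x)) volume 0 1 :=
  bub_int α hα _ (f.continuous.mul g.continuous).continuousOn

lemma bubB_comm (α : ℝ) (f g : ℝ[X]) : bubB α f g = bubB α g f := by
  unfold bubB; congr 1; ext x; ring

lemma bubB_add (α : ℝ) (hα : -1 < α) (f g k : ℝ[X]) :
    bubB α (f + g) k = bubB α f k + bubB α g k := by
  unfold bubB
  rw [← intervalIntegral.integral_add (bub_intPP α hα f k) (bub_intPP α hα g k)]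
  congr 1; ext x; rw [eval_add]; ring

lemma bubB_smul (α : ℝ) (c : ℝ) (f k : ℝ[X]) :
    bubB α (C c * f) k = c * bubB α f k := by
  unfold bubB
  rw [← intervalIntegral.integral_const_mul]
  congr 1; ext x; rw [eval_mul, eval_C]; ring

lemma bubB_nonneg (α : ℝ) (f : ℝ[X]) : 0 ≤ bubB α f f := by
  apply intervalIntegral.integral_nonneg zero_le_one
  intro x hx
  have : 0 ≤ x * (1 - x) := mul_nonneg hx.1 (by linarith [hx.2])
  exact mul_nonneg (Real.rpow_nonneg this _) (mul_self_nonneg _)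

lemma bubL_B (α : ℝ) (hα : -1 < α) (f g : ℝ[X]) :
    bubB α (bubL α f) g = ∫ x in (0:ℝ)..1, (x * (1 - x)) ^ α *
      (x * (1 - x) * ((derivative f).eval x * (derivative g).eval x)) := by
  have h0 := bub_ibp α hα (fun x => (derivative f * g).eval x)
    (fun x => (derivative (derivative f * g)).eval x) (fun x _ => Polynomial.hasDerivAt _ x)
    (Polynomial.continuous _).continuousOn
  have e : bubB α (bubL α f) g + ∫ x in (0:ℝ)..1, (x * (1 - x)) ^ α * ((α + 1) * (1 - 2 * x) *
     (derivative f * g).eval x + x * (1 - x) * (derivative (derivative f * g)).eval x) =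
      ∫ x in (0:ℝ)..1, (x * (1 - x)) ^ α *
      (x * (1 - x) * ((derivative f).eval x * (derivative g).eval x)) := by
    unfold bubB
    rw [← intervalIntegral.integral_add (bub_intPP α hα _ _)]
    · congr 1; ext x
      simp only [bubL, eval_neg, eval_add, eval_mul, eval_sub, eval_one, eval_X, eval_C,
        derivative_mul]
      ring
    · apply bub_int α hα
      have h1 := Polynomial.continuous (derivative f * g)
      have h2 := Polynomial.continuous (derivative (derivative f * g))
      exact Continuous.continuousOn (by fun_prop)
  rw [h0, add_zero] at e
  exact e

lemma bubL_symm (α : ℝ) (hα : -1 < α) (f g : ℝ[X]) :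
    bubB α (bubL α f) g = bubB α (bubL α g) f := by
  rw [bubL_B α hα, bubL_B α hα]
  congr 1; ext x; ring

lemma bubL_coeff (α : ℝ) (f : ℝ[X]) (k : ℕ) :
    (bubL α f).coeff k = k * (k + 2 * α + 1) * f.coeff k
      - (k + 1) * (k + 1 + α) * f.coeff (k + 1) := by
  have e : bubL α f = X * (X * derivative (derivative f)) - X * derivative (derivative f)
      + C (2 * (α + 1)) * (X * derivative f) - C (α + 1) * derivative f := by
    simp only [bubL, C_mul]; ring
  rw [e]
  rcases k with _ | _ | k
  · simp only [coeff_sub, coeff_add, coeff_C_mul, coeff_X_mul_zero, coeff_derivative]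
    push_cast; ring
  · simp only [coeff_sub, coeff_add, coeff_C_mul, coeff_X_mul, coeff_X_mul_zero, coeff_derivative]
    push_cast; ring
  · simp only [coeff_sub, coeff_add, coeff_C_mul, coeff_X_mul, coeff_derivative]
    push_cast; ring

/-- shifted operator -/
noncomputable def bubT (α l : ℝ) (f : ℝ[X]) : ℝ[X] := C l * f - bubL α f

lemma bubT_coeff (α l : ℝ) (f : ℝ[X]) (k : ℕ) :
    (bubT α l f).coeff k = (l - k * (k + 2 * α + 1)) * f.coeff k
      + (k + 1) * (k + 1 + α) * f.coeff (k + 1) := by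
  rw [bubT, coeff_sub, coeff_C_mul, bubL_coeff]; ring

lemma bubT_add (α l : ℝ) (f g : ℝ[X]) : bubT α l (f + g) = bubT α l f + bubT α l g := by
  ext k; simp only [bubT_coeff, coeff_add]; ring

lemma bubT_smul (α l c : ℝ) (f : ℝ[X]) : bubT α l (C c * f) = C c * bubT α l f := by
  ext k; simp only [bubT_coeff, coeff_C_mul]; ring

lemma bubT_B (α l : ℝ) (hα : -1 < α) (f g : ℝ[X]) :
    bubB α (bubT α l f) g = l * bubB α f g - bubB α (bubL α f) g := by
  have : bubT α l f = C l * f + C (-1) * bubL α f := by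
    rw [bubT, C_neg, C_1]; ring
  rw [this, bubB_add α hα, bubB_smul, bubB_smul]; ring

lemma bubT_symm (α l : ℝ) (hα : -1 < α) (f g : ℝ[X]) :
    bubB α (bubT α l f) g = bubB α (bubT α l g) f := by
  rw [bubT_B α l hα, bubT_B α l hα, bubL_symm α hα f g, bubB_comm α f g]

lemma bub_lam_lt (α : ℝ) (hα : -1 < α) (k N : ℕ) (h : k < N) :
    (k * (k + 2 * α + 1) : ℝ) < N * (N + 2 * α + 1) := by
  have h1 : (k:ℝ) + 1 ≤ N := by exact_mod_cast h
  have h2 : (0:ℝ) ≤ k := Nat.cast_nonneg k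
  nlinarith [mul_pos (by linarith : (0:ℝ) < N - k) (by linarith : (0:ℝ) < N + k + 2 * α + 1)]

lemma bubT_surj (α : ℝ) (hα : -1 < α) (N : ℕ) (k : ℕ) (hk : k ≤ N) :
    ∀ f : ℝ[X], (∀ j, k ≤ j → f.coeff j = 0) →
      ∃ r : ℝ[X], (∀ j, k ≤ j → r.coeff j = 0) ∧ bubT α (N * (N + 2 * α + 1)) r = f := by
  induction k with
  | zero =>
    intro f hf
    refine ⟨0, by simp, ?_⟩
    ext j
    rw [hf j (Nat.zero_le j), bubT_coeff]; simp
  | succ k ih =>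
    intro f hf
    set l : ℝ := N * (N + 2 * α + 1) with hl
    have hlt : (k * (k + 2 * α + 1) : ℝ) < l := bub_lam_lt α hα k N hk
    set c : ℝ := f.coeff k / (l - k * (k + 2 * α + 1)) with hc
    obtain ⟨r, hr, hr2⟩ := ih (by omega) (f + C (-c) * bubT α l (X ^ k)) (by
      intro j hj
      rw [coeff_add, coeff_C_mul, bubT_coeff, coeff_X_pow, coeff_X_pow]
      rcases hj.eq_or_lt with rfl | hj
      · have : (l - k * (k + 2 * α + 1) : ℝ) ≠ 0 := by linarith
        simp [hc]
        field_simp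
        ring
      · rw [hf j hj, if_neg (by omega), if_neg (by omega)]; ring)
    refine ⟨r + C c * X ^ k, ?_, ?_⟩
    · intro j hj
      rw [coeff_add, coeff_C_mul, coeff_X_pow, hr j (by omega), if_neg (by omega)]; ring
    · rw [bubT_add, hr2, bubT_smul, C_neg]; ring

lemma bub_markov (α : ℝ) (hα : -1 < α) (n : ℕ) : ∀ q : ℝ[X], (∀ j, n < j → q.coeff j = 0) →
    bubB α (bubL α q) q ≤ n * (n + 2 * α + 1) * bubB α q q := by
  induction n with
  | zero =>
    intro q hq
    have : bubL α q = C 0 * 0 := by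
      ext k
      rw [bubL_coeff, hq (k+1) (by omega)]
      rcases k with _ | k
      · simp
      · rw [hq (k+1) (by omega)]; simp
    rw [this, bubB_smul]; simp
  | succ n ih =>
    intro q hq
    set l : ℝ := ((n + 1 : ℕ) : ℝ) * (((n + 1 : ℕ) : ℝ) + 2 * α + 1) with hl
    have hlt : (n * (n + 2 * α + 1) : ℝ) < l := bub_lam_lt α hα n (n + 1) (by omega)
    obtain ⟨r, hr, hr2⟩ := bubT_surj α hα (n + 1) (n + 1) le_rfl (bubT α l q) (by
      intro j hj
      rw [bubT_coeff, hq (j + 1) (by omega)]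
      rcases hj.eq_or_lt with rfl | hj
      · rw [hl]; ring
      · rw [hq j hj]; ring)
    rw [← hl] at hr2
    have h1 : bubB α (bubT α l q) q = bubB α (bubT α l r) r := by
      calc bubB α (bubT α l q) q = bubB α (bubT α l r) q := by rw [hr2]
        _ = bubB α (bubT α l q) r := bubT_symm α l hα _ _
        _ = _ := by rw [hr2]
    have h2 := ih r (fun j hj => hr j hj)
    rw [bubT_B α l hα, bubT_B α l hα] at h1
    have h3 := mul_le_mul_of_nonneg_right hlt.le (bubB_nonneg α r)
    linarith

/-- Weighted squared norm. -/
noncomputable def bubM (α : ℝ) (f : ℝ[X]) : ℝ :=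
  ∫ x in (0:ℝ)..1, (x * (1 - x)) ^ α * f.eval x ^ 2

lemma bubM_nonneg (α : ℝ) (f : ℝ[X]) : 0 ≤ bubM α f := by
  apply intervalIntegral.integral_nonneg zero_le_one
  intro x hx
  have : 0 ≤ x * (1 - x) := mul_nonneg hx.1 (by linarith [hx.2])
  exact mul_nonneg (Real.rpow_nonneg this _) (sq_nonneg _)

lemma bub_markov2 (α : ℝ) (hα : -1 < α) (n : ℕ) (q : ℝ[X]) (hq : q.natDegree ≤ n) (hn : 1 ≤ n) :
    ∫ x in (0:ℝ)..1, (x * (1 - x)) ^ α * (x * (1 - x) * (derivative q).eval x ^ 2) ≤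
      (1 + 2 * (α + 1)) * (n:ℝ) ^ 2 * bubM α q := by
  have h := bub_markov α hα n q (fun j hj => coeff_eq_zero_of_natDegree_lt (by omega))
  rw [bubL_B α hα] at h
  have e1 : bubB α q q = bubM α q := by
    unfold bubB bubM; congr 1; ext x; ring
  rw [e1] at h
  simp only [← sq] at h
  refine h.trans (mul_le_mul_of_nonneg_right ?_ (bubM_nonneg α q))
  have : (1:ℝ) ≤ n := by exact_mod_cast hn
  nlinarith [mul_nonneg (by linarith : (0:ℝ) ≤ n) (by linarith : (0:ℝ) ≤ n - 1)]

/-- pointwise inequality, with `w = x (1-x)`, `m = 1 - 2x`, `m^2 = 1 - 4 w`. -/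
lemma bub_pointwise (κ s δ w m a b : ℝ) (hκ : 0 < κ) (hs : 0 < s) (hδ : δ = κ * s)
    (hw : 0 ≤ w) (hm : m ^ 2 = 1 - 4 * w) :
    3 * κ / 4 * a ^ 2 - (κ + 4 * κ * δ + 2 * δ + 1) * (w / (w + δ) * a ^ 2) - s * (w * b ^ 2) ≤
      κ * m * (m * (δ / (w + δ)) * a ^ 2) +
        w * (-2 * (δ / (w + δ)) * a ^ 2 + m * (-(δ * m) / (w + δ) ^ 2) * a ^ 2 +
          m * (δ / (w + δ)) * (2 * a * b)) := by
  have hδ0 : 0 < δ := by rw [hδ]; positivity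
  have hwd : 0 < w + δ := by linarith
  obtain ⟨ψ, hψ⟩ : ∃ ψ, ψ = δ / (w + δ) := ⟨_, rfl⟩
  have h1 : w / (w + δ) = 1 - ψ := by rw [hψ]; field_simp; ring
  have h2 : w * ψ = δ * (1 - ψ) := by rw [hψ]; field_simp; ring
  have h3 : w * (m * (-(δ * m) / (w + δ) ^ 2)) = -(m ^ 2 * (ψ * (1 - ψ))) := by
    rw [← h1, hψ]; field_simp
  have hψ0 : 0 ≤ ψ := by rw [hψ]; positivity
  have hψ1 : 0 ≤ 1 - ψ := by rw [← h1]; positivity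
  have hm1 : m ^ 2 ≤ 1 := by linarith
  rw [← hψ, h1]
  have e : κ * m * (m * ψ * a ^ 2) +
        w * (-2 * ψ * a ^ 2 + m * (-(δ * m) / (w + δ) ^ 2) * a ^ 2 + m * ψ * (2 * a * b)) =
      κ * ψ * a ^ 2 - 4 * κ * (w * ψ) * a ^ 2 - 2 * (w * ψ) * a ^ 2
        + (w * (m * (-(δ * m) / (w + δ) ^ 2))) * a ^ 2 + 2 * (w * m * ψ * a * b) := by
    have : κ * m * (m * ψ * a ^ 2) = κ * (m ^ 2) * ψ * a ^ 2 := by ring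
    rw [this, hm]; ring
  rw [e, h2, h3]
  -- Young
  have y : 0 ≤ s * (w * b ^ 2) + 2 * (w * m * ψ * a * b) + κ / 4 * a ^ 2 := by
    have hb : w * ψ ^ 2 ≤ δ / 4 := by
      have : w * ψ ^ 2 = δ * (ψ * (1 - ψ)) := by
        calc w * ψ ^ 2 = (w * ψ) * ψ := by ring
          _ = _ := by rw [h2]; ring
      rw [this]
      nlinarith [sq_nonneg (ψ - 1 / 2)]
    have hb2 : w * m ^ 2 * ψ ^ 2 ≤ κ * s / 4 := by
      have : w * ψ ^ 2 * m ^ 2 ≤ w * ψ ^ 2 * 1 := mul_le_mul_of_nonneg_left hm1 (by positivity)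
      rw [← hδ]; linarith
    have hsq : 0 ≤ w * (s * b + m * ψ * a) ^ 2 := by positivity
    have h4 : 0 ≤ (κ * s / 4 - w * m ^ 2 * ψ ^ 2) * a ^ 2 :=
      mul_nonneg (by linarith) (sq_nonneg a)
    have h5 : 0 ≤ s * (s * (w * b ^ 2) + 2 * (w * m * ψ * a * b) + κ / 4 * a ^ 2) := by
      nlinarith
    exact nonneg_of_mul_nonneg_right h5 hs
  have z : m ^ 2 * (ψ * (1 - ψ)) * a ^ 2 ≤ (1 - ψ) * a ^ 2 := by
    apply mul_le_mul_of_nonneg_right _ (sq_nonneg a)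
    have : m ^ 2 * ψ ≤ 1 := mul_le_one₀ hm1 hψ0 (by linarith)
    nlinarith
  nlinarith

lemma bub_frac (w δ t : ℝ) (hw : 0 < w) (hδ : 0 < δ) (ht0 : 0 ≤ t) (ht1 : t ≤ 1) :
    w / (w + δ) ≤ δ ^ (-t) * w ^ t := by
  have e : δ ^ (-t) * w ^ t = (w / δ) ^ t := by
    rw [Real.div_rpow hw.le hδ.le, Real.rpow_neg hδ.le]; field_simp
  rw [e]
  rcases le_total w δ with h | h
  · have h1 : w / (w + δ) ≤ w / δ := by gcongr; linarith
    refine h1.trans ?_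
    have := Real.rpow_le_rpow_of_exponent_ge (x := w / δ) (by positivity)
      ((div_le_one hδ).2 h) ht1
    rwa [Real.rpow_one] at this
  · have h1 : w / (w + δ) ≤ 1 := (div_le_one (by positivity)).2 (by linarith)
    exact h1.trans (Real.one_le_rpow ((one_le_div hδ).2 h) ht0)

lemma bub_step (α t : ℝ) (hα : -1 < α) (ht0 : 0 ≤ t) (ht1 : t ≤ 1) :
    ∃ c : ℝ, 0 < c ∧ ∀ p : ℕ, 1 ≤ p → ∀ q : ℝ[X], q.natDegree ≤ p →
      bubM α q ≤ c * (p:ℝ) ^ (2 * t) * bubM (α + t) q := by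
  obtain ⟨κ, hκd⟩ : ∃ κ, κ = α + 1 := ⟨_, rfl⟩
  have hκ : 0 < κ := by linarith
  obtain ⟨Λ, hΛd⟩ : ∃ Λ, Λ = 1 + 2 * κ := ⟨_, rfl⟩
  have hΛ : 0 < Λ := by linarith
  obtain ⟨δ0, hδ0d⟩ : ∃ δ0, δ0 = κ ^ 2 / (4 * Λ) := ⟨_, rfl⟩
  have hδ0 : 0 < δ0 := by rw [hδ0d]; positivity
  refine ⟨2 / κ * ((κ + 4 * κ * δ0 + 2 * δ0 + 1) * δ0 ^ (-t)), by positivity, ?_⟩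
  intro p hp q hq
  have hp1 : (1:ℝ) ≤ p := by exact_mod_cast hp
  have hp0 : (0:ℝ) < p := by linarith
  obtain ⟨s, hsd⟩ : ∃ s, s = κ / (4 * Λ * (p:ℝ) ^ 2) := ⟨_, rfl⟩
  have hs : 0 < s := by rw [hsd]; positivity
  obtain ⟨δ, hδd⟩ : ∃ δ, δ = κ * s := ⟨_, rfl⟩
  have hδ : 0 < δ := by rw [hδd]; positivity
  have hδe : δ = δ0 / (p:ℝ) ^ 2 := by rw [hδd, hsd, hδ0d]; field_simp
  have hδle : δ ≤ δ0 := by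
    rw [hδe]; exact div_le_self hδ0.le (by nlinarith)
  have hδt : δ ^ (-t) = δ0 ^ (-t) * (p:ℝ) ^ (2 * t) := by
    rw [hδe, Real.div_rpow hδ0.le (by positivity), Real.rpow_neg (by positivity : (0:ℝ) ≤ (p:ℝ)^2),
      div_inv_eq_mul, ← Real.rpow_natCast, ← Real.rpow_mul hp0.le]
    norm_num
  obtain ⟨K, hK⟩ : ∃ K, K = κ + 4 * κ * δ0 + 2 * δ0 + 1 := ⟨_, rfl⟩
  have hK0 : 0 < K := by rw [hK]; positivity
  have hwd : ∀ x ∈ Set.Icc (0:ℝ) 1, 0 < x * (1 - x) + δ := fun x hx => by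
    have : 0 ≤ x * (1 - x) := mul_nonneg hx.1 (by linarith [hx.2])
    linarith
  set h : ℝ → ℝ := fun x => (1 - 2 * x) * (δ / (x * (1 - x) + δ)) * q.eval x ^ 2 with hh
  set h' : ℝ → ℝ := fun x => -2 * (δ / (x * (1 - x) + δ)) * q.eval x ^ 2
    + (1 - 2 * x) * (-(δ * (1 - 2 * x)) / (x * (1 - x) + δ) ^ 2) * q.eval x ^ 2
    + (1 - 2 * x) * (δ / (x * (1 - x) + δ)) * (2 * q.eval x * (derivative q).eval x) with hh'
  have hder : ∀ x ∈ Set.Icc (0:ℝ) 1, HasDerivAt h (h' x) x := by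
    intro x hx
    have d1 : HasDerivAt (fun x : ℝ => x * (1 - x) + δ) (1 - 2 * x) x := by
      have := ((hasDerivAt_id x).mul ((hasDerivAt_id x).const_sub 1)).add_const δ
      exact this.congr_deriv (by simp only [id]; ring)
    have d2 : HasDerivAt (fun x : ℝ => 1 - 2 * x) (-2) x := by
      have := ((hasDerivAt_id x).const_mul 2).const_sub 1
      exact this.congr_deriv (by ring)
    have d3 := (hasDerivAt_const x δ).div d1 (hwd x hx).ne'
    have d4 := (q.hasDerivAt x).pow 2
    refine ((d2.mul d3).mul d4).congr_deriv ?_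
    simp only [hh', Pi.mul_apply, Pi.div_apply, Pi.pow_apply]
    push_cast
    ring
  have hc' : ContinuousOn h' (Set.Icc 0 1) := by
    have c1 := q.continuous
    have c2 := (derivative q).continuous
    have n1 : ∀ x ∈ Set.Icc (0:ℝ) 1, x * (1 - x) + δ ≠ 0 := fun x hx => (hwd x hx).ne'
    have n2 : ∀ x ∈ Set.Icc (0:ℝ) 1, (x * (1 - x) + δ) ^ 2 ≠ 0 :=
      fun x hx => pow_ne_zero 2 (n1 x hx)
    have c3 : ContinuousOn (fun x : ℝ => δ / (x * (1 - x) + δ)) (Set.Icc 0 1) :=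
      ContinuousOn.div (by fun_prop) (by fun_prop) n1
    have c4 : ContinuousOn (fun x : ℝ => -(δ * (1 - 2 * x)) / (x * (1 - x) + δ) ^ 2)
      (Set.Icc 0 1) := ContinuousOn.div (by fun_prop) (by fun_prop) n2
    have c5 := c1.continuousOn (s := Set.Icc (0:ℝ) 1)
    have c6 := c2.continuousOn (s := Set.Icc (0:ℝ) 1)
    rw [hh']
    fun_prop
  have hc : ContinuousOn h (Set.Icc 0 1) := fun x hx => (hder x hx).continuousAt.continuousWithinAt
  have hz := bub_ibp α hα h h' hder hc'
  have i1 : IntervalIntegrable (fun x : ℝ => (x * (1 - x)) ^ α * q.eval x ^ 2) volume 0 1 :=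
    bub_int α hα _ (q.continuous.pow 2).continuousOn
  have i2 : IntervalIntegrable (fun x : ℝ => (x * (1 - x)) ^ (α + t) * q.eval x ^ 2) volume 0 1 :=
    bub_int _ (by linarith) _ (q.continuous.pow 2).continuousOn
  have i3 : IntervalIntegrable (fun x : ℝ => (x * (1 - x)) ^ α *
      (x * (1 - x) * (derivative q).eval x ^ 2)) volume 0 1 := by
    have c2 := (derivative q).continuous
    exact bub_int α hα _ (Continuous.continuousOn (by fun_prop))
  have hmono := intervalIntegral.integral_mono_on_of_le_Ioo (μ := volume) (a := 0) (b := 1)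
    zero_le_one
    (f := fun x : ℝ => 3 * κ / 4 * ((x * (1 - x)) ^ α * q.eval x ^ 2)
      - K * δ ^ (-t) * ((x * (1 - x)) ^ (α + t) * q.eval x ^ 2)
      - s * ((x * (1 - x)) ^ α * (x * (1 - x) * (derivative q).eval x ^ 2)))
    (((i1.const_mul _).sub (i2.const_mul _)).sub (i3.const_mul _))
    (bub_int α hα (fun x => (α + 1) * (1 - 2 * x) * h x + x * (1 - x) * h' x) (by fun_prop))
    (by
      intro x hx
      have hw : 0 < x * (1 - x) := mul_pos hx.1 (by linarith [hx.2])
      have pw := bub_pointwise κ s δ (x * (1 - x)) (1 - 2 * x) (q.eval x) ((derivative q).eval x)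
        hκ hs hδd hw.le (by ring)
      have pf := bub_frac (x * (1 - x)) δ t hw hδ ht0 ht1
      have hW : 0 ≤ (x * (1 - x)) ^ α := Real.rpow_nonneg hw.le _
      have pf2 : (κ + 4 * κ * δ + 2 * δ + 1) * (x * (1 - x) / (x * (1 - x) + δ) * q.eval x ^ 2) ≤
          K * ((δ ^ (-t) * (x * (1 - x)) ^ t) * q.eval x ^ 2) := by
        have hd0 : 0 ≤ x * (1 - x) / (x * (1 - x) + δ) := by positivity
        have hKle : κ + 4 * κ * δ + 2 * δ + 1 ≤ K := by
          rw [hK]; gcongr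
        gcongr
      have := mul_le_mul_of_nonneg_left (show 3 * κ / 4 * q.eval x ^ 2 -
          K * ((δ ^ (-t) * (x * (1 - x)) ^ t) * q.eval x ^ 2)
          - s * (x * (1 - x) * (derivative q).eval x ^ 2) ≤ _ by
        exact le_trans (by linarith) pw) hW
      rw [← hκd]
      refine le_trans (le_of_eq ?_) this
      rw [Real.rpow_add hw]
      ring)
  rw [hz, intervalIntegral.integral_sub ((i1.const_mul _).sub (i2.const_mul _)) (i3.const_mul _),
    intervalIntegral.integral_sub (i1.const_mul _) (i2.const_mul _),
    intervalIntegral.integral_const_mul, intervalIntegral.integral_const_mul,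
    intervalIntegral.integral_const_mul] at hmono
  have hD := bub_markov2 α hα p q hq hp
  rw [← hκd, ← hΛd] at hD
  have hD2 := mul_le_mul_of_nonneg_left hD hs.le
  have hsL : s * (Λ * (p:ℝ) ^ 2 * bubM α q) = κ / 4 * bubM α q := by
    rw [hsd]; field_simp
  rw [hsL] at hD2
  change 3 * κ / 4 * bubM α q - K * δ ^ (-t) * bubM (α + t) q - _ ≤ 0 at hmono
  have fin : κ / 2 * bubM α q ≤ K * δ ^ (-t) * bubM (α + t) q := by linarith
  rw [hδt] at fin
  rw [← hK]
  calc bubM α q = 2 / κ * (κ / 2 * bubM α q) := by field_simp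
    _ ≤ 2 / κ * (K * (δ0 ^ (-t) * (p:ℝ) ^ (2 * t)) * bubM (α + t) q) := by gcongr
    _ = _ := by ring

lemma bub_iter (t : ℝ) (ht0 : 0 ≤ t) (ht1 : t ≤ 1) (n : ℕ) : ∀ (α : ℝ), -1 < α →
    ∃ c : ℝ, 0 < c ∧ ∀ p : ℕ, 1 ≤ p → ∀ q : ℝ[X], q.natDegree ≤ p →
      bubM α q ≤ c * (p:ℝ) ^ (2 * (n * t)) * bubM (α + n * t) q := by
  induction n with
  | zero => intro α _; exact ⟨1, one_pos, fun p hp q hq => by simp⟩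
  | succ n ih =>
    intro α hα
    obtain ⟨c1, hc1, h1⟩ := bub_step α t hα ht0 ht1
    obtain ⟨c2, hc2, h2⟩ := ih (α + t) (by linarith)
    refine ⟨c1 * c2, by positivity, fun p hp q hq => ?_⟩
    have hp0 : (0:ℝ) < p := by exact_mod_cast hp
    have e : (p:ℝ) ^ (2 * (((n + 1 : ℕ) : ℝ) * t)) = (p:ℝ) ^ (2 * t) * (p:ℝ) ^ (2 * (n * t)) := by
      rw [← Real.rpow_add hp0]; congr 1; push_cast; ring
    have e2 : α + ((n + 1 : ℕ) : ℝ) * t = α + t + n * t := by push_cast; ring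
    rw [e, e2]
    calc bubM α q ≤ c1 * (p:ℝ) ^ (2 * t) * bubM (α + t) q := h1 p hp q hq
      _ ≤ c1 * (p:ℝ) ^ (2 * t) * (c2 * (p:ℝ) ^ (2 * (n * t)) * bubM (α + t + n * t) q) := by
        gcongr; exact h2 p hp q hq
      _ = _ := by ring

lemma bub_one_dim (α β : ℝ) (hα : -1 < α) (hαβ : α ≤ β) :
    ∃ c : ℝ, 0 < c ∧ ∀ p : ℕ, 1 ≤ p → ∀ q : ℝ[X], q.natDegree ≤ p →
      bubM α q ≤ c * (p:ℝ) ^ (2 * (β - α)) * bubM β q := by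
  obtain ⟨n, hn⟩ := exists_nat_gt (β - α)
  have hn0 : (0:ℝ) < n := by linarith
  have h := bub_iter ((β - α) / n) (div_nonneg (by linarith) hn0.le)
    ((div_le_one hn0).2 hn.le) n α hα
  rw [mul_div_cancel₀ _ hn0.ne'] at h
  simpa using h

lemma bub_deg (q : MvPolynomial (Fin 2) ℝ) (v : Fin 2 → ℝ[X]) (i : Fin 2) (p : ℕ)
    (hq : q.degreeOf i ≤ p) (hv : ∀ j, j ≠ i → (v j).natDegree = 0) (hi : (v i).natDegree ≤ 1) :
    (MvPolynomial.aeval v q).natDegree ≤ p := by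
  rw [MvPolynomial.aeval_def, MvPolynomial.eval₂_eq']
  apply natDegree_sum_le_of_forall_le
  intro d hd
  have hdi : d i ≤ p := (MvPolynomial.degreeOf_le_iff.1 hq) d hd
  have hterm : ∀ j, (v j ^ d j).natDegree ≤ if j = i then p else 0 := by
    intro j
    split_ifs with hj
    · subst hj
      exact natDegree_pow_le.trans ((Nat.mul_le_mul_left _ hi).trans (by omega))
    · exact natDegree_pow_le.trans (by rw [hv j hj]; simp)
  have h2 : (∏ j, v j ^ d j).natDegree ≤ p := by
    refine (natDegree_prod_le _ _).trans ((Finset.sum_le_sum fun j _ => hterm j).trans ?_)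
    simp
  rw [Polynomial.algebraMap_eq]
  exact (natDegree_C_mul_le _ _).trans h2

lemma bub_eval (q : MvPolynomial (Fin 2) ℝ) (v : Fin 2 → ℝ[X]) (x : ℝ) :
    (MvPolynomial.aeval v q).eval x = MvPolynomial.eval (fun i => (v i).eval x) q := by
  rw [MvPolynomial.aeval_def, MvPolynomial.eval₂_eq', MvPolynomial.eval_eq', eval_finsetSum]
  simp [eval_prod]

lemma bub_slice1 (q : MvPolynomial (Fin 2) ℝ) (p : ℕ) (hq : q.degreeOf 0 ≤ p) (y : ℝ) :
    ∃ f : ℝ[X], f.natDegree ≤ p ∧ ∀ x, f.eval x = MvPolynomial.eval ![x, y] q := by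
  refine ⟨MvPolynomial.aeval ![X, C y] q, bub_deg q _ 0 p hq ?_ ?_, ?_⟩
  · intro j hj; fin_cases j <;> simp at hj ⊢
  · simp
  · intro x
    rw [bub_eval]; congr 2; ext i; fin_cases i <;> simp

lemma bub_slice2 (q : MvPolynomial (Fin 2) ℝ) (p : ℕ) (hq : q.degreeOf 1 ≤ p) (x : ℝ) :
    ∃ f : ℝ[X], f.natDegree ≤ p ∧ ∀ y, f.eval y = MvPolynomial.eval ![x, y] q := by
  refine ⟨MvPolynomial.aeval ![C x, X] q, bub_deg q _ 1 p hq ?_ ?_, ?_⟩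
  · intro j hj; fin_cases j <;> simp at hj ⊢
  · simp
  · intro y
    rw [bub_eval]; congr 2; ext i; fin_cases i <;> simp

lemma bub_cont (q : MvPolynomial (Fin 2) ℝ) :
    Continuous (fun z : ℝ × ℝ => MvPolynomial.eval ![z.1, z.2] q) := by
  refine (MvPolynomial.continuous_eval q).comp ?_
  refine continuous_pi fun i => ?_
  fin_cases i
  · exact continuous_fst
  · exact continuous_snd

lemma bub_int2 (a b : ℝ) (ha : -1 < a) (hb : -1 < b) (q : MvPolynomial (Fin 2) ℝ) :
    Integrable (fun z : ℝ × ℝ => (z.1 * (1 - z.1)) ^ a * (z.2 * (1 - z.2)) ^ b *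
      (MvPolynomial.eval ![z.1, z.2] q) ^ 2)
      ((volume.restrict (Set.Icc (0:ℝ) 1)).prod (volume.restrict (Set.Icc (0:ℝ) 1))) := by
  have h1 : ∀ a : ℝ, -1 < a → Integrable (fun x : ℝ => (x * (1 - x)) ^ a)
      (volume.restrict (Set.Icc (0:ℝ) 1)) := fun a ha =>
    (intervalIntegrable_iff_integrableOn_Icc_of_le zero_le_one).1 (bub_int_w a ha)
  have h2 := (h1 a ha).mul_prod (h1 b hb)
  rw [Measure.prod_restrict] at h2 ⊢
  exact IntegrableOn.mul_continuousOn (K := Set.Icc (0:ℝ) 1 ×ˢ Set.Icc (0:ℝ) 1) h2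
    ((bub_cont q).pow 2).continuousOn (isCompact_Icc.prod isCompact_Icc)

lemma bub_M_Icc (a : ℝ) (f : ℝ[X]) :
    ∫ x in Set.Icc (0:ℝ) 1, (x * (1 - x)) ^ a * f.eval x ^ 2 = bubM a f := by
  rw [bubM, intervalIntegral.integral_of_le zero_le_one, integral_Icc_eq_integral_Ioc]

lemma bub_split (a : ℝ) (q : MvPolynomial (Fin 2) ℝ) :
    ∫ z in unitSquare, (z.1 * (1 - z.1) * (z.2 * (1 - z.2))) ^ a *
        (MvPolynomial.eval ![z.1, z.2] q) ^ 2 =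
    ∫ z : ℝ × ℝ, (z.1 * (1 - z.1)) ^ a * (z.2 * (1 - z.2)) ^ a *
      (MvPolynomial.eval ![z.1, z.2] q) ^ 2
      ∂((volume.restrict (Set.Icc (0:ℝ) 1)).prod (volume.restrict (Set.Icc (0:ℝ) 1))) := by
  rw [Measure.prod_restrict, ← Measure.volume_eq_prod]
  apply setIntegral_congr_fun (measurableSet_Icc.prod measurableSet_Icc)
  intro z hz
  have h1 : 0 ≤ z.1 * (1 - z.1) := mul_nonneg hz.1.1 (by linarith [hz.1.2])
  have h2 : 0 ≤ z.2 * (1 - z.2) := mul_nonneg hz.2.1 (by linarith [hz.2.2])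
  simp only [Real.mul_rpow h1 h2]

/-- $hp$-polynomial inverse estimate with bubbles on the unit
square (Proposition 3.5 of the paper, d = 2, parallelogram case). -/
theorem bubble_inverse_estimate_square (α β : ℝ) (hα : -1 / 2 < α) (hαβ : α ≤ β) :
    ∃ c : ℝ, 0 < c ∧
      ∀ p : ℕ, 1 ≤ p → ∀ q : MvPolynomial (Fin 2) ℝ,
        (∀ i : Fin 2, q.degreeOf i ≤ p) →
        ∫ z in unitSquare,
            (z.1 * (1 - z.1) * (z.2 * (1 - z.2))) ^ α *
              (MvPolynomial.eval ![z.1, z.2] q) ^ 2 ≤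
          c * (p : ℝ) ^ (4 * (β - α)) *
            ∫ z in unitSquare,
              (z.1 * (1 - z.1) * (z.2 * (1 - z.2))) ^ β *
                (MvPolynomial.eval ![z.1, z.2] q) ^ 2 := by
  have hα1 : -1 < α := by linarith
  have hβ1 : -1 < β := by linarith
  obtain ⟨c, hc, H⟩ := bub_one_dim α β hα1 hαβ
  refine ⟨c * c, by positivity, fun p hp q hq => ?_⟩
  have hp0 : (0:ℝ) < p := by exact_mod_cast hp
  rw [bub_split, bub_split]
  obtain ⟨P, hP⟩ : ∃ P, P = c * (p:ℝ) ^ (2 * (β - α)) := ⟨_, rfl⟩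
  have hP0 : 0 ≤ P := by rw [hP]; positivity
  have hPP : c * c * (p:ℝ) ^ (4 * (β - α)) = P * P := by
    rw [hP, show 4 * (β - α) = 2 * (β - α) + 2 * (β - α) by ring, Real.rpow_add hp0]; ring
  have hw : ∀ x ∈ Set.Icc (0:ℝ) 1, ∀ a : ℝ, 0 ≤ (x * (1 - x)) ^ a := fun x hx a =>
    Real.rpow_nonneg (mul_nonneg hx.1 (by linarith [hx.2])) a
  have I1 := bub_int2 α α hα1 hα1 q
  have I2 := bub_int2 α β hα1 hβ1 q
  have I3 := bub_int2 β β hβ1 hβ1 q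
  have s1 : ∫ z : ℝ × ℝ, (z.1 * (1 - z.1)) ^ α * (z.2 * (1 - z.2)) ^ α *
      (MvPolynomial.eval ![z.1, z.2] q) ^ 2
      ∂((volume.restrict (Set.Icc (0:ℝ) 1)).prod (volume.restrict (Set.Icc (0:ℝ) 1))) ≤
      P * ∫ z : ℝ × ℝ, (z.1 * (1 - z.1)) ^ α * (z.2 * (1 - z.2)) ^ β *
      (MvPolynomial.eval ![z.1, z.2] q) ^ 2
      ∂((volume.restrict (Set.Icc (0:ℝ) 1)).prod (volume.restrict (Set.Icc (0:ℝ) 1))) := by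
    rw [integral_prod _ I1, integral_prod _ I2, ← integral_const_mul]
    refine setIntegral_mono_on I1.integral_prod_left (I2.integral_prod_left.const_mul P)
      measurableSet_Icc ?_
    intro x hx
    obtain ⟨f, hf, hfe⟩ := bub_slice2 q p (hq 1) x
    simp only [← hfe, mul_assoc]
    rw [integral_const_mul, integral_const_mul, mul_left_comm]
    refine mul_le_mul_of_nonneg_left ?_ (hw x hx α)
    have := H p hp f hf
    rw [← hP, ← bub_M_Icc, ← bub_M_Icc] at this
    simpa only [mul_assoc] using this
  have s2 : ∫ z : ℝ × ℝ, (z.1 * (1 - z.1)) ^ α * (z.2 * (1 - z.2)) ^ β *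
      (MvPolynomial.eval ![z.1, z.2] q) ^ 2
      ∂((volume.restrict (Set.Icc (0:ℝ) 1)).prod (volume.restrict (Set.Icc (0:ℝ) 1))) ≤
      P * ∫ z : ℝ × ℝ, (z.1 * (1 - z.1)) ^ β * (z.2 * (1 - z.2)) ^ β *
      (MvPolynomial.eval ![z.1, z.2] q) ^ 2
      ∂((volume.restrict (Set.Icc (0:ℝ) 1)).prod (volume.restrict (Set.Icc (0:ℝ) 1))) := by
    rw [integral_prod_symm _ I2, integral_prod_symm _ I3, ← integral_const_mul]
    refine setIntegral_mono_on I2.integral_prod_right (I3.integral_prod_right.const_mul P)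
      measurableSet_Icc ?_
    intro y hy
    obtain ⟨f, hf, hfe⟩ := bub_slice1 q p (hq 0) y
    have e : ∀ a : ℝ, ∫ x in Set.Icc (0:ℝ) 1, (x * (1 - x)) ^ a * (y * (1 - y)) ^ β *
        (MvPolynomial.eval ![x, y] q) ^ 2 = (y * (1 - y)) ^ β * bubM a f := by
      intro a
      rw [← bub_M_Icc, ← integral_const_mul]
      congr 1; ext x; rw [hfe]; ring
    simp only [e]
    rw [mul_left_comm]
    refine mul_le_mul_of_nonneg_left ?_ (hw y hy β)
    rw [hP]
    exact H p hp f hf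
  rw [hPP, mul_assoc]
  exact s1.trans (mul_le_mul_of_nonneg_left s2 hP0)
end

section
/- Let K = {(x,y,z) ∈ ℝ³ : x ≥ 0, y ≥ 0, z ≥ 0, x + y + z ≤ 1} and let b(x,y,z) = x·y·z·(1 − x − y − z) be its bubble function. For all real numbers α, β with −1/2 < α ≤ β, there exists a constant c > 0 (depending only on α and β) such that for every integer p ≥ 1 and every real polynomial q in three variables of total degree at most p, ∫_K b^α q² ≤ c · p^{6(β−α)} · ∫_K b^β q². -/
open MeasureTheory

/-- The reference tetrahedron `K = {(x,y,z) : x,y,z ≥ 0, x + y + z ≤ 1}`. -/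
def refTetrahedron : Set (Fin 3 → ℝ) :=
  {z | (∀ i, 0 ≤ z i) ∧ z 0 + z 1 + z 2 ≤ 1}

/-- The self-reciprocal polynomial `w ^ p * r (-(w - 1) ^ 2 / (4 * w))`. -/
noncomputable def recipPoly (r : Polynomial ℝ) (p : ℕ) (w : ℂ) : ℂ :=
  ∑ k ∈ Finset.range (p + 1), (r.coeff k : ℂ) * ((-(w - 1) ^ 2 / 4) ^ k * w ^ (p - k))

lemma recipPoly_diff (r : Polynomial ℝ) (p : ℕ) : Differentiable ℂ (recipPoly r p) := by
  unfold recipPoly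
  fun_prop

lemma recipPoly_eq (r : Polynomial ℝ) (p : ℕ) (hr : r.natDegree ≤ p) (w : ℂ) (hw : w ≠ 0) :
    recipPoly r p w = w ^ p * (r.map Complex.ofRealHom).eval (-(w - 1) ^ 2 / (4 * w)) := by
  have hd : (r.map Complex.ofRealHom).natDegree < p + 1 :=
    lt_of_le_of_lt Polynomial.natDegree_map_le (by omega)
  rw [Polynomial.eval_eq_sum_range' hd, Finset.mul_sum]
  unfold recipPoly
  refine Finset.sum_congr rfl fun k hk => ?_
  have hk' : k ≤ p := by simpa [Nat.lt_succ_iff] using hk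
  rw [Polynomial.coeff_map]
  have h1 : (-(w - 1) ^ 2 / (4 * w)) = (-(w - 1) ^ 2 / 4) / w := by field_simp
  rw [h1, div_pow _ w]
  have h2 : w ^ p = w ^ (p - k) * w ^ k := by rw [← pow_add]; congr 1; omega
  rw [h2]
  have h3 : w ^ k ≠ 0 := pow_ne_zero _ hw
  simp only [Complex.ofRealHom_eq_coe]
  field_simp

lemma recipPoly_circle (r : Polynomial ℝ) (p : ℕ) (hr : r.natDegree ≤ p) (w : ℂ) (hw : ‖w‖ = 1) :
    ‖recipPoly r p w‖ = |r.eval ((1 - w.re) / 2)| := by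
  have hw0 : w ≠ 0 := by rintro rfl; simp at hw
  have h1 : w * (starRingEnd ℂ) w = 1 := by
    rw [Complex.mul_conj, Complex.normSq_eq_norm_sq, hw]; simp
  have h2 : w + (starRingEnd ℂ) w = 2 * (w.re : ℂ) := by
    rw [Complex.add_conj]; push_cast; ring
  have h3 : -(w - 1) ^ 2 / (4 * w) = (((1 - w.re) / 2 : ℝ) : ℂ) := by
    rw [div_eq_iff (by simpa using hw0)]
    push_cast
    linear_combination h1 - w * h2
  rw [recipPoly_eq r p hr w hw0, h3, norm_mul, norm_pow, hw, one_pow, one_mul]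
  rw [show (((1 - w.re) / 2 : ℝ) : ℂ) = Complex.ofRealHom ((1 - w.re) / 2) from rfl,
    Polynomial.eval_map_apply]
  simp

lemma recipPoly_disc (r : Polynomial ℝ) (p : ℕ) (hr : r.natDegree ≤ p) (M : ℝ)
    (hM : ∀ x ∈ Set.Icc (0 : ℝ) 1, |r.eval x| ≤ M) (w : ℂ) (hw : ‖w‖ ≤ 1) :
    ‖recipPoly r p w‖ ≤ M := by
  refine Complex.norm_le_of_forall_mem_frontier_norm_le (U := Metric.ball (0 : ℂ) 1)
    Metric.isBounded_ball (recipPoly_diff r p).diffContOnCl ?_ ?_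
  · intro z hz
    rw [frontier_ball (0 : ℂ) one_ne_zero] at hz
    have hz1 : ‖z‖ = 1 := by simpa using hz
    rw [recipPoly_circle r p hr z hz1]
    have h := Complex.abs_re_le_norm z
    rw [hz1, abs_le] at h
    exact hM _ ⟨by linarith, by linarith⟩
  · rw [closure_ball (0 : ℂ) one_ne_zero]
    simpa using hw

lemma recipPoly_big (r : Polynomial ℝ) (p : ℕ) (hp : 1 ≤ p) (hr : r.natDegree ≤ p) (M : ℝ)
    (hM : ∀ x ∈ Set.Icc (0 : ℝ) 1, |r.eval x| ≤ M) (w : ℂ) (hw : ‖w‖ ≤ 1 + 1 / p) :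
    ‖recipPoly r p w‖ ≤ 8 * M := by
  have hM0 : 0 ≤ M := (abs_nonneg _).trans (hM 0 (by simp))
  have hp' : (0 : ℝ) < p := by exact_mod_cast hp
  rcases le_or_gt ‖w‖ 1 with h | h
  · exact (recipPoly_disc r p hr M hM w h).trans (by linarith)
  have hw0 : w ≠ 0 := by rintro rfl; simp at h; linarith
  have h1 : recipPoly r p w = w ^ (2 * p) * recipPoly r p w⁻¹ := by
    rw [recipPoly_eq r p hr w hw0, recipPoly_eq r p hr _ (inv_ne_zero hw0)]
    have e : -(w⁻¹ - 1) ^ 2 / (4 * w⁻¹) = -(w - 1) ^ 2 / (4 * w) := by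
      field_simp; ring
    rw [e, ← mul_assoc]
    congr 1
    rw [inv_pow, two_mul, pow_add, mul_assoc, mul_inv_cancel₀ (pow_ne_zero _ hw0), mul_one]
  rw [h1, norm_mul, norm_pow]
  have h2 : ‖recipPoly r p w⁻¹‖ ≤ M := by
    apply recipPoly_disc r p hr M hM
    rw [norm_inv]; exact inv_le_one_of_one_le₀ h.le
  have h3 : ‖w‖ ^ (2 * p) ≤ 8 := by
    have h4 : ‖w‖ ≤ Real.exp (1 / p) := hw.trans (by rw [add_comm]; exact Real.add_one_le_exp _)
    calc ‖w‖ ^ (2 * p) ≤ (Real.exp (1 / p)) ^ (2 * p) := by gcongr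
      _ = Real.exp 1 ^ 2 := by
        rw [← Real.exp_nat_mul, ← Real.exp_nat_mul]; congr 1; push_cast; field_simp
      _ ≤ 8 := by
        have := Real.exp_one_lt_d9
        have := Real.exp_pos 1
        nlinarith
  gcongr

lemma recipPoly_lip (r : Polynomial ℝ) (p : ℕ) (hp : 1 ≤ p) (hr : r.natDegree ≤ p) (M : ℝ)
    (hM : ∀ x ∈ Set.Icc (0 : ℝ) 1, |r.eval x| ≤ M) (w w' : ℂ) (hw : ‖w‖ ≤ 1) (hw' : ‖w'‖ ≤ 1) :
    ‖recipPoly r p w - recipPoly r p w'‖ ≤ 8 * M * p * ‖w - w'‖ := by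
  have hp' : (0 : ℝ) < p := by exact_mod_cast hp
  refine Convex.norm_image_sub_le_of_norm_deriv_le (𝕜 := ℂ) (s := Metric.closedBall (0:ℂ) 1)
    (fun x _ => (recipPoly_diff r p) x) ?_ (convex_closedBall _ _) (by simpa using hw')
    (by simpa using hw)
  intro z hz
  have hz1 : ‖z‖ ≤ 1 := by simpa using hz
  have := Complex.norm_deriv_le_of_forall_mem_sphere_norm_le (c := z) (R := 1 / p) (C := 8 * M)
    (f := recipPoly r p) (by positivity) (recipPoly_diff r p).diffContOnCl (by
      intro y hy
      apply recipPoly_big r p hp hr M hM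
      have hy' : ‖y - z‖ = 1 / p := by simpa using hy
      calc ‖y‖ = ‖z + (y - z)‖ := by ring_nf
        _ ≤ ‖z‖ + ‖y - z‖ := norm_add_le _ _
        _ ≤ _ := by rw [hy']; gcongr)
  refine this.trans (le_of_eq ?_)
  field_simp

/-- Bernstein type inequality in the variable `s = √x`. -/
lemma bernstein_sqrt (r : Polynomial ℝ) (p : ℕ) (hp : 1 ≤ p) (hr : r.natDegree ≤ p) (M : ℝ)
    (hM : ∀ x ∈ Set.Icc (0 : ℝ) 1, |r.eval x| ≤ M) (s t : ℝ) (hs : 0 ≤ s) (ht : 0 ≤ t)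
    (hs1 : s ^ 2 ≤ 3 / 4) (ht1 : t ^ 2 ≤ 3 / 4) :
    |r.eval (s ^ 2)| - 48 * M * p * |s - t| ≤ |r.eval (t ^ 2)| := by
  have hM0 : 0 ≤ M := (abs_nonneg _).trans (hM 0 (by simp))
  have key : ∀ s : ℝ, s ^ 2 ≤ 3 / 4 → ∃ w : ℂ, w = (⟨√(1 - s ^ 2), s⟩ : ℂ) ∧ ‖w‖ = 1 ∧
      ‖w ^ 2‖ = 1 ∧ (1 - (w ^ 2).re) / 2 = s ^ 2 := by
    intro s hs
    have hq := Real.sq_sqrt (show 0 ≤ 1 - s ^ 2 by linarith)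
    have hn : ‖(⟨√(1 - s ^ 2), s⟩ : ℂ)‖ = 1 := by
      rw [← sq_eq_sq₀ (norm_nonneg _) zero_le_one, ← Complex.normSq_eq_norm_sq, Complex.normSq_mk]
      nlinarith
    refine ⟨_, rfl, hn, by rw [norm_pow, hn, one_pow], ?_⟩
    rw [sq, Complex.mul_re]
    simp only
    nlinarith
  obtain ⟨w, hw, hw1, hw2, hw3⟩ := key s hs1
  obtain ⟨v, hv, hv1, hv2, hv3⟩ := key t ht1
  have h1 := recipPoly_lip r p hp hr M hM (w ^ 2) (v ^ 2) hw2.le hv2.le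
  have h2 := recipPoly_circle r p hr _ hw2
  have h3 := recipPoly_circle r p hr _ hv2
  rw [hw3] at h2
  rw [hv3] at h3
  have h4 := norm_sub_norm_le (recipPoly r p (w ^ 2)) (recipPoly r p (v ^ 2))
  rw [h2, h3] at h4
  have h5 : ‖w ^ 2 - v ^ 2‖ ≤ 2 * ‖w - v‖ := by
    rw [sq_sub_sq, norm_mul]
    have := norm_add_le w v
    gcongr
    linarith
  have h6 : ‖w - v‖ ≤ 3 * |s - t| := by
    refine (Complex.norm_le_abs_re_add_abs_im _).trans ?_
    rw [hw, hv]
    simp only [Complex.sub_re, Complex.sub_im]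
    have ha := Real.sq_sqrt (show 0 ≤ 1 - s ^ 2 by linarith)
    have hb := Real.sq_sqrt (show 0 ≤ 1 - t ^ 2 by linarith)
    have ha2 : 1 / 2 ≤ √(1 - s ^ 2) := Real.le_sqrt_of_sq_le (by linarith)
    have hb2 : 1 / 2 ≤ √(1 - t ^ 2) := Real.le_sqrt_of_sq_le (by linarith)
    set A := √(1 - s ^ 2)
    set B := √(1 - t ^ 2)
    have hs' : s ≤ 1 := by nlinarith
    have ht' : t ≤ 1 := by nlinarith
    have e : |A - B| * (A + B) = |s - t| * (s + t) := by
      rw [← abs_of_nonneg (show 0 ≤ A + B by linarith), ← abs_of_nonneg (show 0 ≤ s + t by linarith),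
        ← abs_mul, ← abs_mul, ← abs_neg]
      congr 1
      linarith
    have := abs_nonneg (A - B)
    have := abs_nonneg (s - t)
    nlinarith
  have h7 : 8 * M * p * ‖w ^ 2 - v ^ 2‖ ≤ 8 * M * p * (6 * |s - t|) := by
    gcongr
    linarith
  linarith

lemma rpow_ge_min (α y : ℝ) (hy : 1 / 16 ≤ y) (hy1 : y ≤ 1) : min 1 ((1 / 16 : ℝ) ^ α) ≤ y ^ α := by
  rcases le_or_gt 0 α with h | h
  · exact (min_le_right _ _).trans (Real.rpow_le_rpow (by norm_num) hy h)
  · exact (min_le_left _ _).trans (Real.one_le_rpow_of_pos_of_le_one_of_nonpos (by linarith) hy1 h.le)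

lemma rpow_le_max (α y : ℝ) (hy : 1 / 16 ≤ y) (hy1 : y ≤ 1) : y ^ α ≤ max 1 ((1 / 16 : ℝ) ^ α) := by
  rcases le_or_gt 0 α with h | h
  · exact (Real.rpow_le_one (by linarith) hy1 h).trans (le_max_left _ _)
  · exact (Real.rpow_le_rpow_of_nonpos (by norm_num) hy h.le).trans (le_max_right _ _)

/-- The weighted square of `r`. -/
noncomputable def wsq (α : ℝ) (r : Polynomial ℝ) (x : ℝ) : ENNReal :=
  ENNReal.ofReal ((x * (1 - x)) ^ α * (r.eval x) ^ 2)

lemma lower_left (α : ℝ) (hα : -1 / 2 < α) (r : Polynomial ℝ) (p : ℕ) (hp : 1 ≤ p)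
    (hr : r.natDegree ≤ p) (x₀ : ℝ) (hx0 : 0 ≤ x₀) (hx1 : x₀ ≤ 1 / 2)
    (hM : ∀ x ∈ Set.Icc (0 : ℝ) 1, |r.eval x| ≤ |r.eval x₀|) :
    ENNReal.ofReal (min 1 ((1 / 16 : ℝ) ^ α) / 8 * (1 / (96 * p)) ^ (2 + 2 * α) * (r.eval x₀) ^ 2)
      ≤ ∫⁻ x in Set.Icc 0 1, wsq α r x := by
  have hp' : (1 : ℝ) ≤ p := by exact_mod_cast hp
  set m := min 1 ((1 / 16 : ℝ) ^ α) with hm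
  have hm0 : 0 < m := lt_min one_pos (by positivity)
  set h : ℝ := 1 / (96 * p) with hh
  have hh0 : 0 < h := by positivity
  have hh1 : h ≤ 1 / 96 := by
    rw [hh]; apply one_div_le_one_div_of_le <;> linarith
  have hph : p * h = 1 / 96 := by rw [hh]; field_simp
  set s := √x₀ with hs
  have hs0 : 0 ≤ s := Real.sqrt_nonneg _
  have hss : s ^ 2 = x₀ := Real.sq_sqrt hx0
  have hs1 : s ≤ 3 / 4 := by nlinarith
  set S := s + h with hS
  have hS1 : S ^ 2 ≤ 3 / 4 := by nlinarith
  have hS0 : 0 < S := by positivity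
  have hhS : h ≤ S := by linarith
  have hW : ∀ x ∈ Set.Icc ((S - h / 2) ^ 2) (S ^ 2),
      ENNReal.ofReal (m * S ^ (2 * α) * ((r.eval x₀) ^ 2 / 4)) ≤ wsq α r x := by
    intro x ⟨ha, hb⟩
    apply ENNReal.ofReal_le_ofReal
    have hx : 0 ≤ x := (sq_nonneg _).trans ha
    have hx34 : x ≤ 3 / 4 := hb.trans hS1
    have hq : (r.eval x₀) ^ 2 / 4 ≤ (r.eval x) ^ 2 := by
      have hb' := bernstein_sqrt r p hp hr _ hM s (√x) hs0 (Real.sqrt_nonneg _)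
        (by rw [hss]; linarith) (by rw [Real.sq_sqrt hx]; exact hx34)
      rw [hss, Real.sq_sqrt hx] at hb'
      have h1 : |s - √x| ≤ h := by
        have h2 : √x ≤ S := Real.sqrt_le_iff.2 ⟨hS0.le, hb⟩
        have h3 : S - h / 2 ≤ √x := Real.le_sqrt_of_sq_le ha
        rw [abs_le]; constructor <;> linarith
      have h4 : 48 * |r.eval x₀| * p * |s - √x| ≤ |r.eval x₀| / 2 := by
        calc 48 * |r.eval x₀| * p * |s - √x| ≤ 48 * |r.eval x₀| * p * h := by gcongr
          _ = |r.eval x₀| / 2 := by rw [mul_assoc, hph]; ring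
      have h5 : |r.eval x₀| / 2 ≤ |r.eval x| := by linarith
      rw [← sq_abs (r.eval x), ← sq_abs (r.eval x₀)]
      have := abs_nonneg (r.eval x₀)
      nlinarith
    have hw : m * S ^ (2 * α) ≤ (x * (1 - x)) ^ α := by
      have hS2 : 0 < S ^ 2 := by positivity
      have e : x * (1 - x) = S ^ 2 * (x / S ^ 2 * (1 - x)) := by field_simp
      have hx4 : 1 / 4 ≤ x / S ^ 2 := by
        rw [le_div_iff₀ hS2]; nlinarith
      have hx41 : x / S ^ 2 ≤ 1 := by
        rw [div_le_one hS2]; exact hb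
      have y1 : 1 / 16 ≤ x / S ^ 2 * (1 - x) := by nlinarith
      have y2 : x / S ^ 2 * (1 - x) ≤ 1 := by nlinarith
      rw [e, Real.mul_rpow hS2.le (by linarith), mul_comm,
        show S ^ (2 * α) = (S ^ 2) ^ α by rw [Real.rpow_mul hS0.le]; norm_num]
      gcongr
      exact rpow_ge_min α _ y1 y2
    have hw0 : 0 ≤ (x * (1 - x)) ^ α := le_trans (by positivity) hw
    gcongr
  have hsub : Set.Icc ((S - h / 2) ^ 2) (S ^ 2) ⊆ Set.Icc 0 1 := by
    apply Set.Icc_subset_Icc (sq_nonneg _) (by linarith)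
  calc _ ≤ ENNReal.ofReal (m * S ^ (2 * α) * ((r.eval x₀) ^ 2 / 4)) *
        volume (Set.Icc ((S - h / 2) ^ 2) (S ^ 2)) := by
        rw [Real.volume_Icc, ← ENNReal.ofReal_mul (by positivity)]
        apply ENNReal.ofReal_le_ofReal
        have h1 : h / 2 * S ≤ S ^ 2 - (S - h / 2) ^ 2 := by nlinarith
        have h2 : h ^ (2 + 2 * α) ≤ h * S ^ (2 * α) * S := by
          have e1 : h ^ (2 + 2 * α) = h * h ^ (1 + 2 * α) := by
            rw [show 2 + 2 * α = 1 + (1 + 2 * α) by ring, Real.rpow_add hh0 1, Real.rpow_one]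
          have e2 : S ^ (2 * α) * S = S ^ (1 + 2 * α) := by
            rw [add_comm, Real.rpow_add hS0, Real.rpow_one]
          rw [e1, mul_assoc, e2]
          gcongr
          linarith
        calc m / 8 * h ^ (2 + 2 * α) * r.eval x₀ ^ 2
            ≤ m / 8 * (h * S ^ (2 * α) * S) * r.eval x₀ ^ 2 := by gcongr
          _ = m * S ^ (2 * α) * (r.eval x₀ ^ 2 / 4) * (h / 2 * S) := by ring
          _ ≤ _ := by gcongr
    _ = ∫⁻ x in Set.Icc ((S - h / 2) ^ 2) (S ^ 2),
          ENNReal.ofReal (m * S ^ (2 * α) * ((r.eval x₀) ^ 2 / 4)) := by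
        rw [setLIntegral_const]
    _ ≤ ∫⁻ x in Set.Icc ((S - h / 2) ^ 2) (S ^ 2), wsq α r x :=
        setLIntegral_mono' measurableSet_Icc hW
    _ ≤ _ := lintegral_mono_set hsub

lemma lower_bd (α : ℝ) (hα : -1 / 2 < α) (r : Polynomial ℝ) (p : ℕ) (hp : 1 ≤ p)
    (hr : r.natDegree ≤ p) (x₀ : ℝ) (hx0 : 0 ≤ x₀) (hx1 : x₀ ≤ 1)
    (hM : ∀ x ∈ Set.Icc (0 : ℝ) 1, |r.eval x| ≤ |r.eval x₀|) :
    ENNReal.ofReal (min 1 ((1 / 16 : ℝ) ^ α) / 8 * (1 / (96 * p)) ^ (2 + 2 * α) * (r.eval x₀) ^ 2)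
      ≤ ∫⁻ x in Set.Icc 0 1, wsq α r x := by
  rcases le_total x₀ (1 / 2) with h | h
  · exact lower_left α hα r p hp hr x₀ hx0 h hM
  have hev : ∀ x, (r.comp (1 - Polynomial.X)).eval x = r.eval (1 - x) := by
    intro x; simp [Polynomial.eval_comp]
  have hdeg : (r.comp (1 - Polynomial.X)).natDegree ≤ p := by
    refine Polynomial.natDegree_comp_le.trans ?_
    have : (1 - Polynomial.X : Polynomial ℝ).natDegree ≤ 1 := by
      refine (Polynomial.natDegree_sub_le _ _).trans (by simp)
    nlinarith
  have := lower_left α hα (r.comp (1 - Polynomial.X)) p hp hdeg (1 - x₀) (by linarith)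
    (by linarith) (by
      intro x hx
      rw [hev, hev, sub_sub_cancel]
      exact hM _ ⟨by linarith [hx.2], by linarith [hx.1]⟩)
  rw [hev, sub_sub_cancel] at this
  refine this.trans (le_of_eq ?_)
  rw [← lintegral_indicator measurableSet_Icc, ← lintegral_indicator measurableSet_Icc,
    ← lintegral_sub_left_eq_self _ (1 : ℝ)]
  congr 1
  ext x
  have e : (1 - x ∈ Set.Icc (0:ℝ) 1) ↔ x ∈ Set.Icc (0:ℝ) 1 := by
    simp only [Set.mem_Icc]; constructor <;> rintro ⟨a, b⟩ <;> constructor <;> linarith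
  by_cases hx : x ∈ Set.Icc (0:ℝ) 1
  · rw [Set.indicator_of_mem (e.2 hx), Set.indicator_of_mem hx]
    unfold wsq
    rw [hev, sub_sub_cancel, mul_comm x]
  · rw [Set.indicator_of_notMem (fun h => hx (e.1 h)), Set.indicator_of_notMem hx]

lemma upper_bd (α : ℝ) (hα : -1 / 2 < α) (r : Polynomial ℝ) (M δ : ℝ) (hδ : 0 < δ)
    (hδ1 : δ ≤ 1 / 2) (hM : ∀ x ∈ Set.Icc (0 : ℝ) 1, |r.eval x| ≤ |M|) :
    ∫⁻ x in Set.Ico 0 δ, wsq α r x ≤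
      ENNReal.ofReal (max 1 ((1 / 16 : ℝ) ^ α) / (1 + α) * δ ^ (1 + α) * M ^ 2) := by
  set m := max 1 ((1 / 16 : ℝ) ^ α) with hm
  have hm0 : 0 < m := lt_max_of_lt_left one_pos
  have h1 : ∀ x ∈ Set.Ico 0 δ, wsq α r x ≤ ENNReal.ofReal (m * M ^ 2 * x ^ α) := by
    rintro x ⟨ha, hb⟩
    apply ENNReal.ofReal_le_ofReal
    rw [Real.mul_rpow ha (by linarith)]
    have h2 := rpow_le_max α (1 - x) (by linarith) (by linarith)
    have h3 : (r.eval x) ^ 2 ≤ M ^ 2 := sq_le_sq.2 (hM x ⟨ha, by linarith⟩)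
    have := Real.rpow_nonneg ha α
    calc x ^ α * (1 - x) ^ α * (r.eval x) ^ 2 ≤ x ^ α * m * M ^ 2 := by gcongr
      _ = _ := by ring
  have hIntg : IntegrableOn (fun x : ℝ => m * M ^ 2 * x ^ α) (Set.Ioc 0 δ) := by
    have := (intervalIntegral.intervalIntegrable_rpow' (a := 0) (b := δ) (r := α) (by linarith))
    exact ((intervalIntegrable_iff_integrableOn_Ioc_of_le hδ.le).1 this).const_mul _
  calc _ ≤ ∫⁻ x in Set.Ico 0 δ, ENNReal.ofReal (m * M ^ 2 * x ^ α) :=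
        setLIntegral_mono' measurableSet_Ico h1
    _ = ∫⁻ x in Set.Ioc 0 δ, ENNReal.ofReal (m * M ^ 2 * x ^ α) :=
        setLIntegral_congr (Ico_ae_eq_Ioc)
    _ = ENNReal.ofReal (∫ x in Set.Ioc 0 δ, m * M ^ 2 * x ^ α) := by
        rw [ofReal_integral_eq_lintegral_ofReal hIntg]
        refine (ae_restrict_iff' measurableSet_Ioc).2 (Filter.Eventually.of_forall fun x hx => ?_)
        have := Real.rpow_nonneg hx.1.le α
        positivity
    _ = _ := by
        rw [← intervalIntegral.integral_of_le hδ.le, intervalIntegral.integral_const_mul,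
          integral_rpow (Or.inl (by linarith)), Real.zero_rpow (by linarith), add_comm α 1]
        congr 1
        ring
    _ ≤ _ := le_rfl

lemma unit_excl (α : ℝ) (hα : -1 / 2 < α) (κ : ℝ) (hκ : 0 < κ) : ∃ ε : ℝ, 0 < ε ∧ ε ≤ 1 / 2 ∧
    ∀ p : ℕ, 1 ≤ p → ∀ r : Polynomial ℝ, r.natDegree ≤ p →
      ∫⁻ x in Set.Ico 0 (ε / p ^ 2), wsq α r x ≤
        ENNReal.ofReal κ * ∫⁻ x in Set.Icc 0 1, wsq α r x := by
  set m := min 1 ((1 / 16 : ℝ) ^ α) with hm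
  have hm0 : 0 < m := lt_min one_pos (by positivity)
  set m' := max 1 ((1 / 16 : ℝ) ^ α) with hm'
  have hm0' : 0 < m' := lt_max_of_lt_left one_pos
  have ha : 0 < 1 + α := by linarith
  set A := κ * (m / 8 * (1 / 96) ^ (2 + 2 * α)) / (m' / (1 + α)) with hA
  have hA0 : 0 < A := by positivity
  refine ⟨min (1 / 2) (A ^ (1 / (1 + α))), lt_min (by norm_num) (by positivity), min_le_left _ _, ?_⟩
  intro p hp r hr
  set ε := min (1 / 2) (A ^ (1 / (1 + α))) with hε
  have hε0 : 0 < ε := lt_min (by norm_num) (by positivity)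
  have hεA : ε ^ (1 + α) ≤ A := by
    calc ε ^ (1 + α) ≤ (A ^ (1 / (1 + α))) ^ (1 + α) := by
          gcongr; exact min_le_right _ _
      _ = A := by rw [← Real.rpow_mul hA0.le, one_div_mul_cancel ha.ne', Real.rpow_one]
  have hp' : (1 : ℝ) ≤ p := by exact_mod_cast hp
  have hp0 : (0 : ℝ) < p := by linarith
  obtain ⟨x₀, hx₀, hmax⟩ := (isCompact_Icc (a := (0:ℝ)) (b := 1)).exists_isMaxOn ⟨0, by simp⟩
    (f := fun x => |r.eval x|) (by fun_prop)
  have hM : ∀ x ∈ Set.Icc (0 : ℝ) 1, |r.eval x| ≤ |r.eval x₀| := fun x hx => hmax hx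
  have hδ1 : ε / p ^ 2 ≤ 1 / 2 := by
    rw [div_le_iff₀ (by positivity)]
    have : ε ≤ 1 / 2 := min_le_left _ _
    nlinarith
  refine (upper_bd α hα r _ (ε / p ^ 2) (by positivity) hδ1 hM).trans ?_
  refine le_trans ?_ (mul_le_mul_right (lower_bd α hα r p hp hr x₀ hx₀.1 hx₀.2 hM) _)
  rw [← ENNReal.ofReal_mul hκ.le]
  apply ENNReal.ofReal_le_ofReal
  rw [← hm, ← hm']
  have e1 : (ε / p ^ 2) ^ (1 + α) = ε ^ (1 + α) * (1 / p : ℝ) ^ (2 + 2 * α) := by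
    rw [show 2 + 2 * α = 2 * (1 + α) by ring, Real.rpow_mul (by positivity),
      ← Real.mul_rpow hε0.le (by positivity)]
    congr 1
    norm_num
    ring
  have e2 : (1 / (96 * p) : ℝ) ^ (2 + 2 * α) = (1 / 96) ^ (2 + 2 * α) * (1 / p : ℝ) ^ (2 + 2 * α) := by
    rw [← Real.mul_rpow (by positivity) (by positivity)]
    congr 1
    field_simp
  rw [e1, e2]
  calc _ ≤ m' / (1 + α) * (A * (1 / p : ℝ) ^ (2 + 2 * α)) * r.eval x₀ ^ 2 := by gcongr
    _ = κ * (m / 8 * ((1 / 96) ^ (2 + 2 * α) * (1 / p : ℝ) ^ (2 + 2 * α)) * r.eval x₀ ^ 2) := by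
      rw [hA]; field_simp
    _ ≤ _ := le_rfl

lemma lintegral_scale (L : ℝ) (hL : 0 < L) (F : ℝ → ENNReal) (hF : Measurable F) :
    ∫⁻ x, F x = ENNReal.ofReal L * ∫⁻ x, F (L * x) := by
  conv_lhs => rw [← Real.smul_map_volume_mul_left hL.ne']
  rw [lintegral_smul_measure, lintegral_map hF (by fun_prop), abs_of_pos hL, smul_eq_mul]

lemma scaled_excl (α : ℝ) (κ : ENNReal) (η : ℝ) (h1 : η ≤ 1) (p : ℕ)
    (H : ∀ r : Polynomial ℝ, r.natDegree ≤ p →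
      ∫⁻ x in Set.Ico 0 η, wsq α r x ≤ κ * ∫⁻ x in Set.Icc 0 1, wsq α r x)
    (r : Polynomial ℝ) (hr : r.natDegree ≤ p) (L D : ℝ) (hL : 0 < L) (hD : 0 ≤ D) :
    ∫⁻ x in Set.Ico 0 (η * L), ENNReal.ofReal ((D * (x * (L - x))) ^ α * r.eval x ^ 2) ≤
      κ * ∫⁻ x in Set.Icc 0 L, ENNReal.ofReal ((D * (x * (L - x))) ^ α * r.eval x ^ 2) := by
  set r' := r.comp (Polynomial.C L * Polynomial.X) with hr'
  have hev : ∀ x, r'.eval x = r.eval (L * x) := by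
    intro x; simp [hr', Polynomial.eval_comp]
  have hdeg : r'.natDegree ≤ p := by
    refine Polynomial.natDegree_comp_le.trans ?_
    have : (Polynomial.C L * Polynomial.X : Polynomial ℝ).natDegree ≤ 1 :=
      (Polynomial.natDegree_C_mul_le _ _).trans Polynomial.natDegree_X_le
    nlinarith
  set F : ℝ → ENNReal := fun x => ENNReal.ofReal ((D * (x * (L - x))) ^ α * r.eval x ^ 2) with hF
  have hFm : Measurable F := by
    have : Measurable fun x => r.eval x := r.continuous.measurable
    fun_prop
  have hpt : ∀ x ∈ Set.Icc (0:ℝ) 1, F (L * x) = ENNReal.ofReal ((D * L ^ 2) ^ α) * wsq α r' x := by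
    intro x hx
    have hx1 : 0 ≤ 1 - x := by linarith [hx.2]
    have hx0 := hx.1
    rw [hF, wsq, ← ENNReal.ofReal_mul (by positivity)]
    simp only
    rw [hev, ← mul_assoc (_ ^ α), ← Real.mul_rpow (by positivity) (by positivity)]
    congr 3
    ring
  have hsc : ∀ (S S' : Set ℝ), MeasurableSet S → MeasurableSet S' → S' ⊆ Set.Icc 0 1 →
      (∀ x, L * x ∈ S ↔ x ∈ S') → ∫⁻ x in S, F x = ENNReal.ofReal L *
        (ENNReal.ofReal ((D * L ^ 2) ^ α) * ∫⁻ x in S', wsq α r' x) := by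
    intro S S' hS hS' hsub hiff
    rw [← lintegral_indicator hS, lintegral_scale L hL _ (hFm.indicator hS),
      ← lintegral_const_mul' (ENNReal.ofReal ((D * L ^ 2) ^ α)) _ ENNReal.ofReal_ne_top,
      ← lintegral_indicator hS']
    congr 1
    refine lintegral_congr fun x => ?_
    by_cases hx : x ∈ S'
    · rw [Set.indicator_of_mem ((hiff x).2 hx), Set.indicator_of_mem hx, hpt x (hsub hx)]
    · rw [Set.indicator_of_notMem (fun h => hx ((hiff x).1 h)), Set.indicator_of_notMem hx]
  rw [hsc (Set.Ico 0 (η * L)) (Set.Ico 0 η) measurableSet_Ico measurableSet_Ico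
    (fun x hx => ⟨hx.1, hx.2.le.trans h1⟩) (by
      intro x
      rw [Set.mem_Ico, Set.mem_Ico, mul_comm η L, mul_lt_mul_iff_right₀ hL,
        mul_nonneg_iff_of_pos_left hL]),
    hsc (Set.Icc 0 L) (Set.Icc 0 1) measurableSet_Icc measurableSet_Icc le_rfl (by
      intro x
      rw [Set.mem_Icc, Set.mem_Icc, mul_nonneg_iff_of_pos_left hL, mul_le_iff_le_one_right hL])]
  calc _ ≤ ENNReal.ofReal L * (ENNReal.ofReal ((D * L ^ 2) ^ α) *
        (κ * ∫⁻ x in Set.Icc 0 1, wsq α r' x)) := by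
          gcongr; exact H r' hdeg
    _ = _ := by ring

/-- Barycentric coordinates. -/
def bary (v : Fin 3 → ℝ) : Fin 4 → ℝ := ![v 0, v 1, v 2, 1 - v 0 - v 1 - v 2]

lemma mem_ref_iff (v : Fin 3 → ℝ) : v ∈ refTetrahedron ↔ ∀ i, 0 ≤ bary v i := by
  simp only [refTetrahedron, bary, Set.mem_ofPred_eq, Fin.forall_fin_succ, Matrix.cons_val_zero,
    Matrix.cons_val_succ, Fin.succ_zero_eq_one, Fin.succ_one_eq_two]
  simp
  constructor
  · rintro ⟨⟨a, b, c⟩, d⟩; exact ⟨a, b, c, by linarith⟩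
  · rintro ⟨a, b, c, d⟩; exact ⟨⟨a, b, c⟩, by linarith⟩

lemma bary_cont (i : Fin 4) : Continuous fun v => bary v i := by
  unfold bary
  fin_cases i <;> simp <;> fun_prop

lemma ref_closed : IsClosed refTetrahedron := by
  have : refTetrahedron = ⋂ i, {v | 0 ≤ bary v i} := by
    ext v; simp [mem_ref_iff]
  rw [this]
  exact isClosed_iInter fun i => isClosed_le continuous_const (bary_cont i)

/-- The weighted square density of `f`. -/
noncomputable def dens (α : ℝ) (f : (Fin 3 → ℝ) → ℝ) (v : Fin 3 → ℝ) : ENNReal :=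
  ENNReal.ofReal ((v 0 * v 1 * v 2 * (1 - v 0 - v 1 - v 2)) ^ α * f v ^ 2)

/-- `f` restricted to every line is a polynomial of degree at most `p`. -/
def LinePoly (p : ℕ) (f : (Fin 3 → ℝ) → ℝ) : Prop :=
  ∀ a v : Fin 3 → ℝ, ∃ r : Polynomial ℝ, r.natDegree ≤ p ∧ ∀ t : ℝ, f (a + t • v) = r.eval t

lemma dens_meas (α : ℝ) (f : (Fin 3 → ℝ) → ℝ) (hf : Measurable f) : Measurable (dens α f) := by
  unfold dens
  fun_prop

lemma lintegral_fin3 (F : (Fin 3 → ℝ) → ENNReal) (hF : Measurable F) :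
    ∫⁻ v, F v = ∫⁻ u : Fin 2 → ℝ, ∫⁻ x : ℝ, F ![x, u 0, u 1] := by
  have e := (volume_preserving_piFinSuccAbove (fun _ : Fin 3 => ℝ) 0).symm
  rw [← e.lintegral_comp hF, Measure.volume_eq_prod, lintegral_prod_symm]
  · refine lintegral_congr fun u => lintegral_congr fun x => ?_
    congr 1
    ext i
    fin_cases i <;> rfl
  · exact (hF.comp e.measurable).aemeasurable

lemma base_excl (α : ℝ) (κ : ENNReal) (η : ℝ) (h1 : η ≤ 1) (p : ℕ)
    (H : ∀ r : Polynomial ℝ, r.natDegree ≤ p →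
      ∫⁻ x in Set.Ico 0 η, wsq α r x ≤ κ * ∫⁻ x in Set.Icc 0 1, wsq α r x)
    (f : (Fin 3 → ℝ) → ℝ) (hf : Measurable f) (hp : LinePoly p f) :
    ∫⁻ v in refTetrahedron ∩ {v | bary v 0 < η * (bary v 0 + bary v 3)}, dens α f v ≤
      κ * ∫⁻ v in refTetrahedron, dens α f v := by
  have hK : MeasurableSet refTetrahedron := ref_closed.measurableSet
  have hB : MeasurableSet {v | bary v 0 < η * (bary v 0 + bary v 3)} := by
    have h0 := (bary_cont 0).measurable
    have h3 := (bary_cont 3).measurable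
    exact measurableSet_lt h0 ((h0.add h3).const_mul η)
  have hd := dens_meas α f hf
  rw [← lintegral_indicator (hK.inter hB), ← lintegral_indicator hK,
    lintegral_fin3 _ (hd.indicator (hK.inter hB)), lintegral_fin3 _ (hd.indicator hK)]
  have hmeas : Measurable fun u : Fin 2 → ℝ =>
      ∫⁻ x : ℝ, refTetrahedron.indicator (dens α f) ![x, u 0, u 1] := by
    apply Measurable.lintegral_prod_right' (f := fun q : (Fin 2 → ℝ) × ℝ =>
      refTetrahedron.indicator (dens α f) ![q.2, q.1 0, q.1 1])
    apply (hd.indicator hK).comp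
    rw [measurable_pi_iff]
    intro i
    fin_cases i <;> simp <;> fun_prop
  rw [← lintegral_const_mul _ hmeas]
  refine lintegral_mono fun u => ?_
  simp only
  by_cases hu : 0 ≤ u 0 ∧ 0 ≤ u 1 ∧ 0 < 1 - u 0 - u 1
  swap
  · have : ∀ x : ℝ, (refTetrahedron ∩ {v | bary v 0 < η * (bary v 0 + bary v 3)}).indicator
        (dens α f) ![x, u 0, u 1] = 0 := by
      intro x
      apply Set.indicator_of_notMem
      rintro ⟨⟨ha, hb⟩, hc⟩
      have a0 := ha 0
      have a1 := ha 1
      have a2 := ha 2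
      simp [bary] at a0 a1 a2 hb hc
      apply hu
      refine ⟨a1, a2, ?_⟩
      by_contra hcon
      have : x = 0 := by linarith
      have : 1 - u 0 - u 1 = 0 := by linarith
      have : x + (1 - x - u 0 - u 1) = 0 := by linarith
      rw [this] at hc
      linarith
    simp only [this]
    simp
  obtain ⟨hu0, hu1, hL⟩ := hu
  set L := 1 - u 0 - u 1 with hLd
  obtain ⟨r, hr, hre⟩ := hp ![0, u 0, u 1] ![1, 0, 0]
  have hre' : ∀ x : ℝ, f ![x, u 0, u 1] = r.eval x := by
    intro x
    rw [← hre]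
    congr 1
    ext i
    fin_cases i <;> simp
  have key := scaled_excl α κ η h1 p H r hr L (u 0 * u 1) hL (by positivity)
  rw [← lintegral_indicator measurableSet_Ico, ← lintegral_indicator measurableSet_Icc] at key
  have hden : ∀ x : ℝ, dens α f ![x, u 0, u 1] =
      ENNReal.ofReal ((u 0 * u 1 * (x * (L - x))) ^ α * r.eval x ^ 2) := by
    intro x
    unfold dens
    rw [hre']
    congr 3
    simp [hLd]
    ring
  refine (le_of_eq ?_).trans (key.trans (le_of_eq ?_))
  · refine lintegral_congr fun x => ?_
    have : (![x, u 0, u 1] ∈ (refTetrahedron ∩ {v | bary v 0 < η * (bary v 0 + bary v 3)})) ↔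
        x ∈ Set.Ico 0 (η * L) := by
      have e : x + (1 - x - u 0 - u 1) = L := by rw [hLd]; ring
      simp only [refTetrahedron, bary, Set.mem_inter_iff, Set.mem_ofPred_eq, Fin.forall_fin_succ]
      simp [e]
      intro g
      constructor
      · rintro ⟨⟨a, b, c⟩, d⟩; exact a
      · intro a
        refine ⟨⟨a, hu0, hu1⟩, ?_⟩
        have : η * L ≤ L := by nlinarith
        linarith
    by_cases hx : x ∈ Set.Ico 0 (η * L)
    · rw [Set.indicator_of_mem (this.2 hx), Set.indicator_of_mem hx, hden]
    · rw [Set.indicator_of_notMem (fun h => hx (this.1 h)), Set.indicator_of_notMem hx]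
  · congr 1
    refine lintegral_congr fun x => ?_
    have : (![x, u 0, u 1] ∈ refTetrahedron) ↔ x ∈ Set.Icc 0 L := by
      simp only [refTetrahedron, Set.mem_ofPred_eq, Fin.forall_fin_succ]
      simp
      constructor
      · rintro ⟨⟨a, b, c⟩, d⟩; exact ⟨a, by linarith⟩
      · rintro ⟨a, g⟩
        exact ⟨⟨a, hu0, hu1⟩, by linarith⟩
    by_cases hx : x ∈ Set.Icc 0 L
    · rw [Set.indicator_of_mem (this.2 hx), Set.indicator_of_mem hx, hden]
    · rw [Set.indicator_of_notMem (fun h => hx (this.1 h)), Set.indicator_of_notMem hx]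

/-- The affine symmetry of the tetrahedron given by a permutation of the vertices. -/
def symT (σ : Equiv.Perm (Fin 4)) (v : Fin 3 → ℝ) : Fin 3 → ℝ := fun k => bary v (σ k.castSucc)

lemma bary_sum (v : Fin 3 → ℝ) : ∑ i, bary v i = 1 := by
  simp [bary, Fin.sum_univ_four]

lemma bary_symT (σ : Equiv.Perm (Fin 4)) (v : Fin 3 → ℝ) (i : Fin 4) :
    bary (symT σ v) i = bary v (σ i) := by
  have h := bary_sum v
  rw [← Equiv.sum_comp σ, Fin.sum_univ_four] at h
  fin_cases i
  · rfl
  · rfl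
  · rfl
  · change 1 - bary v (σ 0) - bary v (σ 1) - bary v (σ 2) = bary v (σ 3)
    linarith

lemma bub_eq (v : Fin 3 → ℝ) : v 0 * v 1 * v 2 * (1 - v 0 - v 1 - v 2) = ∏ i, bary v i := by
  simp [bary, Fin.prod_univ_four]

/-- Integer matrix of the linear part of `symT`. -/
def symM (σ : Equiv.Perm (Fin 4)) : Matrix (Fin 3) (Fin 3) ℤ :=
  fun k j => (if σ k.castSucc = j.castSucc then 1 else 0) - (if σ k.castSucc = 3 then 1 else 0)

lemma symM_det (σ : Equiv.Perm (Fin 4)) : (symM σ).det ^ 2 = 1 := by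
  rw [Matrix.det_fin_three]
  revert σ
  decide

lemma symT_eq (σ : Equiv.Perm (Fin 4)) (v : Fin 3 → ℝ) :
    symT σ v = (((symM σ).map (Int.castRingHom ℝ)).toLin' v) + symT σ 0 := by
  ext k
  simp only [symT, Pi.add_apply, Matrix.toLin'_apply, Matrix.mulVec, dotProduct, Matrix.map_apply,
    symM, Fin.sum_univ_three]
  generalize σ k.castSucc = j
  fin_cases j <;> (simp [bary]; try ring)

lemma symT_mp (σ : Equiv.Perm (Fin 4)) : MeasurePreserving (symT σ) volume volume := by
  have hdet : (((symM σ).map (Int.castRingHom ℝ)).det) ^ 2 = 1 := by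
    have := congrArg (Int.castRingHom ℝ) (symM_det σ)
    rw [map_pow, RingHom.map_det] at this
    simpa using this
  have hne : ((symM σ).map (Int.castRingHom ℝ)).det ≠ 0 := by
    intro h; rw [h] at hdet; norm_num at hdet
  have h1 : MeasurePreserving (((symM σ).map (Int.castRingHom ℝ)).toLin') volume volume := by
    refine ⟨(LinearMap.continuous_of_finiteDimensional _).measurable, ?_⟩
    rw [Real.map_matrix_volume_pi_eq_smul_volume_pi hne]
    have : |(((symM σ).map (Int.castRingHom ℝ)).det)⁻¹| = 1 := by
      rw [abs_inv, inv_eq_one]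
      exact (pow_eq_one_iff_of_nonneg (abs_nonneg _) two_ne_zero).1 (by rw [sq_abs]; exact hdet)
    rw [this]; simp
  have h2 := (measurePreserving_add_right (volume : Measure (Fin 3 → ℝ)) (symT σ 0)).comp h1
  convert h2 using 1
  ext1 v
  exact symT_eq σ v

lemma symT_line (σ : Equiv.Perm (Fin 4)) (p : ℕ) (f : (Fin 3 → ℝ) → ℝ) (hp : LinePoly p f) :
    LinePoly p (fun v => f (symT σ v)) := by
  intro a v
  obtain ⟨r, hr, hre⟩ := hp (symT σ a) (((symM σ).map (Int.castRingHom ℝ)).toLin' v)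
  refine ⟨r, hr, fun t => ?_⟩
  rw [← hre]
  change f (symT σ (a + t • v)) = _
  congr 1
  rw [symT_eq, symT_eq σ a, map_add, map_smul]
  abel

lemma symT_inv (σ : Equiv.Perm (Fin 4)) (v : Fin 3 → ℝ) : symT σ (symT σ⁻¹ v) = v := by
  ext k
  change bary (symT σ⁻¹ v) (σ k.castSucc) = v k
  rw [bary_symT]
  simp
  fin_cases k <;> rfl

lemma sym_excl (α : ℝ) (κ : ENNReal) (η : ℝ) (h1 : η ≤ 1) (p : ℕ)
    (H : ∀ r : Polynomial ℝ, r.natDegree ≤ p →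
      ∫⁻ x in Set.Ico 0 η, wsq α r x ≤ κ * ∫⁻ x in Set.Icc 0 1, wsq α r x)
    (f : (Fin 3 → ℝ) → ℝ) (hf : Measurable f) (hp : LinePoly p f) (σ : Equiv.Perm (Fin 4)) :
    ∫⁻ v in refTetrahedron ∩ {v | bary v (σ 0) < η * (bary v (σ 0) + bary v (σ 3))}, dens α f v ≤
      κ * ∫⁻ v in refTetrahedron, dens α f v := by
  have hmp := symT_mp σ
  have hgm : Measurable fun v => f (symT σ⁻¹ v) := hf.comp (symT_mp σ⁻¹).measurable
  have key := base_excl α κ η h1 p H _ hgm (symT_line σ⁻¹ p f hp)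
  have hK : MeasurableSet refTetrahedron := ref_closed.measurableSet
  have hB : MeasurableSet {v | bary v 0 < η * (bary v 0 + bary v 3)} := by
    have h0 := (bary_cont 0).measurable
    have h3 := (bary_cont 3).measurable
    exact measurableSet_lt h0 ((h0.add h3).const_mul η)
  have hd := dens_meas α _ hgm
  have hden : ∀ v, dens α (fun v => f (symT σ⁻¹ v)) (symT σ v) = dens α f v := by
    intro v
    simp only [dens]
    have := symT_inv σ⁻¹ v
    rw [inv_inv] at this
    rw [this, bub_eq, bub_eq]
    simp only [bary_symT]
    rw [Equiv.prod_comp σ (fun i => bary v i)]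
  rw [← hmp.setLIntegral_comp_preimage (hK.inter hB) hd, ← hmp.setLIntegral_comp_preimage hK hd] at key
  simp only [hden] at key
  have eK : symT σ ⁻¹' refTetrahedron = refTetrahedron := by
    ext v
    simp only [Set.mem_preimage, mem_ref_iff, bary_symT]
    exact ⟨fun h i => by simpa using h (σ⁻¹ i), fun h i => h _⟩
  rw [Set.preimage_inter, eK] at key
  simpa only [Set.preimage_ofPred_eq, bary_symT] using key

lemma eval_line (q : MvPolynomial (Fin 3) ℝ) (p : ℕ) (hq : q.totalDegree ≤ p) :
    LinePoly p (fun v => MvPolynomial.eval v q) := by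
  intro a v
  refine ⟨MvPolynomial.aeval (fun i => Polynomial.C (v i) * Polynomial.X + Polynomial.C (a i)) q,
    ?_, fun t => ?_⟩
  · simpa using MvPolynomial.aeval_natDegree_le (n := 1) q hq
      (fun i => Polynomial.C (v i) * Polynomial.X + Polynomial.C (a i))
      (fun i => Polynomial.natDegree_linear_le)
  · have h := MvPolynomial.comp_aeval_apply
      (fun i => Polynomial.C (v i) * Polynomial.X + Polynomial.C (a i))
      (Polynomial.aeval (R := ℝ) t) q
    rw [Polynomial.coe_aeval_eq_eval] at h
    rw [h, MvPolynomial.aeval_eq_eval]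
    simp only
    congr 2
    ext i
    simp
    ring

lemma exists_perm : ∀ i j : Fin 4, i ≠ j → ∃ σ : Equiv.Perm (Fin 4), σ 0 = i ∧ σ 3 = j := by
  decide

lemma bub_lower (v : Fin 3 → ℝ) (η : ℝ) (hη : 0 < η) (hv : v ∈ refTetrahedron)
    (h : ∀ σ : Equiv.Perm (Fin 4), η * (bary v (σ 0) + bary v (σ 3)) ≤ bary v (σ 0)) :
    η ^ 3 / 256 ≤ v 0 * v 1 * v 2 * (1 - v 0 - v 1 - v 2) := by
  rw [mem_ref_iff] at hv
  obtain ⟨j, -, hj⟩ := Finset.exists_max_image Finset.univ (bary v) ⟨0, Finset.mem_univ _⟩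
  have hj4 : 1 / 4 ≤ bary v j := by
    have := bary_sum v
    rw [Fin.sum_univ_four] at this
    linarith [hj 0 (Finset.mem_univ _), hj 1 (Finset.mem_univ _), hj 2 (Finset.mem_univ _),
      hj 3 (Finset.mem_univ _)]
  have hi : ∀ i ∈ Finset.univ.erase j, η / 4 ≤ bary v i := by
    intro i hi
    obtain ⟨σ, h0, h3⟩ := exists_perm i j (Finset.ne_of_mem_erase hi)
    have := h σ
    rw [h0, h3] at this
    have := hv i
    nlinarith
  rw [bub_eq, ← Finset.mul_prod_erase _ _ (Finset.mem_univ j)]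
  have h1 : ∏ i ∈ Finset.univ.erase j, (η / 4) ≤ ∏ i ∈ Finset.univ.erase j, bary v i :=
    Finset.prod_le_prod (fun _ _ => by positivity) hi
  rw [Finset.prod_const, Finset.card_erase_of_mem (Finset.mem_univ j)] at h1
  simp only [Finset.card_univ, Fintype.card_fin] at h1
  have h2 : (0:ℝ) ≤ (η / 4) ^ (4 - 1) := by positivity
  calc η ^ 3 / 256 = 1 / 4 * (η / 4) ^ (4 - 1) := by norm_num; ring
    _ ≤ _ := by gcongr

lemma ref_bub_le_one (v : Fin 3 → ℝ) (hv : v ∈ refTetrahedron) :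
    0 ≤ v 0 * v 1 * v 2 * (1 - v 0 - v 1 - v 2) ∧
      v 0 * v 1 * v 2 * (1 - v 0 - v 1 - v 2) ≤ 1 := by
  rw [mem_ref_iff] at hv
  rw [bub_eq]
  refine ⟨Finset.prod_nonneg fun i _ => hv i, Finset.prod_le_one (fun i _ => hv i) fun i _ => ?_⟩
  rw [← bary_sum v]
  exact Finset.single_le_sum (fun i _ => hv i) (Finset.mem_univ i)

lemma ref_compact : IsCompact refTetrahedron := by
  refine (isCompact_Icc (a := (0 : Fin 3 → ℝ)) (b := 1)).of_isClosed_subset ref_closed ?_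
  rintro v ⟨h, h'⟩
  refine ⟨h, fun i => ?_⟩
  have a0 := h 0
  have a1 := h 1
  have a2 := h 2
  fin_cases i <;> simp <;> linarith

lemma dens_est (α β : ℝ) (hα : -1 / 2 < α) (hαβ : α ≤ β) : ∃ c : ℝ, 0 < c ∧
    ∀ p : ℕ, 1 ≤ p → ∀ q : MvPolynomial (Fin 3) ℝ, q.totalDegree ≤ p →
      ∫⁻ z in refTetrahedron, dens α (fun v => MvPolynomial.eval v q) z ≠ ⊤ →
      ∫⁻ z in refTetrahedron, dens α (fun v => MvPolynomial.eval v q) z ≤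
        ENNReal.ofReal (c * (p : ℝ) ^ (6 * (β - α))) *
          ∫⁻ z in refTetrahedron, dens β (fun v => MvPolynomial.eval v q) z := by
  obtain ⟨ε, hε0, hε1, hex⟩ := unit_excl α hα (1 / 48) (by norm_num)
  refine ⟨2 * (256 / ε ^ 3) ^ (β - α), by positivity, ?_⟩
  intro p hp q hq hfin
  have hp' : (1 : ℝ) ≤ p := by exact_mod_cast hp
  have hp0 : (0 : ℝ) < p := by linarith
  set f : (Fin 3 → ℝ) → ℝ := fun v => MvPolynomial.eval v q with hf
  have hfm : Measurable f := (MvPolynomial.continuous_eval q).measurable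
  set η := ε / (p : ℝ) ^ 2 with hη
  have hη0 : 0 < η := by positivity
  have hη1 : η ≤ 1 := by
    rw [hη, div_le_one (by positivity)]; nlinarith
  set B : Equiv.Perm (Fin 4) → Set (Fin 3 → ℝ) := fun σ =>
    refTetrahedron ∩ {v | bary v (σ 0) < η * (bary v (σ 0) + bary v (σ 3))} with hB
  set G : Set (Fin 3 → ℝ) := refTetrahedron ∩
    {v | ∀ σ : Equiv.Perm (Fin 4), η * (bary v (σ 0) + bary v (σ 3)) ≤ bary v (σ 0)} with hG
  have hGc : IsClosed G := by
    refine ref_closed.inter ?_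
    have : {v | ∀ σ : Equiv.Perm (Fin 4), η * (bary v (σ 0) + bary v (σ 3)) ≤ bary v (σ 0)} =
      ⋂ σ : Equiv.Perm (Fin 4), {v | η * (bary v (σ 0) + bary v (σ 3)) ≤ bary v (σ 0)} := by
      ext v; simp
    rw [this]
    exact isClosed_iInter fun σ => isClosed_le
      (continuous_const.mul ((bary_cont _).add (bary_cont _))) (bary_cont _)
  have hcov : refTetrahedron ⊆ G ∪ ⋃ σ, B σ := by
    intro v hv
    by_cases h : ∀ σ : Equiv.Perm (Fin 4), η * (bary v (σ 0) + bary v (σ 3)) ≤ bary v (σ 0)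
    · exact Or.inl ⟨hv, h⟩
    · push Not at h
      obtain ⟨σ, hσ⟩ := h
      exact Or.inr (Set.mem_iUnion.2 ⟨σ, hv, hσ⟩)
  set I := ∫⁻ z in refTetrahedron, dens α f z with hI
  have hBs : ∀ σ, ∫⁻ z in B σ, dens α f z ≤ ENNReal.ofReal (1 / 48) * I := fun σ =>
    sym_excl α _ η hη1 p (fun r hr => hex p hp r hr) f hfm (eval_line q p hq) σ
  have hsum : ∫⁻ z in ⋃ σ, B σ, dens α f z ≤ ENNReal.ofReal (1 / 2) * I := by
    refine (lintegral_iUnion_le _ _).trans ?_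
    rw [tsum_fintype]
    refine (Finset.sum_le_sum fun σ _ => hBs σ).trans (le_of_eq ?_)
    rw [Finset.sum_const, Finset.card_univ, Fintype.card_perm, Fintype.card_fin, nsmul_eq_mul,
      ← mul_assoc]
    congr 1
    rw [← ENNReal.ofReal_natCast, ← ENNReal.ofReal_mul (by positivity)]
    congr 1
    norm_num [Nat.factorial]
  have hI1 : I ≤ (∫⁻ z in G, dens α f z) + ENNReal.ofReal (1 / 2) * I :=
    (lintegral_mono_set hcov).trans ((lintegral_union_le _ _ _).trans (by gcongr))
  have hI2 : I ≤ 2 * ∫⁻ z in G, dens α f z := by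
    have e : I = ENNReal.ofReal (1 / 2) * I + ENNReal.ofReal (1 / 2) * I := by
      rw [← add_mul, ← ENNReal.ofReal_add (by norm_num) (by norm_num)]
      norm_num
    have hne : ENNReal.ofReal (1 / 2) * I ≠ ⊤ := ENNReal.mul_ne_top ENNReal.ofReal_ne_top hfin
    have h3 : ENNReal.ofReal (1 / 2) * I ≤ ∫⁻ z in G, dens α f z := by
      have := hI1
      conv_lhs at this => rw [e]
      exact (ENNReal.add_le_add_iff_right hne).1 this
    rw [two_mul, e]
    gcongr
  set C := ((256 / ε ^ 3) ^ (β - α) * (p : ℝ) ^ (6 * (β - α))) with hC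
  have hC0 : 0 < C := by positivity
  have hGd : ∀ z ∈ G, dens α f z ≤ ENNReal.ofReal C * dens β f z := by
    rintro z ⟨hz, hzs⟩
    have hb := bub_lower z η hη0 hz hzs
    unfold dens
    rw [← ENNReal.ofReal_mul hC0.le]
    apply ENNReal.ofReal_le_ofReal
    set b := z 0 * z 1 * z 2 * (1 - z 0 - z 1 - z 2)
    have hb0 : 0 < b := lt_of_lt_of_le (by positivity) hb
    rw [← mul_assoc]
    gcongr
    have e1 : b ^ β = b ^ α * b ^ (β - α) := by rw [← Real.rpow_add hb0]; ring_nf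
    have e2 : C * (η ^ 3 / 256) ^ (β - α) = 1 := by
      have : (p : ℝ) ^ (6 * (β - α)) = ((p : ℝ) ^ 6) ^ (β - α) := by
        rw [Real.rpow_mul hp0.le]; norm_num
      rw [hC, this, ← Real.mul_rpow (by positivity) (by positivity),
        ← Real.mul_rpow (by positivity) (by positivity)]
      have : 256 / ε ^ 3 * (p : ℝ) ^ 6 * (η ^ 3 / 256) = 1 := by
        rw [hη]; field_simp
      rw [this, Real.one_rpow]
    have h3 : (η ^ 3 / 256) ^ (β - α) ≤ b ^ (β - α) :=
      Real.rpow_le_rpow (by positivity) hb (by linarith)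
    calc b ^ α = b ^ α * (C * (η ^ 3 / 256) ^ (β - α)) := by rw [e2, mul_one]
      _ ≤ b ^ α * (C * b ^ (β - α)) := by gcongr
      _ = C * b ^ β := by rw [e1]; ring
  calc I ≤ 2 * ∫⁻ z in G, dens α f z := hI2
    _ ≤ 2 * ∫⁻ z in G, ENNReal.ofReal C * dens β f z := by
      gcongr 2 * ?_
      exact setLIntegral_mono' hGc.measurableSet hGd
    _ = ENNReal.ofReal (2 * C) * ∫⁻ z in G, dens β f z := by
      rw [lintegral_const_mul' _ _ ENNReal.ofReal_ne_top, ENNReal.ofReal_mul zero_le_two, mul_assoc,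
        ENNReal.ofReal_ofNat]
    _ ≤ ENNReal.ofReal (2 * C) * ∫⁻ z in refTetrahedron, dens β f z := by
      gcongr
      exact Set.inter_subset_left
    _ = _ := by rw [hC, mul_assoc 2]

/-- $hp$-polynomial inverse estimate with bubbles on the
reference tetrahedron (Proposition 3.5 of the paper, d = 3, tetrahedron
case). -/
theorem bubble_inverse_estimate_tetrahedron (α β : ℝ) (hα : -1 / 2 < α) (hαβ : α ≤ β) :
    ∃ c : ℝ, 0 < c ∧
      ∀ p : ℕ, 1 ≤ p → ∀ q : MvPolynomial (Fin 3) ℝ, q.totalDegree ≤ p →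
        ∫ z in refTetrahedron,
            (z 0 * z 1 * z 2 * (1 - z 0 - z 1 - z 2)) ^ α *
              (MvPolynomial.eval z q) ^ 2 ≤
          c * (p : ℝ) ^ (6 * (β - α)) *
            ∫ z in refTetrahedron,
              (z 0 * z 1 * z 2 * (1 - z 0 - z 1 - z 2)) ^ β *
                (MvPolynomial.eval z q) ^ 2 := by
  obtain ⟨c, hc, hest⟩ := dens_est α β hα hαβ
  refine ⟨c, hc, fun p hp q hq => ?_⟩
  have hK : MeasurableSet refTetrahedron := ref_closed.measurableSet
  have hnn : ∀ γ : ℝ, ∀ z ∈ refTetrahedron, 0 ≤ (z 0 * z 1 * z 2 * (1 - z 0 - z 1 - z 2)) ^ γ *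
      (MvPolynomial.eval z q) ^ 2 := fun γ z hz =>
    mul_nonneg (Real.rpow_nonneg (ref_bub_le_one z hz).1 _) (sq_nonneg _)
  have hnn' : ∀ γ : ℝ, ∀ᵐ z ∂(volume.restrict refTetrahedron),
      0 ≤ (z 0 * z 1 * z 2 * (1 - z 0 - z 1 - z 2)) ^ γ * (MvPolynomial.eval z q) ^ 2 := fun γ =>
    (ae_restrict_iff' hK).2 (Filter.Eventually.of_forall (hnn γ))
  have hIβ0 : 0 ≤ ∫ z in refTetrahedron, (z 0 * z 1 * z 2 * (1 - z 0 - z 1 - z 2)) ^ β *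
      (MvPolynomial.eval z q) ^ 2 := integral_nonneg_of_ae (hnn' β)
  by_cases hIntg : IntegrableOn (fun z : Fin 3 → ℝ => (z 0 * z 1 * z 2 * (1 - z 0 - z 1 - z 2)) ^ α *
      (MvPolynomial.eval z q) ^ 2) refTetrahedron
  swap
  · rw [integral_undef hIntg]
    positivity
  have hqc : Continuous fun z : Fin 3 → ℝ => MvPolynomial.eval z q := MvPolynomial.continuous_eval q
  have hqm := hqc.measurable
  have hIntgβ : IntegrableOn (fun z : Fin 3 → ℝ => (z 0 * z 1 * z 2 * (1 - z 0 - z 1 - z 2)) ^ β *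
      (MvPolynomial.eval z q) ^ 2) refTetrahedron := by
    have hq2 : IntegrableOn (fun z : Fin 3 → ℝ => (MvPolynomial.eval z q) ^ 2) refTetrahedron :=
      (hqc.pow 2).continuousOn.integrableOn_compact ref_compact
    refine Integrable.mono' (hIntg.add hq2) (Measurable.aestronglyMeasurable (by fun_prop)) ?_
    refine (ae_restrict_iff' hK).2 (Filter.Eventually.of_forall fun z hz => ?_)
    rw [Real.norm_of_nonneg (hnn β z hz)]
    obtain ⟨h0, h1⟩ := ref_bub_le_one z hz
    simp only [Pi.add_apply]
    rcases h0.eq_or_lt with h | h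
    · have h3 : (z 0 * z 1 * z 2 * (1 - z 0 - z 1 - z 2)) ^ β ≤ 1 := by
        rw [← h]; exact Real.zero_rpow_le_one β
      have := hnn α z hz
      nlinarith [sq_nonneg (MvPolynomial.eval z q)]
    · have h3 := Real.rpow_le_rpow_of_exponent_ge h h1 hαβ
      nlinarith [sq_nonneg (MvPolynomial.eval z q)]
  have eα := ofReal_integral_eq_lintegral_ofReal hIntg (hnn' α)
  have eβ := ofReal_integral_eq_lintegral_ofReal hIntgβ (hnn' β)
  have hfin : ∫⁻ z in refTetrahedron, dens α (fun v => MvPolynomial.eval v q) z ≠ ⊤ := by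
    unfold dens
    rw [← eα]
    exact ENNReal.ofReal_ne_top
  have key := hest p hp q hq hfin
  unfold dens at key
  rw [← eα, ← eβ, ← ENNReal.ofReal_mul (by positivity)] at key
  exact (ENNReal.ofReal_le_ofReal_iff (by positivity)).1 key
end

section
/- There exists a constant c > 0 such that for every integer p ≥ 1 and every real polynomial q in two variables of total degree at most p, ∫_T ((∂_x q)(x,y)² + (∂_y q)(x,y)²) dx dy ≤ c · p⁴ · ∫_T q(x,y)² dx dy, where T = {(x,y) ∈ ℝ² : x ≥ 0, y ≥ 0, x + y ≤ 1}. -/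
open MeasureTheory

/-- The reference triangle `T = {(x,y) : x ≥ 0, y ≥ 0, x + y ≤ 1}`. -/
def refTriangle : Set (ℝ × ℝ) := {z | 0 ≤ z.1 ∧ 0 ≤ z.2 ∧ z.1 + z.2 ≤ 1}


namespace HpInv
open Polynomial

/-- Integral of a polynomial over `[0,1]`. -/
noncomputable def I (f : ℝ[X]) : ℝ := ∫ x in (0:ℝ)..1, f.eval x

lemma ii (f : ℝ[X]) (a b : ℝ) : IntervalIntegrable (fun x => f.eval x) volume a b :=
  f.continuous.intervalIntegrable a b

lemma I_add (f g : ℝ[X]) : I (f + g) = I f + I g := by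
  simp only [I, eval_add]
  exact intervalIntegral.integral_add (ii f 0 1) (ii g 0 1)

lemma I_C_mul (a : ℝ) (f : ℝ[X]) : I (C a * f) = a * I f := by
  simp [I]

lemma I_sq_nonneg (f : ℝ[X]) : 0 ≤ I (f * f) := by
  refine intervalIntegral.integral_nonneg (by norm_num) fun x _ => ?_
  rw [eval_mul]; exact mul_self_nonneg _

lemma I_deriv (h : ℝ[X]) : I (derivative h) = h.eval 1 - h.eval 0 :=
  intervalIntegral.integral_eq_sub_of_hasDerivAt (fun x _ => h.hasDerivAt x) (ii _ 0 1)

lemma I_parts (f g : ℝ[X]) :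
    I (derivative f * g) = f.eval 1 * g.eval 1 - f.eval 0 * g.eval 0 - I (f * derivative g) := by
  have h := I_deriv (f * g)
  rw [derivative_mul, I_add, eval_mul, eval_mul] at h
  linarith

/-- Real shifted Legendre polynomial. -/
noncomputable def P (n : ℕ) : ℝ[X] := (shiftedLegendre n).map (Int.castRingHom ℝ)

lemma P_natDegree (n : ℕ) : (P n).natDegree = n := by
  rw [P, natDegree_map_eq_of_injective Int.cast_injective, natDegree_shiftedLegendre]

lemma P_ne (n : ℕ) : (P n).coeff n ≠ 0 := by
  have : (n + n).choose n ≠ 0 := (Nat.choose_pos (by simp)).ne'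
  simp [P, coeff_shiftedLegendre, this]

lemma P_zero (n : ℕ) : (P n).eval 0 = 1 := by
  rw [← coeff_zero_eq_eval_zero]; simp [P, coeff_shiftedLegendre]

lemma P'_zero (n : ℕ) : (derivative (P n)).eval 0 = - (n * (n + 1)) := by
  rw [← coeff_zero_eq_eval_zero, coeff_derivative]; simp [P, coeff_shiftedLegendre]

lemma P_symm (n : ℕ) : C ((-1) ^ n) * (P n).comp (1 - X) = P n := by
  have := congrArg (Polynomial.map (Int.castRingHom ℝ)) (neg_one_pow_mul_shiftedLegendre_comp_one_sub_X_eq n)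
  simpa [P, Polynomial.map_comp] using this

lemma P_one (n : ℕ) : (P n).eval 1 = (-1) ^ n := by
  conv_lhs => rw [← P_symm n]
  simp [P_zero]

lemma P'_one (n : ℕ) : (derivative (P n)).eval 1 = (-1) ^ n * (n * (n + 1)) := by
  conv_lhs => rw [← P_symm n]
  rw [derivative_C_mul, derivative_comp]
  simp [P'_zero]

noncomputable def W (n : ℕ) : ℝ[X] := X ^ n * (1 - X) ^ n

lemma P_rodrigues (n : ℕ) : C (n.factorial : ℝ) * P n = derivative^[n] (W n) := by
  have := congrArg (Polynomial.map (Int.castRingHom ℝ)) (factorial_mul_shiftedLegendre_eq n)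
  rw [← iterate_derivative_map] at this
  simpa [P, W] using this

lemma W_eval (n k : ℕ) (hk : k < n) (x : ℝ) (hx : x = 0 ∨ x = 1) :
    (derivative^[k] (W n)).eval x = 0 := by
  rcases hx with rfl | rfl
  · have h : (X : ℝ[X]) ^ (n - k) ∣ derivative^[k] (W n) :=
      pow_sub_dvd_iterate_derivative_of_pow_dvd k (Dvd.intro _ rfl)
    obtain ⟨r, hr⟩ := h
    rw [hr]; simp; left; omega
  · have h : (1 - X : ℝ[X]) ^ (n - k) ∣ derivative^[k] (W n) :=
      pow_sub_dvd_iterate_derivative_of_pow_dvd k (Dvd.intro_left _ rfl)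
    obtain ⟨r, hr⟩ := h
    rw [hr]; simp; left; omega

lemma W_parts (n k : ℕ) (hk : k ≤ n) : ∀ g : ℝ[X],
    I (derivative^[k] (W n) * g) = (-1) ^ k * I (W n * derivative^[k] g) := by
  induction k with
  | zero => intro g; simp
  | succ k ih =>
    intro g
    rw [Function.iterate_succ_apply', I_parts, W_eval n k hk 0 (by simp),
      W_eval n k hk 1 (by simp), ih (by omega), ← Function.iterate_succ_apply, pow_succ]
    ring

lemma P_orth (n : ℕ) (g : ℝ[X]) (hg : g.natDegree < n) : I (P n * g) = 0 := by
  have h := W_parts n n le_rfl g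
  rw [← P_rodrigues, iterate_derivative_eq_zero hg, mul_assoc, I_C_mul] at h
  have h0 : (n.factorial : ℝ) ≠ 0 := by positivity
  have h1 : I 0 = 0 := by simp [I]
  rw [mul_zero, h1, mul_zero] at h
  exact (mul_eq_zero.1 h).resolve_left h0

lemma P'_norm (n : ℕ) : I (derivative (P n) * derivative (P n)) = 2 * n * (n + 1) := by
  rw [I_parts, P_orth', P_one, P_zero, P'_one, P'_zero]
  · have : ((-1 : ℝ) ^ n) * (-1) ^ n = 1 := by rw [← mul_pow]; simp
    linear_combination (n * (n + 1) : ℝ) * this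
where
  P_orth' : I (P n * derivative (derivative (P n))) = 0 := by
    rcases Nat.lt_or_ge n 1 with h | h
    · have : derivative (P n) = 0 := derivative_of_natDegree_zero (by rw [P_natDegree]; omega)
      simp [this, I]
    · apply P_orth
      have h1 := natDegree_derivative_le (P n)
      have h2 := natDegree_derivative_le (derivative (P n))
      rw [P_natDegree] at h1
      omega

lemma P_norm (n : ℕ) : (2 * n + 1) * I (P n * P n) = 1 := by
  have h1 := I_parts (P n) (X * P n)
  have e : derivative (X * P n) = P n + X * derivative (P n) := by simp [derivative_mul]
  have e2 : derivative (P n) * (X * P n) = P n * (X * derivative (P n)) := by ring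
  rw [e, mul_add, I_add, e2] at h1
  have h2 : I (P n * (X * derivative (P n))) = n * I (P n * P n) := by
    rcases Nat.eq_zero_or_pos n with rfl | hn
    · have : derivative (P 0) = 0 := derivative_of_natDegree_zero (by rw [P_natDegree])
      simp [this, I]
    · have h3 : I (P n * (X * derivative (P n) + C (-(n:ℝ)) * P n)) = 0 := by
        apply P_orth
        have : (X * derivative (P n) + C (-(n:ℝ)) * P n).natDegree ≤ n - 1 := by
          rw [natDegree_le_iff_coeff_eq_zero]
          intro N hN
          obtain ⟨m, rfl⟩ : ∃ m, N = m + 1 := ⟨N - 1, by omega⟩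
          rw [coeff_add, coeff_X_mul, coeff_derivative, coeff_C_mul]
          rcases Nat.lt_or_ge n (m + 1) with h | h
          · rw [coeff_eq_zero_of_natDegree_lt (by rw [P_natDegree]; exact h)]; ring
          · have : n = m + 1 := by omega
            subst this; push_cast; ring
        omega
      rw [mul_add, I_add, mul_left_comm (P n) (C _), I_C_mul] at h3
      linarith
  rw [h2, P_one] at h1
  have : ((-1 : ℝ) ^ n) * (-1) ^ n = 1 := by rw [← mul_pow]; simp
  simp only [eval_mul, eval_X, P_one] at h1
  linarith

lemma markov (n : ℕ) : ∀ f : ℝ[X], f.natDegree ≤ n →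
    I (derivative f * derivative f) ≤ (n + 1) ^ 4 * I (f * f) := by
  induction n with
  | zero =>
    intro f hf
    rw [derivative_of_natDegree_zero (by omega)]
    have := I_sq_nonneg f
    have h1 : I 0 = 0 := by simp [I]
    simpa [h1] using this
  | succ m ih =>
    intro f hf
    set n := m + 1 with hn
    set a : ℝ := f.coeff n / (P n).coeff n with ha
    obtain ⟨g, hg⟩ : ∃ g, g = f + C (-a) * P n := ⟨_, rfl⟩
    have hgd : g.natDegree ≤ m := by
      rw [natDegree_le_iff_coeff_eq_zero]
      intro N hN
      rw [hg, coeff_add, coeff_C_mul]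
      rcases Nat.lt_or_ge n N with h | h
      · rw [coeff_eq_zero_of_natDegree_lt (lt_of_le_of_lt hf h),
          coeff_eq_zero_of_natDegree_lt (by rw [P_natDegree]; exact h)]; simp
      · have : N = n := by omega
        subst this
        rw [ha]; have := P_ne n; field_simp; simp
    have hf' : f = g + C a * P n := by rw [hg, C_neg]; ring
    have hP := P_norm n
    have hP' := P'_norm n
    have ho := P_orth n g (by omega)
    have hi := ih g hgd
    set s : ℝ := 2 * n * (n + 1) * (2 * n + 1) with hs
    set S : ℝ := ((m:ℝ) + 1) ^ 4 with hS
    have hS0 : 0 < S := by positivity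
    have hs0 : 0 < s := by positivity
    have e1 : I (f * f) = I (g * g) + a ^ 2 * I (P n * P n) := by
      have : f * f = g * g + (C (2 * a) * (P n * g) + C (a ^ 2) * (P n * P n)) := by
        rw [hf', C_mul, C_pow]; simp only [map_ofNat]; ring
      rw [this, I_add, I_add, I_C_mul, I_C_mul, ho]; ring
    have e2 : I (derivative f * derivative f) = I (derivative g * derivative g) +
        2 * a * I (derivative g * derivative (P n)) + a ^ 2 * (2 * n * (n + 1)) := by
      have : derivative f * derivative f = derivative g * derivative g +
          (C (2 * a) * (derivative g * derivative (P n)) +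
            C (a ^ 2) * (derivative (P n) * derivative (P n))) := by
        rw [hf', C_mul, C_pow]; simp only [map_ofNat, derivative_add, derivative_C_mul]; ring
      rw [this, I_add, I_add, I_C_mul, I_C_mul, hP']; ring
    have e3 := I_sq_nonneg (C s * derivative g + C (-(S * a)) * derivative (P n))
    have e4 : (C s * derivative g + C (-(S * a)) * derivative (P n)) *
        (C s * derivative g + C (-(S * a)) * derivative (P n)) =
        C (s ^ 2) * (derivative g * derivative g) +
          (C (-(2 * s * S * a)) * (derivative g * derivative (P n)) +
          C (S ^ 2 * a ^ 2) * (derivative (P n) * derivative (P n))) := by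
      simp only [C_mul, C_pow, C_neg, map_ofNat]; ring
    rw [e4, I_add, I_add, I_C_mul, I_C_mul, I_C_mul, hP'] at e3
    have hnn : (n : ℝ) = m + 1 := by rw [hn]; push_cast; ring
    have hSs : S + s ≤ ((n : ℝ) + 1) ^ 4 := by
      rw [hS, hs, hnn]
      have : (0:ℝ) ≤ m := by positivity
      nlinarith
    have hff := I_sq_nonneg f
    refine le_trans ?_ (mul_le_mul_of_nonneg_right hSs hff)
    have hPv : I (P n * P n) = 1 / (2 * n + 1) := by
      field_simp; linarith
    set G := I (derivative g * derivative g)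
    set M := I (derivative g * derivative (P n))
    set N := I (g * g)
    have hk : (2 * (n:ℝ) * (n + 1)) = s * I (P n * P n) := by
      rw [hPv, hs]; field_simp
    rw [e1, e2, hk]
    rw [hk] at e3
    set K := I (P n * P n)
    have key : s * S * (G + 2 * a * M + a ^ 2 * (s * K)) ≤ s * S * ((S + s) * (N + a ^ 2 * K)) := by
      have h5 : s * (S + s) * G ≤ s * (S + s) * (S * N) :=
        mul_le_mul_of_nonneg_left hi (by positivity)
      nlinarith
    exact le_of_mul_le_mul_left key (by positivity)

lemma markov_half (n : ℕ) (f : ℝ[X]) (hf : f.natDegree ≤ n) :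
    ∫ x in (0:ℝ)..(1/2), (derivative f).eval x ^ 2 ≤
      4 * (n + 1) ^ 4 * ∫ x in (0:ℝ)..(1/2), f.eval x ^ 2 := by
  have h := markov n (f.comp (X * C (1/2))) (by
    rw [natDegree_comp, natDegree_X_mul (by simp), natDegree_C]; simpa using hf)
  have e1 : I (f.comp (X * C (1/2)) * f.comp (X * C (1/2))) =
      2 * ∫ x in (0:ℝ)..(1/2), f.eval x ^ 2 := by
    have := intervalIntegral.integral_comp_mul_left (a := 0) (b := 1) (c := (1/2 : ℝ))
      (fun x => f.eval x ^ 2) (by norm_num)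
    simp [I, ← pow_two] at this ⊢
    exact this
  have e2 : I (derivative (f.comp (X * C (1/2))) * derivative (f.comp (X * C (1/2)))) =
      1 / 2 * ∫ x in (0:ℝ)..(1/2), (derivative f).eval x ^ 2 := by
    have := intervalIntegral.integral_comp_mul_left (a := 0) (b := 1) (c := (1/2 : ℝ))
      (fun x => (derivative f).eval x ^ 2) (by norm_num)
    have e : derivative (f.comp (X * C (1/2))) * derivative (f.comp (X * C (1/2))) =
      C (1/4) * ((derivative f).comp (X * C (1/2)) * (derivative f).comp (X * C (1/2))) := by
      rw [derivative_comp]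
      simp only [derivative_mul, derivative_X, derivative_C, one_mul, mul_zero, add_zero]
      rw [show (1/4 : ℝ) = 1/2 * (1/2) by norm_num, C_mul]; ring
    rw [e, I_C_mul]
    simp [I, ← pow_two] at this ⊢
    rw [this]; ring
  rw [e1, e2] at h
  linarith

/-- Evaluation of a bivariate polynomial at a point of the plane. -/
noncomputable def ev (q : MvPolynomial (Fin 2) ℝ) (z : ℝ × ℝ) : ℝ :=
  MvPolynomial.eval ![z.1, z.2] q

lemma ev_cont (q : MvPolynomial (Fin 2) ℝ) : Continuous (ev q) := by
  have h : Continuous fun z : ℝ × ℝ => (![z.1, z.2] : Fin 2 → ℝ) := by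
    refine continuous_pi fun i => ?_
    fin_cases i
    · exact continuous_fst
    · exact continuous_snd
  exact (MvPolynomial.continuous_eval q).comp h

/-- Directional derivative. -/
noncomputable def dir (u : ℝ × ℝ) (q : MvPolynomial (Fin 2) ℝ) (z : ℝ × ℝ) : ℝ :=
  u.1 * ev (MvPolynomial.pderiv 0 q) z + u.2 * ev (MvPolynomial.pderiv 1 q) z

lemma dir_cont (u : ℝ × ℝ) (q : MvPolynomial (Fin 2) ℝ) : Continuous (dir u q) :=
  (continuous_const.mul (ev_cont _)).add (continuous_const.mul (ev_cont _))

noncomputable def sl (a u : ℝ × ℝ) : Fin 2 → ℝ[X] :=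
  ![C u.1 * X + C a.1, C u.2 * X + C a.2]

lemma sl_eval (a u : ℝ × ℝ) (q : MvPolynomial (Fin 2) ℝ) (t : ℝ) :
    (MvPolynomial.aeval (sl a u) q).eval t = ev q (a + t • u) := by
  induction q using MvPolynomial.induction_on with
  | C c => simp [ev, ← algebraMap_eq]
  | add f g hf hg => simp only [ev, map_add, eval_add] at *; rw [hf, hg]
  | mul_X f i hf =>
    simp only [ev, map_mul, eval_mul] at *
    rw [hf]
    congr 1
    fin_cases i <;> simp [sl] <;> ring

lemma sl_deriv (a u : ℝ × ℝ) (q : MvPolynomial (Fin 2) ℝ) :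
    derivative (MvPolynomial.aeval (sl a u) q) =
      C u.1 * MvPolynomial.aeval (sl a u) (MvPolynomial.pderiv 0 q) +
      C u.2 * MvPolynomial.aeval (sl a u) (MvPolynomial.pderiv 1 q) := by
  induction q using MvPolynomial.induction_on with
  | C c => simp [algebraMap_eq]
  | add f g hf hg => simp only [map_add, hf, hg]; ring
  | mul_X f i hf =>
    have h0 : derivative (sl a u i) = C u.1 * (if i = 0 then 1 else 0) + C u.2 * (if i = 1 then 1 else 0) := by
      fin_cases i <;> simp [sl]
    rw [map_mul, derivative_mul, hf, MvPolynomial.aeval_X, h0]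
    simp only [Derivation.leibniz, MvPolynomial.pderiv_X, smul_eq_mul, map_add, map_mul,
      MvPolynomial.aeval_X]
    fin_cases i <;> simp <;> ring

lemma sl_deriv_eval (a u : ℝ × ℝ) (q : MvPolynomial (Fin 2) ℝ) (t : ℝ) :
    (derivative (MvPolynomial.aeval (sl a u) q)).eval t = dir u q (a + t • u) := by
  rw [sl_deriv, eval_add, eval_mul, eval_mul, sl_eval, sl_eval, eval_C, eval_C, dir]

lemma slice (p : ℕ) (q : MvPolynomial (Fin 2) ℝ) (hq : q.totalDegree ≤ p) (a u : ℝ × ℝ) :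
    ∫ t in Set.Icc (0:ℝ) (1/2), dir u q (a + t • u) ^ 2 ≤
      4 * (p + 1) ^ 4 * ∫ t in Set.Icc (0:ℝ) (1/2), ev q (a + t • u) ^ 2 := by
  have h := markov_half p (MvPolynomial.aeval (sl a u) q) (by
    have := MvPolynomial.aeval_natDegree_le (n := 1) q hq (sl a u) (by
      intro i; fin_cases i <;> exact natDegree_linear_le)
    simpa using this)
  simp only [sl_eval, sl_deriv_eval] at h
  rwa [intervalIntegral.integral_of_le (by norm_num), intervalIntegral.integral_of_le (by norm_num),
    ← integral_Icc_eq_integral_Ioc, ← integral_Icc_eq_integral_Ioc] at h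

abbrev Q : Set (ℝ × ℝ) := Set.Icc (0:ℝ) (1/2) ×ˢ Set.Icc (0:ℝ) (1/2)

lemma Q_compact : IsCompact Q := isCompact_Icc.prod isCompact_Icc

lemma square_v (p : ℕ) (q : MvPolynomial (Fin 2) ℝ) (hq : q.totalDegree ≤ p) (a u v : ℝ × ℝ) :
    ∫ z in Q, dir v q (a + z.1 • u + z.2 • v) ^ 2 ≤
      4 * (p + 1) ^ 4 * ∫ z in Q, ev q (a + z.1 • u + z.2 • v) ^ 2 := by
  have c1 : Continuous fun z : ℝ × ℝ => dir v q (a + z.1 • u + z.2 • v) ^ 2 :=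
    ((dir_cont v q).comp (by fun_prop)).pow 2
  have c2 : Continuous fun z : ℝ × ℝ => ev q (a + z.1 • u + z.2 • v) ^ 2 :=
    ((ev_cont q).comp (by fun_prop)).pow 2
  have i1 := c1.continuousOn.integrableOn_compact (μ := volume) Q_compact
  have i2 := c2.continuousOn.integrableOn_compact (μ := volume) Q_compact
  rw [Measure.volume_eq_prod] at i1 i2 ⊢
  rw [setIntegral_prod _ i1, setIntegral_prod _ i2, ← integral_const_mul]
  rw [IntegrableOn, ← Measure.prod_restrict] at i1 i2
  refine integral_mono i1.integral_prod_left (i2.integral_prod_left.const_mul _) fun x => ?_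
  exact slice p q hq (a + x • u) v

lemma square_u (p : ℕ) (q : MvPolynomial (Fin 2) ℝ) (hq : q.totalDegree ≤ p) (a u v : ℝ × ℝ) :
    ∫ z in Q, dir u q (a + z.1 • u + z.2 • v) ^ 2 ≤
      4 * (p + 1) ^ 4 * ∫ z in Q, ev q (a + z.1 • u + z.2 • v) ^ 2 := by
  have h := square_v p q hq a v u
  have s : ∀ f : ℝ × ℝ → ℝ, ∫ z in Q, f z.swap = ∫ z in Q, f z := fun f =>
    setIntegral_prod_swap _ _ f
  rw [← s, ← s (fun z => ev q (a + z.1 • v + z.2 • u) ^ 2)] at h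
  simpa only [Prod.fst_swap, Prod.snd_swap, add_right_comm] using h

/-- squared gradient -/
noncomputable def gr (q : MvPolynomial (Fin 2) ℝ) (z : ℝ × ℝ) : ℝ :=
  ev (MvPolynomial.pderiv 0 q) z ^ 2 + ev (MvPolynomial.pderiv 1 q) z ^ 2

lemma gr_cont (q : MvPolynomial (Fin 2) ℝ) : Continuous (gr q) :=
  ((ev_cont _).pow 2).add ((ev_cont _).pow 2)

lemma gr_nonneg (q : MvPolynomial (Fin 2) ℝ) (z : ℝ × ℝ) : 0 ≤ gr q z := by
  unfold gr; positivity

lemma square (p : ℕ) (q : MvPolynomial (Fin 2) ℝ) (hq : q.totalDegree ≤ p) (a u v : ℝ × ℝ)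
    (huv : ∀ z, gr q z ≤ 3 * (dir u q z ^ 2 + dir v q z ^ 2)) :
    ∫ z in Q, gr q (a + z.1 • u + z.2 • v) ≤
      24 * (p + 1) ^ 4 * ∫ z in Q, ev q (a + z.1 • u + z.2 • v) ^ 2 := by
  have h1 := square_u p q hq a u v
  have h2 := square_v p q hq a u v
  have c1 : Continuous fun z : ℝ × ℝ => dir v q (a + z.1 • u + z.2 • v) ^ 2 :=
    ((dir_cont v q).comp (by fun_prop)).pow 2
  have c2 : Continuous fun z : ℝ × ℝ => dir u q (a + z.1 • u + z.2 • v) ^ 2 :=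
    ((dir_cont u q).comp (by fun_prop)).pow 2
  have c3 : Continuous fun z : ℝ × ℝ => gr q (a + z.1 • u + z.2 • v) :=
    (gr_cont q).comp (by fun_prop)
  have i1 := c1.continuousOn.integrableOn_compact (μ := volume) Q_compact
  have i2 := c2.continuousOn.integrableOn_compact (μ := volume) Q_compact
  have i3 := c3.continuousOn.integrableOn_compact (μ := volume) Q_compact
  have h3 : ∫ z in Q, gr q (a + z.1 • u + z.2 • v) ≤
      ∫ z in Q, 3 * (dir u q (a + z.1 • u + z.2 • v) ^ 2 + dir v q (a + z.1 • u + z.2 • v) ^ 2) :=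
    integral_mono i3 ((i2.add i1).const_mul 3) fun z => huv _
  rw [integral_const_mul, integral_add i2 i1] at h3
  linarith

lemma T_compact : IsCompact refTriangle := by
  refine (isCompact_Icc (a := ((0:ℝ), (0:ℝ))) (b := ((1:ℝ), (1:ℝ)))).of_isClosed_subset ?_ ?_
  · exact (isClosed_le continuous_const continuous_fst).inter
      ((isClosed_le continuous_const continuous_snd).inter
        (isClosed_le (continuous_fst.add continuous_snd) continuous_const))
  · rintro ⟨x, y⟩ ⟨h1, h2, h3⟩
    simp only at h1 h2 h3
    exact ⟨⟨h1, h2⟩, ⟨by simp only; linarith, by simp only; linarith⟩⟩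

/-- One parallelogram piece. -/
lemma piece (p : ℕ) (q : MvPolynomial (Fin 2) ℝ) (hq : q.totalDegree ≤ p) (a u v : ℝ × ℝ)
    (huv : ∀ z, gr q z ≤ 3 * (dir u q z ^ 2 + dir v q z ^ 2)) (φ : ℝ × ℝ → ℝ × ℝ)
    (hφ : ∀ z, φ z = a + z.1 • u + z.2 • v) (hinv : ∀ z, φ (φ z) = z)
    (hm : MeasurePreserving φ volume volume) (hT : φ ⁻¹' Q ⊆ refTriangle) :
    ∫ z in φ ⁻¹' Q, gr q z ≤ 24 * (p + 1) ^ 4 * ∫ z in refTriangle, ev q z ^ 2 := by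
  have he : MeasurableEmbedding φ :=
    (MeasurableEquiv.mk ⟨φ, φ, hinv, hinv⟩ hm.measurable hm.measurable).measurableEmbedding
  have h1 := hm.setIntegral_preimage_emb he (fun z => gr q (φ z)) Q
  have h2 := hm.setIntegral_preimage_emb he (fun z => ev q (φ z) ^ 2) Q
  simp only [hinv] at h1 h2
  have h3 := square p q hq a u v huv
  simp only [← hφ] at h3
  rw [h1]
  refine h3.trans (mul_le_mul_of_nonneg_left ?_ (by positivity))
  rw [← h2]
  exact setIntegral_mono_set
    (((ev_cont q).pow 2).continuousOn.integrableOn_compact T_compact)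
    (Filter.Eventually.of_forall fun z => sq_nonneg _) hT.eventuallyLE

lemma mp_flip : MeasurePreserving (fun z : ℝ × ℝ => (z.1, 1 - z.1 - z.2)) volume volume := by
  rw [Measure.volume_eq_prod]
  refine MeasurePreserving.skew_product (g := fun x y => 1 - x - y) (MeasurePreserving.id _) ?_ ?_
  · exact (by fun_prop : Measurable fun z : ℝ × ℝ => 1 - z.1 - z.2)
  · exact Filter.Eventually.of_forall fun x =>
      (Measure.measurePreserving_sub_left volume (1 - x)).map_eq

lemma mp_swap : MeasurePreserving (Prod.swap : ℝ × ℝ → ℝ × ℝ) volume volume := by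
  rw [Measure.volume_eq_prod]; exact Measure.measurePreserving_swap

lemma mp_flip' : MeasurePreserving (fun z : ℝ × ℝ => (1 - z.1 - z.2, z.2)) volume volume := by
  have := (mp_swap.comp mp_flip).comp mp_swap
  convert this using 2 with z
  simp; ring

lemma cover (f : ℝ × ℝ → ℝ) (hf : ∀ z, 0 ≤ f z) {S A B D : Set (ℝ × ℝ)} (h : S ⊆ (A ∪ B) ∪ D)
    (hA : IntegrableOn f A) (hB : IntegrableOn f B) (hD : IntegrableOn f D) :
    ∫ z in S, f z ≤ (∫ z in A, f z) + (∫ z in B, f z) + ∫ z in D, f z := by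
  have hle : (volume.restrict S : Measure (ℝ × ℝ)) ≤
      (volume.restrict A + volume.restrict B) + volume.restrict D :=
    (Measure.restrict_mono h le_rfl).trans ((Measure.restrict_union_le _ _).trans
      (add_le_add (Measure.restrict_union_le _ _) le_rfl))
  have hAB : Integrable f (volume.restrict A + volume.restrict B) := Integrable.add_measure hA hB
  rw [← integral_add_measure hA hB, ← integral_add_measure hAB hD]
  exact integral_mono_measure hle (Filter.Eventually.of_forall hf) (hAB.add_measure hD)

lemma main (p : ℕ) (q : MvPolynomial (Fin 2) ℝ) (hq : q.totalDegree ≤ p) :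
    ∫ z in refTriangle, gr q z ≤
      72 * (p + 1) ^ 4 * ∫ z in refTriangle, ev q z ^ 2 := by
  have t0 : id ⁻¹' Q ⊆ refTriangle := by
    rintro ⟨x, y⟩ ⟨⟨h1, h2⟩, h3, h4⟩
    simp only [id] at h1 h2 h3 h4
    exact ⟨h1, h3, by simp only; linarith⟩
  have k0 := piece p q hq (0, 0) (1, 0) (0, 1)
    (fun z => by
      simp only [gr, dir]
      generalize ev (MvPolynomial.pderiv 0 q) z = A
      generalize ev (MvPolynomial.pderiv 1 q) z = B
      nlinarith [sq_nonneg A, sq_nonneg B])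
    id (fun z => by ext <;> simp) (fun z => rfl) (MeasurePreserving.id _) t0
  have t1 : (fun z : ℝ × ℝ => (z.1, 1 - z.1 - z.2)) ⁻¹' Q ⊆ refTriangle := by
    rintro ⟨x, y⟩ ⟨⟨h1, h2⟩, h3, h4⟩
    simp only at h1 h2 h3 h4
    exact ⟨h1, by simp only; linarith, by simp only; linarith⟩
  have k1 := piece p q hq (0, 1) (1, -1) (0, -1)
    (fun z => by
      simp only [gr, dir]
      generalize ev (MvPolynomial.pderiv 0 q) z = A
      generalize ev (MvPolynomial.pderiv 1 q) z = B
      nlinarith [sq_nonneg (2 * A - 3 * B)])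
    (fun z => (z.1, 1 - z.1 - z.2)) (fun z => by ext <;> simp; ring) (fun z => by ext <;> simp)
    mp_flip t1
  have t2 : (fun z : ℝ × ℝ => (1 - z.1 - z.2, z.2)) ⁻¹' Q ⊆ refTriangle := by
    rintro ⟨x, y⟩ ⟨⟨h1, h2⟩, h3, h4⟩
    simp only at h1 h2 h3 h4
    exact ⟨by simp only; linarith, h3, by simp only; linarith⟩
  have k2 := piece p q hq (1, 0) (-1, 0) (-1, 1)
    (fun z => by
      simp only [gr, dir]
      generalize ev (MvPolynomial.pderiv 0 q) z = A
      generalize ev (MvPolynomial.pderiv 1 q) z = B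
      nlinarith [sq_nonneg (3 * A - 2 * B)])
    (fun z => (1 - z.1 - z.2, z.2)) (fun z => by ext <;> simp; ring) (fun z => by ext <;> simp; ring)
    mp_flip' t2
  have hcov : refTriangle ⊆ (id ⁻¹' Q ∪ (fun z : ℝ × ℝ => (z.1, 1 - z.1 - z.2)) ⁻¹' Q) ∪
      (fun z : ℝ × ℝ => (1 - z.1 - z.2, z.2)) ⁻¹' Q := by
    rintro ⟨x, y⟩ ⟨h1, h2, h3⟩
    simp only at h1 h2 h3
    simp only [Set.mem_union, Set.mem_preimage, Set.mem_prod, Set.mem_Icc, id]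
    rcases le_or_gt x (1/2) with hx | hx
    · rcases le_or_gt y (1/2) with hy | hy
      · left; left; exact ⟨⟨h1, hx⟩, h2, hy⟩
      · left; right; exact ⟨⟨h1, hx⟩, by linarith, by linarith⟩
    · right; exact ⟨⟨by linarith, by linarith⟩, h2, by linarith⟩
  have hi : ∀ s : Set (ℝ × ℝ), s ⊆ refTriangle → IntegrableOn (gr q) s := fun s h =>
    ((gr_cont q).continuousOn.integrableOn_compact T_compact).mono_set h
  have hc := cover (gr q) (gr_nonneg q) hcov (hi _ t0) (hi _ t1) (hi _ t2)
  linarith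

end HpInv

/-- $hp$-explicit H¹-to-L² polynomial inverse estimate on the
reference triangle (inequality (3.4) of Proposition 3.2 of the paper,
squared form). -/
theorem h1_inverse_estimate_triangle :
    ∃ c : ℝ, 0 < c ∧
      ∀ p : ℕ, 1 ≤ p → ∀ q : MvPolynomial (Fin 2) ℝ, q.totalDegree ≤ p →
        ∫ z in refTriangle,
            ((MvPolynomial.eval ![z.1, z.2] (MvPolynomial.pderiv 0 q)) ^ 2 +
              (MvPolynomial.eval ![z.1, z.2] (MvPolynomial.pderiv 1 q)) ^ 2) ≤
          c * (p : ℝ) ^ 4 *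
            ∫ z in refTriangle, (MvPolynomial.eval ![z.1, z.2] q) ^ 2 := by
  refine ⟨1152, by norm_num, fun p hp q hq => ?_⟩
  refine (HpInv.main p q hq).trans (mul_le_mul_of_nonneg_right ?_
    (integral_nonneg fun z => sq_nonneg _))
  have h1 : (1:ℝ) ≤ p := by exact_mod_cast hp
  have h2 : ((p:ℝ) + 1) ^ 4 ≤ (2 * p) ^ 4 := by gcongr; linarith
  rw [mul_pow] at h2
  linarith
end
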